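/- Let A ⊂ X and let x ∈ X∖A be such that A is 1-thin at x. Then there exist R > 0 and sets E₀, E₁ ⊂ X such that: χ_{E₀}, χ_{E₁} ∈ BV(X); χ_{E₀} and χ_{E₁} are 1-superminimizers in B(x,R); max{χ_{E₀}^∧, χ_{E₁}^∧} = 1 at every point of A ∩ B(x,R); χ_{E₀}^∨(x) = 0 = χ_{E₁}^∨(x); the set {max{χ_{E₀}^∨, χ_{E₁}^∨} > 0} is 1-thin at x; and lim_{r→0} r·P(E₀,B(x,r))/μ(B(x,r)) = 0 and lim_{r→0} r·P(E₁,B(x,r))/μ(B(x,r)) = 0. (Strengthened weak Cartan property.) -/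

import Mathlib

open MeasureTheory Metric Filter Set
open scoped ENNReal NNReal Topology

noncomputable section

namespace MetricBV

variable {X : Type*} [MetricSpace X] [MeasurableSpace X]

/-- A rectifiable curve, encoded as a Lipschitz map on the interval `[0,1]`
(every rectifiable curve admits such a reparametrization). -/
structure Curve (X : Type*) [MetricSpace X] where
  toFun : ℝ → X
  lipschitz : ∃ K : ℝ≥0, LipschitzOnWith K toFun (Set.Icc 0 1)

/-- The metric speed of a curve at a point. -/
def speed (γ : ℝ → X) (t : ℝ) : ℝ≥0∞ :=
  Filter.limsup (fun h : ℝ => ENNReal.ofReal (dist (γ (t + h)) (γ t) / |h|)) (𝓝[≠] (0 : ℝ))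

/-- The curve integral `∫_γ g ds`. -/
def curveIntegral (g : X → ℝ≥0∞) (γ : Curve X) : ℝ≥0∞ :=
  ∫⁻ t in Set.Icc (0 : ℝ) 1, g (γ.toFun t) * speed γ.toFun t

/-- A curve lies in a set `Ω`. -/
def Curve.In (γ : Curve X) (Ω : Set X) : Prop :=
  ∀ t ∈ Set.Icc (0 : ℝ) 1, γ.toFun t ∈ Ω

/-- The 1-modulus of a family of curves. -/
def Mod1 (μ : Measure X) (Γ : Set (Curve X)) : ℝ≥0∞ :=
  ⨅ (ρ : X → ℝ≥0∞) (_ : Measurable ρ) (_ : ∀ γ ∈ Γ, 1 ≤ curveIntegral ρ γ),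
    ∫⁻ x, ρ x ∂μ

/-- `g` is an upper gradient of `u` in `Ω`: the upper gradient inequality holds
along every curve contained in `Ω`. -/
def IsUpperGradientOn (g : X → ℝ≥0∞) (u : X → ℝ) (Ω : Set X) : Prop :=
  ∀ γ : Curve X, γ.In Ω →
    ENNReal.ofReal |u (γ.toFun 1) - u (γ.toFun 0)| ≤ curveIntegral g γ

/-- `g` is a 1-weak upper gradient of `u` in `Ω`: the upper gradient inequality holds
along every curve in `Ω` outside a family of zero 1-modulus. -/
def IsWeakUpperGradientOn (μ : Measure X) (g : X → ℝ≥0∞) (u : X → ℝ) (Ω : Set X) : Prop :=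
  ∃ Γ : Set (Curve X), Mod1 μ Γ = 0 ∧
    ∀ γ : Curve X, γ ∉ Γ → γ.In Ω →
      ENNReal.ofReal |u (γ.toFun 1) - u (γ.toFun 0)| ≤ curveIntegral g γ

/-- Membership in the Newtonian space `N^{1,1}(X)`. -/
def MemN11 (μ : Measure X) (u : X → ℝ) : Prop :=
  Integrable u μ ∧ ∃ g : X → ℝ≥0∞, Measurable g ∧
    IsWeakUpperGradientOn μ g u Set.univ ∧ ∫⁻ x, g x ∂μ < ⊤

/-- The 1-capacity `cap₁(A) = inf ‖u‖_{N^{1,1}(X)}` over `u ∈ N^{1,1}(X)` with `u ≥ 1` on `A`. -/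
def cap1 (μ : Measure X) (A : Set X) : ℝ≥0∞ :=
  ⨅ (u : X → ℝ) (_ : MemN11 μ u) (_ : ∀ x ∈ A, 1 ≤ u x)
    (g : X → ℝ≥0∞) (_ : Measurable g) (_ : IsWeakUpperGradientOn μ g u Set.univ),
    (∫⁻ x, ENNReal.ofReal |u x| ∂μ + ∫⁻ x, g x ∂μ)

/-- The variational 1-capacity `cap₁(A,Ω) = inf ∫ g_u dμ` over `u ∈ N^{1,1}(X)` with
`u ≥ 1` on `A` and `u = 0` on `X ∖ Ω`. -/
def vcap1 (μ : Measure X) (A Ω : Set X) : ℝ≥0∞ :=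
  ⨅ (u : X → ℝ) (_ : MemN11 μ u) (_ : ∀ x ∈ A, 1 ≤ u x) (_ : ∀ x ∈ Ωᶜ, u x = 0)
    (g : X → ℝ≥0∞) (_ : Measurable g) (_ : IsWeakUpperGradientOn μ g u Set.univ),
    ∫⁻ x, g x ∂μ

/-- Locally Lipschitz in `Ω`: Lipschitz on every compact subset of `Ω`. -/
def LocLipschitzOn (u : X → ℝ) (Ω : Set X) : Prop :=
  ∀ K : Set X, IsCompact K → K ⊆ Ω → ∃ L : ℝ≥0, LipschitzOnWith L u K

/-- Convergence `v i → u` in `L¹_loc(Ω)`. -/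
def TendstoL1Loc (μ : Measure X) (v : ℕ → X → ℝ) (u : X → ℝ) (Ω : Set X) : Prop :=
  ∀ K : Set X, IsCompact K → K ⊆ Ω →
    Filter.Tendsto (fun i => ∫⁻ x in K, ENNReal.ofReal |v i x - u x| ∂μ)
      Filter.atTop (𝓝 0)

/-- The total variation `‖Du‖(Ω)` of `u` in an open set `Ω`: the infimum of
`liminf ∫_Ω g_i dμ` over sequences of locally Lipschitz functions `v i → u` in `L¹_loc(Ω)`
with `g i` a 1-weak upper gradient of `v i` in `Ω`. -/
def tv (μ : Measure X) (u : X → ℝ) (Ω : Set X) : ℝ≥0∞ :=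
  ⨅ (v : ℕ → X → ℝ) (_ : ∀ i, LocLipschitzOn (v i) Ω) (_ : TendstoL1Loc μ v u Ω)
    (g : ℕ → X → ℝ≥0∞) (_ : ∀ i, Measurable (g i))
    (_ : ∀ i, IsWeakUpperGradientOn μ (g i) (v i) Ω),
    Filter.liminf (fun i => ∫⁻ x in Ω, g i x ∂μ) Filter.atTop

/-- The total variation `‖Du‖(A)` for an arbitrary set `A`. -/
def tvs (μ : Measure X) (u : X → ℝ) (A : Set X) : ℝ≥0∞ :=
  ⨅ (U : Set X) (_ : IsOpen U) (_ : A ⊆ U), tv μ u U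

/-- The characteristic function of a set, as a real-valued function. -/
def chi (E : Set X) : X → ℝ := Set.indicator E fun _ => (1 : ℝ)

/-- The perimeter `P(E,Ω) = ‖Dχ_E‖(Ω)` of `E` in an open set `Ω`. -/
def perim (μ : Measure X) (E : Set X) (Ω : Set X) : ℝ≥0∞ := tv μ (chi E) Ω

/-- `u ∈ BV(Ω)`: `u ∈ L¹(Ω)` and `‖Du‖(Ω) < ∞`. -/
def MemBV (μ : Measure X) (u : X → ℝ) (Ω : Set X) : Prop :=
  IntegrableOn u Ω μ ∧ tv μ u Ω < ⊤

/-- `u ∈ BV_loc(Ω)`. -/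
def MemBVloc (μ : Measure X) (u : X → ℝ) (Ω : Set X) : Prop :=
  ∀ K : Set X, IsCompact K → K ⊆ Ω → ∃ U : Set X, IsOpen U ∧ K ⊆ U ∧ U ⊆ Ω ∧ MemBV μ u U

/-- `φ ∈ BV_c(Ω)`: a BV function with compact support in `Ω`. -/
def MemBVc (μ : Measure X) (φ : X → ℝ) (Ω : Set X) : Prop :=
  MemBV μ φ Ω ∧ IsCompact (tsupport φ) ∧ tsupport φ ⊆ Ω

/-- `u` is a 1-minimizer (function of least gradient) in `Ω`. -/
def IsMinimizer (μ : Measure X) (u : X → ℝ) (Ω : Set X) : Prop :=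
  MemBVloc μ u Ω ∧ ∀ φ : X → ℝ, MemBVc μ φ Ω →
    tvs μ u (tsupport φ) ≤ tvs μ (fun y => u y + φ y) (tsupport φ)

/-- `u` is a 1-superminimizer in `Ω`. -/
def IsSuperminimizer (μ : Measure X) (u : X → ℝ) (Ω : Set X) : Prop :=
  MemBVloc μ u Ω ∧ ∀ φ : X → ℝ, MemBVc μ φ Ω → (∀ x, 0 ≤ φ x) →
    tvs μ u (tsupport φ) ≤ tvs μ (fun y => u y + φ y) (tsupport φ)

/-- `u` is a 1-subminimizer in `Ω`. -/
def IsSubminimizer (μ : Measure X) (u : X → ℝ) (Ω : Set X) : Prop :=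
  MemBVloc μ u Ω ∧ ∀ φ : X → ℝ, MemBVc μ φ Ω → (∀ x, φ x ≤ 0) →
    tvs μ u (tsupport φ) ≤ tvs μ (fun y => u y + φ y) (tsupport φ)

/-- The lower approximate limit `u^∧(x)`, with values in `[-∞,∞]`. -/
def lowerApprox (μ : Measure X) (u : X → ℝ) (x : X) : EReal :=
  sSup ((fun t : ℝ => (t : EReal)) '' {t : ℝ | Filter.Tendsto
    (fun r : ℝ => μ ({y | u y < t} ∩ Metric.ball x r) / μ (Metric.ball x r))
    (𝓝[>] (0 : ℝ)) (𝓝 0)})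

/-- The upper approximate limit `u^∨(x)`, with values in `[-∞,∞]`. -/
def upperApprox (μ : Measure X) (u : X → ℝ) (x : X) : EReal :=
  sInf ((fun t : ℝ => (t : EReal)) '' {t : ℝ | Filter.Tendsto
    (fun r : ℝ => μ ({y | t < u y} ∩ Metric.ball x r) / μ (Metric.ball x r))
    (𝓝[>] (0 : ℝ)) (𝓝 0)})

/-- The upper approximate limit of an extended-real-valued function. -/
def upperApproxE (μ : Measure X) (ψ : X → EReal) (x : X) : EReal :=
  sInf ((fun t : ℝ => (t : EReal)) '' {t : ℝ | Filter.Tendsto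
    (fun r : ℝ => μ ({y | (t : EReal) < ψ y} ∩ Metric.ball x r) / μ (Metric.ball x r))
    (𝓝[>] (0 : ℝ)) (𝓝 0)})

/-- The measure-theoretic interior `I_E`. -/
def measInterior (μ : Measure X) (E : Set X) : Set X :=
  {x : X | Filter.Tendsto (fun r : ℝ => μ (Metric.ball x r \ E) / μ (Metric.ball x r))
    (𝓝[>] (0 : ℝ)) (𝓝 0)}

/-- The measure-theoretic boundary `∂*E`. -/
def measBoundary (μ : Measure X) (E : Set X) : Set X :=
  {x : X | 0 < Filter.limsup (fun r : ℝ => μ (Metric.ball x r ∩ E) / μ (Metric.ball x r))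
      (𝓝[>] (0 : ℝ)) ∧
    0 < Filter.limsup (fun r : ℝ => μ (Metric.ball x r \ E) / μ (Metric.ball x r))
      (𝓝[>] (0 : ℝ))}

/-- `A` is 1-thin at `x`. -/
def IsThinAt (μ : Measure X) (A : Set X) (x : X) : Prop :=
  Filter.Tendsto (fun r : ℝ =>
      ENNReal.ofReal r * vcap1 μ (A ∩ Metric.ball x r) (Metric.ball x (2 * r))
        / μ (Metric.ball x r))
    (𝓝[>] (0 : ℝ)) (𝓝 0)

/-- `U` is 1-finely open. -/
def IsFinelyOpen (μ : Measure X) (U : Set X) : Prop :=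
  ∀ x ∈ U, IsThinAt μ Uᶜ x

/-- The class `K_{ψ,f}(Ω)` of admissible functions for the obstacle problem. -/
def MemK (μ : Measure X) (ψ : X → EReal) (f : X → ℝ) (Ω : Set X) (u : X → ℝ) : Prop :=
  MemBVloc μ u Set.univ ∧ (∀ᵐ x ∂μ, x ∈ Ω → ψ x ≤ (u x : EReal)) ∧
    (∀ᵐ x ∂μ, x ∉ Ω → u x = f x)

/-- `u` is a solution of the `K_{ψ,f}(Ω)`-obstacle problem. -/
def IsObstacleSolution (μ : Measure X) (ψ : X → EReal) (f : X → ℝ) (Ω : Set X)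
    (u : X → ℝ) : Prop :=
  MemK μ ψ f Ω u ∧ ∀ v : X → ℝ, MemK μ ψ f Ω v → tv μ u Set.univ ≤ tv μ v Set.univ

/-- The standing assumptions: `(X,d,μ)` is a complete metric space with at least two points,
`μ` is a doubling measure with constant `Cd`, and `X` supports a `(1,1)`-Poincaré inequality
with constants `CP`, `lam`. -/
structure MMS {X : Type*} [MetricSpace X] [MeasurableSpace X] (μ : Measure X)
    (Cd CP lam : ℝ) : Prop where
  complete : CompleteSpace X
  nontrivial : Nontrivial X
  hCd : 1 ≤ Cd
  hCP : 0 < CP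
  hlam : 1 ≤ lam
  doubling : ∀ (x : X) (r : ℝ), 0 < r →
    0 < μ (Metric.ball x (2 * r)) ∧
    μ (Metric.ball x (2 * r)) ≤ ENNReal.ofReal Cd * μ (Metric.ball x r) ∧
    μ (Metric.ball x r) < ⊤
  poincare : ∀ (x : X) (r : ℝ), 0 < r → ∀ u : X → ℝ, MeasureTheory.LocallyIntegrable u μ →
    ∀ g : X → ℝ≥0∞, Measurable g → IsUpperGradientOn g u Set.univ →
      ∫⁻ y in Metric.ball x r, ENNReal.ofReal |u y - ⨍ z in Metric.ball x r, u z ∂μ| ∂μ ≤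
        ENNReal.ofReal (CP * r) * (μ (Metric.ball x r) / μ (Metric.ball x (lam * r))) *
          ∫⁻ y in Metric.ball x (lam * r), g y ∂μ

set_option linter.unusedSectionVars false

section Curves

variable {X : Type*} [MetricSpace X]

lemma speed_comp_affine (γ : ℝ → X) (a c t : ℝ) (hc : 0 < c) :
    speed (fun s => γ (a + c * s)) t = ENNReal.ofReal c * speed γ (a + c * t) := by
  unfold speed
  have hmap : Filter.map (fun h : ℝ => c * h) (𝓝[≠] (0 : ℝ)) = 𝓝[≠] (0 : ℝ) := by
    have := (Homeomorph.mulLeft₀ c hc.ne').map_punctured_nhds_eq (0 : ℝ)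
    simpa using this
  have h1 : (fun h : ℝ => ENNReal.ofReal (dist (γ (a + c * (t + h))) (γ (a + c * t)) / |h|))
      = fun h : ℝ => ENNReal.ofReal c *
        ENNReal.ofReal (dist (γ (a + c * t + c * h)) (γ (a + c * t)) / |c * h|) := by
    funext h
    rw [← ENNReal.ofReal_mul hc.le, abs_mul, abs_of_pos hc]
    congr 1
    have : a + c * (t + h) = a + c * t + c * h := by ring
    rw [this]
    by_cases hh : |h| = 0
    · simp [hh]
    · field_simp
  rw [h1, ENNReal.limsup_const_mul_of_ne_top ENNReal.ofReal_ne_top]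
  congr 1
  conv_rhs => rw [← hmap]
  rfl

/-- The restriction of a curve to `[a,b]`, reparametrized affinely on `[0,1]`. -/
def Curve.sub (γ : Curve X) (a b : ℝ) (ha : 0 ≤ a) (hab : a ≤ b) (hb : b ≤ 1) : Curve X where
  toFun := fun t => γ.toFun (a + (b - a) * t)
  lipschitz := by
    obtain ⟨K, hK⟩ := γ.lipschitz
    have h1 : LipschitzOnWith ⟨b - a, by linarith⟩ (fun t : ℝ => a + (b - a) * t) (Icc 0 1) := by
      refine LipschitzOnWith.of_dist_le_mul fun s _ t _ => ?_
      rw [Real.dist_eq, Real.dist_eq]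
      have : a + (b - a) * s - (a + (b - a) * t) = (b - a) * (s - t) := by ring
      rw [this, abs_mul, abs_of_nonneg (by linarith : (0 : ℝ) ≤ b - a)]
      rfl
    refine ⟨K * ⟨b - a, by linarith⟩, hK.comp h1 ?_⟩
    intro t ht
    constructor
    · have := mul_nonneg (by linarith : (0 : ℝ) ≤ b - a) ht.1
      linarith
    · nlinarith [ht.1, ht.2]

lemma Curve.sub_integral (γ : Curve X) (a b : ℝ) (ha : 0 ≤ a) (hab : a < b) (hb : b ≤ 1)
    (g : X → ℝ≥0∞) : curveIntegral g (γ.sub a b ha hab.le hb) =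
      ∫⁻ t in Icc a b, g (γ.toFun t) * speed γ.toFun t := by
  have hc : 0 < b - a := by linarith
  have himg : (fun s : ℝ => a + (b - a) * s) '' Icc 0 1 = Icc a b := by
    have := image_affine_Icc' hc a 0 1
    simp only [mul_zero, mul_one, zero_add] at this
    rw [show b - a + a = b by ring] at this
    rw [← this]
    congr 1
    funext s; ring
  rw [← himg, lintegral_image_eq_lintegral_abs_deriv_mul measurableSet_Icc
    (f' := fun _ => b - a)]
  · unfold curveIntegral
    refine lintegral_congr fun t => ?_
    have h2 := speed_comp_affine γ.toFun a (b - a) t hc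
    rw [abs_of_pos hc]
    change g (γ.toFun (a + (b - a) * t)) * speed (fun s => γ.toFun (a + (b - a) * s)) t = _
    rw [h2]
    ring
  · intro t _
    have := ((hasDerivAt_id t).const_mul (b - a)).const_add a
    simpa using this.hasDerivWithinAt
  · intro s _ t _ hst
    have : (b - a) * s = (b - a) * t := by simpa using hst
    exact mul_left_cancel₀ hc.ne' this

lemma IsUpperGradientOn.sub {g : X → ℝ≥0∞} {u : X → ℝ} {Ω : Set X} (h : IsUpperGradientOn g u Ω)
    (γ : Curve X) {a b : ℝ} (ha : 0 ≤ a) (hab : a ≤ b) (hb : b ≤ 1)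
    (hin : ∀ t ∈ Icc a b, γ.toFun t ∈ Ω) :
    ENNReal.ofReal |u (γ.toFun b) - u (γ.toFun a)| ≤
      ∫⁻ t in Icc a b, g (γ.toFun t) * speed γ.toFun t := by
  rcases hab.eq_or_lt with rfl | hab'
  · simp
  · rw [← γ.sub_integral a b ha hab' hb g]
    have := h (γ.sub a b ha hab hb) ?_
    · simpa [Curve.sub] using this
    · intro t ht
      apply hin
      constructor
      · have := mul_nonneg (by linarith : (0 : ℝ) ≤ b - a) ht.1
        linarith
      · nlinarith [ht.1, ht.2]

lemma speed_le {γ : ℝ → X} {K : ℝ≥0} (hK : LipschitzOnWith K γ (Icc 0 1)) {t : ℝ}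
    (ht : t ∈ Ioo (0 : ℝ) 1) : speed γ t ≤ K := by
  unfold speed
  have h : ∀ᶠ h in 𝓝[≠] (0 : ℝ), t + h ∈ Ioo (0 : ℝ) 1 := by
    apply eventually_nhdsWithin_of_eventually_nhds
    have : Tendsto (fun h : ℝ => t + h) (𝓝 0) (𝓝 t) := by
      have : Tendsto (fun h : ℝ => t + h) (𝓝 0) (𝓝 (t + 0)) := tendsto_const_nhds.add tendsto_id
      rwa [add_zero] at this
    exact this.eventually (Ioo_mem_nhds ht.1 ht.2)
  refine limsup_le_of_le (h := ?_)
  filter_upwards [h, self_mem_nhdsWithin] with s hs hs0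
  have h1 := hK.dist_le_mul _ (Ioo_subset_Icc_self hs) _ (Ioo_subset_Icc_self ht)
  rw [Real.dist_eq, add_sub_cancel_left] at h1
  rw [← ENNReal.ofReal_coe_nnreal]
  apply ENNReal.ofReal_le_ofReal
  rw [div_le_iff₀ (abs_pos.mpr hs0)]
  exact h1

lemma dist_le_speed (γ : Curve X) {a b : ℝ} (ha : 0 ≤ a) (hab : a ≤ b) (hb : b ≤ 1) :
    ENNReal.ofReal (dist (γ.toFun b) (γ.toFun a)) ≤ ∫⁻ t in Icc a b, speed γ.toFun t := by
  obtain ⟨K, hK⟩ := γ.lipschitz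
  set φ : ℝ → ℝ := fun t => dist (γ.toFun t) (γ.toFun a) with hφ
  have hsub : Icc a b ⊆ Icc 0 1 := Icc_subset_Icc ha hb
  have hL : LipschitzOnWith K φ (uIcc a b) := by
    rw [uIcc_of_le hab]
    refine LipschitzOnWith.of_dist_le_mul fun s hs t ht => ?_
    refine le_trans ?_ (hK.dist_le_mul s (hsub hs) t (hsub ht))
    rw [Real.dist_eq]
    exact abs_dist_sub_le _ _ _
  have hac := hL.absolutelyContinuousOnInterval
  have hint := hac.integral_deriv_eq_sub
  have hφa : φ a = 0 := by simp [hφ]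
  rw [hφa, sub_zero] at hint
  change ENNReal.ofReal (φ b) ≤ _
  have hderiv : ∀ t, DifferentiableAt ℝ φ t → ENNReal.ofReal |deriv φ t| ≤ speed γ.toFun t := by
    intro t hd
    have h1 := hd.hasDerivAt.tendsto_slope_zero
    have h2 : Tendsto (fun h : ℝ => ENNReal.ofReal |h⁻¹ • (φ (t + h) - φ t)|) (𝓝[≠] 0)
        (𝓝 (ENNReal.ofReal |deriv φ t|)) :=
      (ENNReal.continuous_ofReal.tendsto _).comp ((continuous_abs.tendsto _).comp h1)
    rw [← h2.limsup_eq]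
    unfold speed
    apply limsup_le_limsup
    · refine Eventually.of_forall fun h => ?_
      apply ENNReal.ofReal_le_ofReal
      rw [smul_eq_mul, abs_mul, abs_inv, inv_mul_eq_div]
      gcongr
      exact abs_dist_sub_le _ _ _
    · isBoundedDefault
    · isBoundedDefault
  rw [← hint]
  refine (ENNReal.ofReal_le_ofReal (le_abs_self _)).trans ?_
  rw [intervalIntegral.integral_of_le hab]
  have h3 : ENNReal.ofReal |∫ t in Ioc a b, deriv φ t| ≤
      ∫⁻ t in Ioc a b, ‖deriv φ t‖ₑ := by
    have := enorm_integral_le_lintegral_enorm (μ := volume.restrict (Ioc a b)) (deriv φ)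
    rwa [Real.enorm_eq_ofReal_abs] at this
  refine h3.trans ?_
  rw [Measure.restrict_congr_set Ioc_ae_eq_Icc]
  refine setLIntegral_mono_ae' measurableSet_Icc ?_
  have had := hac.ae_differentiableAt
  filter_upwards [had] with t ht htI
  rw [Real.enorm_eq_ofReal_abs]
  exact hderiv t (ht (by rwa [uIcc_of_le hab]))

/-- Local-to-global principle for increments on the unit interval. -/
lemma local_to_global (f : ℝ → ℝ) (G : ℝ → ℝ≥0∞)
    (h : ∀ t ∈ Icc (0 : ℝ) 1, ∃ δ > 0, ∀ a b, 0 ≤ a → a ≤ b → b ≤ 1 → |a - t| < δ → |b - t| < δ →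
      ENNReal.ofReal |f b - f a| ≤ ∫⁻ s in Icc a b, G s) :
    ENNReal.ofReal |f 1 - f 0| ≤ ∫⁻ s in Icc (0 : ℝ) 1, G s := by
  choose! δ hδ hh using h
  have hcov : Icc (0 : ℝ) 1 ⊆ ⋃ i : ℝ, (if i ∈ Icc (0 : ℝ) 1 then ball i (δ i) else ∅) := by
    intro t ht
    refine mem_iUnion.mpr ⟨t, ?_⟩
    rw [if_pos ht]
    exact mem_ball_self (hδ t ht)
  obtain ⟨t, ht0, htm, ⟨n, hn⟩, hcv⟩ := exists_monotone_Icc_subset_open_cover_Icc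
    (zero_le_one) (c := fun i => (Subtype.val ⁻¹' (if i ∈ Icc (0 : ℝ) 1 then ball i (δ i) else ∅)
      : Set (Icc (0 : ℝ) 1))) (fun i => by
        apply IsOpen.preimage continuous_subtype_val
        split_ifs
        · exact isOpen_ball
        · exact isOpen_empty) (fun s _ => by
        have := hcov s.2
        rw [mem_iUnion] at this ⊢
        exact this)
  have key : ∀ m, ENNReal.ofReal |f (t m) - f (t 0)| ≤ ∫⁻ s in Icc (t 0 : ℝ) (t m), G s := by
    intro m
    induction m with
    | zero => simp
    | succ m ih =>
      obtain ⟨i, hi⟩ := hcv m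
      have hmm : t m ≤ t (m + 1) := htm (Nat.le_succ m)
      have hiI : i ∈ Icc (0 : ℝ) 1 := by
        by_contra hne
        have := hi (left_mem_Icc.mpr hmm)
        simp [hne] at this
      have m1 : |(t m : ℝ) - i| < δ i := by
        have := hi (left_mem_Icc.mpr hmm)
        simpa only [mem_preimage, if_pos hiI, mem_ball, Real.dist_eq] using this
      have m2 : |(t (m + 1) : ℝ) - i| < δ i := by
        have := hi (right_mem_Icc.mpr hmm)
        simpa only [mem_preimage, if_pos hiI, mem_ball, Real.dist_eq] using this
      have h1 := hh i hiI (t m) (t (m + 1)) (t m).2.1 hmm (t (m + 1)).2.2 m1 m2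
      have h2 : ENNReal.ofReal |f (t (m + 1)) - f (t 0)| ≤
          ENNReal.ofReal |f (t m) - f (t 0)| + ENNReal.ofReal |f (t (m + 1)) - f (t m)| := by
        rw [← ENNReal.ofReal_add (abs_nonneg _) (abs_nonneg _)]
        apply ENNReal.ofReal_le_ofReal
        have := abs_add_le (f (t m) - f (t 0)) (f (t (m + 1)) - f (t m))
        rwa [show f (t m) - f (t 0) + (f (t (m + 1)) - f (t m)) = f (t (m + 1)) - f (t 0) by ring]
          at this
      refine h2.trans ((add_le_add ih h1).trans ?_)
      rw [Measure.restrict_congr_set (Ioc_ae_eq_Icc (a := ((t m : ℝ))) (b := (t (m+1) : ℝ))).symm,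
        ← lintegral_union measurableSet_Ioc]
      · apply lintegral_mono_set
        have h0m : (t 0 : ℝ) ≤ t m := htm (Nat.zero_le m)
        rintro s (hs | hs)
        · exact ⟨hs.1, hs.2.trans hmm⟩
        · exact ⟨h0m.trans hs.1.le, hs.2⟩
      · rw [Set.disjoint_left]
        intro s hs hs'
        exact absurd hs.2 (not_le.mpr hs'.1)
  have := key n
  rw [hn n le_rfl, ht0] at this
  exact this

lemma Curve.continuousOn (γ : Curve X) : ContinuousOn γ.toFun (Icc 0 1) := by
  obtain ⟨K, hK⟩ := γ.lipschitz
  exact hK.continuousOn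

/-- The upper gradient inequality with an additive error term on short subcurves. -/
lemma ug_of_local {g : X → ℝ≥0∞} {u : X → ℝ} {Ω : Set X}
    (h : ∀ γ : Curve X, γ.In Ω → ∀ K : ℝ≥0, LipschitzOnWith K γ.toFun (Icc 0 1) → ∀ ε : ℝ≥0, 0 < ε →
      ∀ t ∈ Icc (0 : ℝ) 1, ∃ δ > 0, ∀ a b, 0 ≤ a → a ≤ b → b ≤ 1 →
        (∀ s ∈ Icc a b, |s - t| < δ) →
        ENNReal.ofReal |u (γ.toFun b) - u (γ.toFun a)| ≤
          (∫⁻ s in Icc a b, g (γ.toFun s) * speed γ.toFun s) + ε * volume (Icc a b)) :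
    IsUpperGradientOn g u Ω := by
  intro γ hγ
  obtain ⟨K, hK⟩ := γ.lipschitz
  refine ENNReal.le_of_forall_pos_le_add fun ε hε _ => ?_
  have := local_to_global (fun t => u (γ.toFun t))
    (fun s => g (γ.toFun s) * speed γ.toFun s + ε) ?_
  · refine this.trans ?_
    rw [lintegral_add_right _ measurable_const]
    simp [curveIntegral]
  · intro t ht
    obtain ⟨δ, hδ, hh⟩ := h γ hγ K hK ε hε t ht
    refine ⟨δ, hδ, fun a b ha hab hb h1 h2 => ?_⟩
    rw [lintegral_add_right _ measurable_const, lintegral_const, Measure.restrict_apply_univ]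
    refine hh a b ha hab hb fun s hs => ?_
    rw [abs_lt] at *
    exact ⟨by linarith [hs.1], by linarith [hs.2]⟩

/-- Upper gradients are local. -/
lemma ug_of_cover {ι : Type*} {g : X → ℝ≥0∞} {u : X → ℝ} {Ω : Set X} (V : ι → Set X)
    (hV : ∀ i, IsOpen (V i)) (hcov : Ω ⊆ ⋃ i, V i) (h : ∀ i, IsUpperGradientOn g u (V i ∩ Ω)) :
    IsUpperGradientOn g u Ω := by
  refine ug_of_local fun γ hγ K hK ε hε t ht => ?_
  obtain ⟨i, hi⟩ := mem_iUnion.mp (hcov (hγ t ht))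
  have hc := γ.continuousOn t ht
  have := hc.preimage_mem_nhdsWithin ((hV i).mem_nhds hi)
  obtain ⟨δ, hδ, hb⟩ := Metric.mem_nhdsWithin_iff.mp this
  refine ⟨δ, hδ, fun a b ha hab hb1 hs => ?_⟩
  refine le_add_right ((h i).sub γ ha hab hb1 fun s hs' => ?_)
  have hs01 : s ∈ Icc (0 : ℝ) 1 := ⟨ha.trans hs'.1, hs'.2.trans hb1⟩
  exact ⟨hb ⟨by rw [mem_ball, Real.dist_eq]; exact hs s hs', hs01⟩, hγ s hs01⟩

lemma IsUpperGradientOn.mono {g h : X → ℝ≥0∞} {u : X → ℝ} {Ω Ω' : Set X}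
    (hg : IsUpperGradientOn g u Ω) (hΩ : Ω' ⊆ Ω) (hgh : ∀ x ∈ Ω', g x ≤ h x) :
    IsUpperGradientOn h u Ω' := by
  intro γ hγ
  refine (hg γ fun t ht => hΩ (hγ t ht)).trans ?_
  refine setLIntegral_mono' measurableSet_Icc fun t ht => ?_
  gcongr
  exact hgh _ (hγ t ht)

lemma IsUpperGradientOn.congr {g : X → ℝ≥0∞} {u v : X → ℝ} {Ω : Set X}
    (hg : IsUpperGradientOn g u Ω) (huv : ∀ x ∈ Ω, u x = v x) : IsUpperGradientOn g v Ω := by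
  intro γ hγ
  rw [← huv _ (hγ 1 (by simp)), ← huv _ (hγ 0 (by simp))]
  exact hg γ hγ

lemma curveIntegral_add_le (g h : X → ℝ≥0∞) (γ : Curve X) :
    curveIntegral g γ + curveIntegral h γ ≤ curveIntegral (fun x => g x + h x) γ := by
  unfold curveIntegral
  refine (le_lintegral_add _ _).trans (le_of_eq ?_)
  simp only [add_mul]

lemma curveIntegral_mono {g h : X → ℝ≥0∞} (hgh : ∀ x, g x ≤ h x) (γ : Curve X) :
    curveIntegral g γ ≤ curveIntegral h γ :=
  lintegral_mono fun _ => mul_le_mul_left (hgh _) _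

lemma curveIntegral_const_mul {g : X → ℝ≥0∞} {c : ℝ≥0∞} (hc : c ≠ ⊤) (γ : Curve X) :
    curveIntegral (fun x => c * g x) γ = c * curveIntegral g γ := by
  unfold curveIntegral
  rw [← lintegral_const_mul' c _ hc]
  simp only [mul_assoc]

lemma IsUpperGradientOn.lin {g h : X → ℝ≥0∞} {u v : X → ℝ} {Ω : Set X}
    (hg : IsUpperGradientOn g u Ω) (hh : IsUpperGradientOn h v Ω) (p q : ℝ) :
    IsUpperGradientOn (fun x => ENNReal.ofReal |p| * g x + ENNReal.ofReal |q| * h x)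
      (fun x => p * u x + q * v x) Ω := by
  intro γ hγ
  refine le_trans ?_ (curveIntegral_add_le _ _ γ)
  rw [curveIntegral_const_mul ENNReal.ofReal_ne_top, curveIntegral_const_mul ENNReal.ofReal_ne_top]
  refine le_trans ?_ (add_le_add (mul_le_mul_right (hg γ hγ) _) (mul_le_mul_right (hh γ hγ) _))
  rw [← ENNReal.ofReal_mul (abs_nonneg _), ← ENNReal.ofReal_mul (abs_nonneg _),
    ← ENNReal.ofReal_add (by positivity) (by positivity), ← abs_mul, ← abs_mul]
  apply ENNReal.ofReal_le_ofReal
  refine le_trans (le_of_eq ?_) (abs_add_le _ _)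
  congr 1; ring

/-- Post-composition with a map that does not increase increments. -/
lemma IsUpperGradientOn.comp_le {g : X → ℝ≥0∞} {u v : X → ℝ} {Ω : Set X}
    (hg : IsUpperGradientOn g u Ω) (h : ∀ x y, |v x - v y| ≤ |u x - u y|) :
    IsUpperGradientOn g v Ω := fun γ hγ =>
  (ENNReal.ofReal_le_ofReal (h _ _)).trans (hg γ hγ)

lemma IsUpperGradientOn.max {g h : X → ℝ≥0∞} {u v : X → ℝ} {Ω : Set X}
    (hg : IsUpperGradientOn g u Ω) (hh : IsUpperGradientOn h v Ω) :
    IsUpperGradientOn (fun x => g x + h x) (fun x => max (u x) (v x)) Ω := by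
  intro γ hγ
  refine le_trans ?_ (curveIntegral_add_le _ _ γ)
  refine le_trans ?_ (add_le_add (hg γ hγ) (hh γ hγ))
  rw [← ENNReal.ofReal_add (abs_nonneg _) (abs_nonneg _)]
  apply ENNReal.ofReal_le_ofReal
  refine (abs_max_sub_max_le_max _ _ _ _).trans (max_le ?_ ?_) <;>
  linarith [abs_nonneg (u (γ.toFun 1) - u (γ.toFun 0)), abs_nonneg (v (γ.toFun 1) - v (γ.toFun 0))]

/-- A globally `L`-Lipschitz function has the constant `L` as an upper gradient. -/
lemma ug_lipschitz {u : X → ℝ} {L : ℝ} (hL : 0 ≤ L) (Ω : Set X)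
    (h : ∀ x ∈ Ω, ∀ y ∈ Ω, |u x - u y| ≤ L * dist x y) :
    IsUpperGradientOn (fun _ => ENNReal.ofReal L) u Ω := by
  intro γ hγ
  unfold curveIntegral
  rw [lintegral_const_mul' _ _ ENNReal.ofReal_ne_top]
  refine le_trans ?_ (mul_le_mul_right (dist_le_speed γ le_rfl zero_le_one le_rfl) _)
  rw [← ENNReal.ofReal_mul hL]
  exact ENNReal.ofReal_le_ofReal (h _ (hγ 1 (by simp)) _ (hγ 0 (by simp)))

lemma ug_const (c : ℝ) (Ω : Set X) : IsUpperGradientOn (fun _ => 0) (fun _ : X => c) Ω := by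
  intro γ _; simp

end Curves

section LocLip

variable {X : Type*} [MetricSpace X] [ProperSpace X]

lemma locLip_iff {u : X → ℝ} {Ω : Set X} (hΩ : IsOpen Ω) :
    LocLipschitzOn u Ω ↔ ∀ x ∈ Ω, ∃ L : ℝ≥0, ∃ t ∈ 𝓝 x, LipschitzOnWith L u t := by
  constructor
  · intro h x hx
    obtain ⟨r, hr, hb⟩ := Metric.nhds_basis_closedBall.mem_iff.mp (hΩ.mem_nhds hx)
    obtain ⟨L, hL⟩ := h _ (isCompact_closedBall x r) hb
    exact ⟨L, _, closedBall_mem_nhds x hr, hL⟩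
  · intro h K hK hKΩ
    refine LocallyLipschitzOn.exists_lipschitzOnWith_of_compact hK fun x hx => ?_
    obtain ⟨L, t, ht, hL⟩ := h x (hKΩ hx)
    exact ⟨L, t, mem_nhdsWithin_of_mem_nhds ht, hL⟩

lemma LocLipschitzOn.mono {u : X → ℝ} {Ω Ω' : Set X} (h : LocLipschitzOn u Ω) (hs : Ω' ⊆ Ω) :
    LocLipschitzOn u Ω' := fun K hK hKs => h K hK (hKs.trans hs)

lemma LocLipschitzOn.continuousOn {u : X → ℝ} {Ω : Set X} (hΩ : IsOpen Ω)
    (h : LocLipschitzOn u Ω) : ContinuousOn u Ω := by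
  intro x hx
  obtain ⟨L, t, ht, hL⟩ := (locLip_iff hΩ).mp h x hx
  exact (hL.continuousOn.continuousAt ht).continuousWithinAt

lemma LocLipschitzOn.continuous {u : X → ℝ} (h : LocLipschitzOn u univ) : Continuous u :=
  continuousOn_univ.mp (h.continuousOn isOpen_univ)

lemma LocLipschitzOn.congr {u v : X → ℝ} {Ω : Set X} (h : LocLipschitzOn u Ω)
    (huv : ∀ x ∈ Ω, u x = v x) : LocLipschitzOn v Ω := by
  intro K hK hs
  obtain ⟨L, hL⟩ := h K hK hs
  refine ⟨L, fun x hx y hy => ?_⟩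
  rw [← huv x (hs hx), ← huv y (hs hy)]
  exact hL hx hy

lemma LocLipschitzOn.of_cover {ι : Type*} {u : X → ℝ} {Ω : Set X} (V : ι → Set X)
    (hV : ∀ i, IsOpen (V i)) (hcov : Ω ⊆ ⋃ i, V i) (h : ∀ i, LocLipschitzOn u (V i ∩ Ω))
    (hΩ : IsOpen Ω) : LocLipschitzOn u Ω := by
  rw [locLip_iff hΩ]
  intro x hx
  obtain ⟨i, hi⟩ := mem_iUnion.mp (hcov hx)
  exact (locLip_iff ((hV i).inter hΩ)).mp (h i) x ⟨hi, hx⟩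

lemma LocLipschitzOn.comp2 {u v : X → ℝ} {Ω : Set X} (F : ℝ × ℝ → ℝ) (hF : LocallyLipschitz F)
    (hu : LocLipschitzOn u Ω) (hv : LocLipschitzOn v Ω) :
    LocLipschitzOn (fun x => F (u x, v x)) Ω := by
  intro K hK hs
  obtain ⟨L, hL⟩ := hu K hK hs
  obtain ⟨M, hM⟩ := hv K hK hs
  have h1 := hL.prodMk hM
  have hK' := hK.image_of_continuousOn h1.continuousOn
  obtain ⟨N, hN⟩ := (hF.locallyLipschitzOn (s := (fun x => (u x, v x)) '' K)).exists_lipschitzOnWith_of_compact hK'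
  exact ⟨_, hN.comp h1 (mapsTo_image _ _)⟩

lemma LocLipschitzOn.mul {u v : X → ℝ} {Ω : Set X}
    (hu : LocLipschitzOn u Ω) (hv : LocLipschitzOn v Ω) :
    LocLipschitzOn (fun x => u x * v x) Ω :=
  hu.comp2 (fun p => p.1 * p.2)
    ((contDiff_fst.mul contDiff_snd : ContDiff ℝ 1 fun p : ℝ × ℝ => p.1 * p.2).locallyLipschitz) hv

lemma LocLipschitzOn.add {u v : X → ℝ} {Ω : Set X}
    (hu : LocLipschitzOn u Ω) (hv : LocLipschitzOn v Ω) :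
    LocLipschitzOn (fun x => u x + v x) Ω :=
  hu.comp2 (fun p => p.1 + p.2)
    ((contDiff_fst.add contDiff_snd : ContDiff ℝ 1 fun p : ℝ × ℝ => p.1 + p.2).locallyLipschitz) hv

lemma LocLipschitzOn.max {u v : X → ℝ} {Ω : Set X}
    (hu : LocLipschitzOn u Ω) (hv : LocLipschitzOn v Ω) :
    LocLipschitzOn (fun x => max (u x) (v x)) Ω :=
  hu.comp2 (fun p => Max.max p.1 p.2)
    ((LipschitzWith.prod_fst.max LipschitzWith.prod_snd).locallyLipschitz) hv

lemma locLip_of_lipschitz {u : X → ℝ} {L : ℝ≥0} (h : LipschitzWith L u) (Ω : Set X) :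
    LocLipschitzOn u Ω := fun _ _ _ => ⟨L, h.lipschitzOnWith⟩

lemma locLip_const (c : ℝ) (Ω : Set X) : LocLipschitzOn (fun _ : X => c) Ω :=
  locLip_of_lipschitz (LipschitzWith.const c) Ω

lemma LocLipschitzOn.comp_le {u v : X → ℝ} {Ω : Set X}
    (hu : LocLipschitzOn u Ω) (h : ∀ x y, |v x - v y| ≤ |u x - u y|) :
    LocLipschitzOn v Ω := by
  intro K hK hs
  obtain ⟨L, hL⟩ := hu K hK hs
  refine ⟨L, LipschitzOnWith.of_dist_le_mul fun x hx y hy => ?_⟩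
  exact (h x y).trans (hL.dist_le_mul x hx y hy)

lemma LocLipschitzOn.lin {u v : X → ℝ} {Ω : Set X}
    (hu : LocLipschitzOn u Ω) (hv : LocLipschitzOn v Ω) (p q : ℝ) :
    LocLipschitzOn (fun x => p * u x + q * v x) Ω :=
  ((locLip_const p Ω).mul hu).add ((locLip_const q Ω).mul hv)

end LocLip

section TV

variable {X : Type*} [MetricSpace X] [MeasurableSpace X] [BorelSpace X] [ProperSpace X]
  {μ : Measure X}

lemma IsUpperGradientOn.weak {g : X → ℝ≥0∞} {u : X → ℝ} {Ω : Set X}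
    (h : IsUpperGradientOn g u Ω) : IsWeakUpperGradientOn μ g u Ω := by
  refine ⟨∅, ?_, fun γ _ => h γ⟩
  refine le_antisymm ?_ (zero_le)
  unfold Mod1
  refine (iInf_le _ (fun _ => 0)).trans ((iInf_le _ measurable_const).trans
    ((iInf_le _ (by simp)).trans ?_))
  simp

/-- A weak upper gradient can be enlarged slightly to a genuine one. -/
lemma IsWeakUpperGradientOn.exists_ug {g : X → ℝ≥0∞} {u : X → ℝ} {Ω : Set X}
    (h : IsWeakUpperGradientOn μ g u Ω) (hg : Measurable g) {ε : ℝ≥0∞} (hε : ε ≠ 0) :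
    ∃ g' : X → ℝ≥0∞, Measurable g' ∧ IsUpperGradientOn g' u Ω ∧
      ∀ S : Set X, ∫⁻ x in S, g' x ∂μ ≤ ∫⁻ x in S, g x ∂μ + ε := by
  obtain ⟨Γ, hΓ, hug⟩ := h
  obtain ⟨e, he, hes⟩ := ENNReal.exists_pos_sum_of_countable hε ℕ
  have : ∀ n, ∃ ρ : X → ℝ≥0∞, Measurable ρ ∧ (∀ γ ∈ Γ, 1 ≤ curveIntegral ρ γ) ∧
      ∫⁻ x, ρ x ∂μ ≤ e n := by
    intro n
    have h1 : Mod1 μ Γ < e n := by rw [hΓ]; exact_mod_cast he n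
    unfold Mod1 at h1
    simp only [iInf_lt_iff] at h1
    obtain ⟨ρ, h1, h2, h3⟩ := h1
    exact ⟨ρ, h1, h2, h3.le⟩
  choose ρ hρm hρΓ hρi using this
  refine ⟨fun x => g x + ∑' n, ρ n x, hg.add (Measurable.tsum hρm), ?_, ?_⟩
  · intro γ hγ
    by_cases hm : γ ∈ Γ
    · have hn : ∀ n : ℕ, (n : ℝ≥0∞) ≤ curveIntegral (fun x => ∑ k ∈ Finset.range n, ρ k x) γ := by
        intro n
        induction n with
        | zero => simp
        | succ n ih =>
          simp only [Finset.sum_range_succ]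
          refine le_trans ?_ (curveIntegral_add_le _ _ γ)
          push_cast
          exact add_le_add ih (hρΓ n γ hm)
      have : curveIntegral (fun x => g x + ∑' n, ρ n x) γ = ⊤ := by
        refine ENNReal.eq_top_of_forall_nnreal_le fun r => ?_
        obtain ⟨n, hrn⟩ := exists_nat_ge r
        refine le_trans ?_ ((hn n).trans (curveIntegral_mono (fun x => ?_) γ))
        · exact_mod_cast hrn
        · exact le_add_left (ENNReal.sum_le_tsum _)
      rw [this]; exact le_top
    · exact (hug γ hm hγ).trans (curveIntegral_mono (fun x => le_self_add) γ)
  · intro S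
    rw [lintegral_add_left hg]
    gcongr
    rw [lintegral_tsum fun n => (hρm n).aemeasurable]
    exact (ENNReal.tsum_le_tsum fun n => (setLIntegral_le_lintegral _ _).trans (hρi n)).trans hes.le

/-- `u` is approximable in `Ω` by locally Lipschitz functions with energy at most `a`. -/
def Appr (μ : Measure X) (u : X → ℝ) (Ω : Set X) (a : ℝ≥0∞) : Prop :=
  ∃ (v : ℕ → X → ℝ) (g : ℕ → X → ℝ≥0∞), (∀ i, LocLipschitzOn (v i) Ω) ∧ TendstoL1Loc μ v u Ω ∧
    (∀ i, Measurable (g i)) ∧ (∀ i, IsUpperGradientOn (g i) (v i) Ω) ∧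
    ∀ i, ∫⁻ x in Ω, g i x ∂μ ≤ a

lemma tv_le_liminf {u : X → ℝ} {Ω : Set X} {v : ℕ → X → ℝ} {g : ℕ → X → ℝ≥0∞}
    (h1 : ∀ i, LocLipschitzOn (v i) Ω) (h2 : TendstoL1Loc μ v u Ω)
    (h3 : ∀ i, Measurable (g i)) (h4 : ∀ i, IsUpperGradientOn (g i) (v i) Ω) :
    tv μ u Ω ≤ liminf (fun i => ∫⁻ x in Ω, g i x ∂μ) atTop :=
  iInf_le_of_le v (iInf_le_of_le h1 (iInf_le_of_le h2 (iInf_le_of_le g (iInf_le_of_le h3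
    (iInf_le_of_le (fun i => (h4 i).weak) le_rfl)))))

lemma Appr.tv_le {u : X → ℝ} {Ω : Set X} {a : ℝ≥0∞} (h : Appr μ u Ω a) : tv μ u Ω ≤ a := by
  obtain ⟨v, g, h1, h2, h3, h4, h5⟩ := h
  exact (tv_le_liminf h1 h2 h3 h4).trans
    (liminf_le_of_le (h := fun b hb => by
      obtain ⟨i, hi⟩ := hb.exists
      exact hi.trans (h5 i)))

lemma appr_of_tv_lt {u : X → ℝ} {Ω : Set X} {a : ℝ≥0∞} (h : tv μ u Ω < a) : Appr μ u Ω a := by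
  unfold tv at h
  simp only [iInf_lt_iff] at h
  obtain ⟨v, h1, h2, g, h3, h4, h5⟩ := h
  obtain ⟨c, hc1, hc2⟩ := exists_between h5
  have hfr := frequently_lt_of_liminf_lt (h := hc1)
  obtain ⟨φ, hφ, hφ'⟩ := extraction_of_frequently_atTop hfr
  have hε : a - c ≠ 0 := (tsub_pos_of_lt hc2).ne'
  choose g' m1 m2 m3 using fun i => (h4 (φ i)).exists_ug (h3 (φ i)) hε
  refine ⟨fun i => v (φ i), g', fun i => h1 _, fun K hK hs => (h2 K hK hs).comp hφ.tendsto_atTop,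
    m1, m2, fun i => (m3 i Ω).trans ?_⟩
  calc _ ≤ c + (a - c) := by gcongr; exact (hφ' i).le
    _ = a := add_tsub_cancel_of_le hc2.le

lemma tv_le_of_forall {u w : X → ℝ} {Ω Ω' : Set X}
    (h : ∀ a, Appr μ u Ω a → Appr μ w Ω' a) : tv μ w Ω' ≤ tv μ u Ω :=
  le_of_forall_gt fun _ ha => (h _ (appr_of_tv_lt (exists_between ha).choose_spec.1)).tv_le.trans_lt
    (exists_between ha).choose_spec.2

lemma Appr.mono {u : X → ℝ} {Ω Ω' : Set X} {a : ℝ≥0∞} (hs : Ω' ⊆ Ω) (h : Appr μ u Ω a) :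
    Appr μ u Ω' a := by
  obtain ⟨v, g, h1, h2, h3, h4, h5⟩ := h
  exact ⟨v, g, fun i K hK hKs => h1 i K hK (hKs.trans hs), fun K hK hKs => h2 K hK (hKs.trans hs),
    h3, fun i => (h4 i).mono hs fun _ _ => le_rfl, fun i => (lintegral_mono_set hs).trans (h5 i)⟩

lemma tv_mono {u : X → ℝ} {Ω Ω' : Set X} (hs : Ω' ⊆ Ω) : tv μ u Ω' ≤ tv μ u Ω :=
  tv_le_of_forall fun _ h => h.mono hs

lemma TendstoL1Loc.congr_ae {v : ℕ → X → ℝ} {u w : X → ℝ} {Ω : Set X} (h : TendstoL1Loc μ v u Ω)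
    (huw : ∀ᵐ x ∂μ, x ∈ Ω → u x = w x) : TendstoL1Loc μ v w Ω := by
  intro K hK hs
  refine (h K hK hs).congr fun i => ?_
  refine setLIntegral_congr_fun_ae hK.measurableSet ?_
  filter_upwards [huw] with x hx hxK
  rw [hx (hs hxK)]

lemma tv_congr_ae {u w : X → ℝ} {Ω : Set X} (huw : ∀ᵐ x ∂μ, x ∈ Ω → u x = w x) :
    tv μ u Ω = tv μ w Ω := by
  apply le_antisymm
  · refine tv_le_of_forall fun a ⟨v, g, h1, h2, h3⟩ => ⟨v, g, h1, h2.congr_ae ?_, h3⟩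
    filter_upwards [huw] with x hx hm using (hx hm).symm
  · exact tv_le_of_forall fun a ⟨v, g, h1, h2, h3⟩ => ⟨v, g, h1, h2.congr_ae huw, h3⟩

lemma locLip_aemeasurable {u : X → ℝ} {Ω : Set X} (hΩ : IsOpen Ω) (h : LocLipschitzOn u Ω) :
    AEMeasurable u (μ.restrict Ω) :=
  (h.continuousOn hΩ).aemeasurable hΩ.measurableSet

lemma aem_diff {u v : X → ℝ} {ν : Measure X} (hu : AEMeasurable u ν) (hv : AEMeasurable v ν) :
    AEMeasurable (fun x => ENNReal.ofReal |u x - v x|) ν :=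
  ENNReal.measurable_ofReal.comp_aemeasurable
    (continuous_abs.measurable.comp_aemeasurable (hu.sub hv))

lemma TendstoL1Loc.of_le {v v' w : ℕ → X → ℝ} {u u' z : X → ℝ} {Ω : Set X}
    (h : TendstoL1Loc μ v u Ω) (h' : TendstoL1Loc μ v' u' Ω) {M N : ℝ} (hM : 0 ≤ M) (hN : 0 ≤ N)
    (hm : ∀ i, AEMeasurable (v i) (μ.restrict Ω)) (hu : AEMeasurable u (μ.restrict Ω))
    (hb : ∀ i, ∀ x ∈ Ω, |w i x - z x| ≤ M * |v i x - u x| + N * |v' i x - u' x|) :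
    TendstoL1Loc μ w z Ω := by
  intro K hK hs
  have h1 := (ENNReal.Tendsto.const_mul (a := ENNReal.ofReal M) (h K hK hs)
    (Or.inr ENNReal.ofReal_ne_top)).add (ENNReal.Tendsto.const_mul (a := ENNReal.ofReal N)
      (h' K hK hs) (Or.inr ENNReal.ofReal_ne_top))
  rw [mul_zero, mul_zero, add_zero] at h1
  refine tendsto_of_tendsto_of_tendsto_of_le_of_le tendsto_const_nhds h1 (fun _ => zero_le)
    fun i => ?_
  simp only
  rw [← lintegral_const_mul' _ _ ENNReal.ofReal_ne_top,
    ← lintegral_const_mul' _ _ ENNReal.ofReal_ne_top, ← lintegral_add_left']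
  · refine setLIntegral_mono' hK.measurableSet fun x hx => ?_
    rw [← ENNReal.ofReal_mul hM, ← ENNReal.ofReal_mul hN, ← ENNReal.ofReal_add (by positivity)
      (by positivity)]
    exact ENNReal.ofReal_le_ofReal (hb i x (hs hx))
  · exact ((aem_diff ((hm i).mono_measure (Measure.restrict_mono hs le_rfl))
      (hu.mono_measure (Measure.restrict_mono hs le_rfl)))).const_mul _

lemma tendstoL1Loc_const (u : X → ℝ) (Ω : Set X) : TendstoL1Loc μ (fun _ => u) u Ω := by
  intro K _ _
  simp

/-- Total variation is convex. -/
lemma Appr.lin {u w : X → ℝ} {Ω : Set X} (hΩ : IsOpen Ω) {a b : ℝ≥0∞} (hu : Appr μ u Ω a)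
    (hw : Appr μ w Ω b) (hum : AEMeasurable u μ) {p q : ℝ} (hp : 0 ≤ p) (hq : 0 ≤ q) :
    Appr μ (fun x => p * u x + q * w x) Ω (ENNReal.ofReal p * a + ENNReal.ofReal q * b) := by
  obtain ⟨v, g, h1, h2, h3, h4, h5⟩ := hu
  obtain ⟨v', g', h1', h2', h3', h4', h5'⟩ := hw
  refine ⟨fun i x => p * v i x + q * v' i x,
    fun i x => ENNReal.ofReal p * g i x + ENNReal.ofReal q * g' i x, fun i => (h1 i).lin (h1' i) p q,
    h2.of_le h2' hp hq (fun i => locLip_aemeasurable hΩ (h1 i)) hum.restrict fun i x _ => ?_,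
    fun i => ((h3 i).const_mul _).add ((h3' i).const_mul _), fun i => ?_, fun i => ?_⟩
  · rw [show p * v i x + q * v' i x - (p * u x + q * w x) = p * (v i x - u x) + q * (v' i x - w x)
      by ring]
    refine (abs_add_le _ _).trans_eq ?_
    rw [abs_mul, abs_mul, abs_of_nonneg hp, abs_of_nonneg hq]
  · have := (h4 i).lin (h4' i) p q
    rwa [abs_of_nonneg hp, abs_of_nonneg hq] at this
  · rw [lintegral_add_left ((h3 i).const_mul _), lintegral_const_mul _ (h3 i),
      lintegral_const_mul _ (h3' i)]
    gcongr
    · exact h5 i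
    · exact h5' i

lemma tv_lin {u w : X → ℝ} {Ω : Set X} (hΩ : IsOpen Ω) (hum : AEMeasurable u μ) {p q : ℝ}
    (hp : 0 ≤ p) (hq : 0 ≤ q) {a b : ℝ≥0∞} (ha : tv μ u Ω < a) (hb : tv μ w Ω < b) :
    tv μ (fun x => p * u x + q * w x) Ω ≤ ENNReal.ofReal p * a + ENNReal.ofReal q * b :=
  ((appr_of_tv_lt ha).lin hΩ (appr_of_tv_lt hb) hum hp hq).tv_le

/-- Total variation does not increase under 1-Lipschitz post-composition. -/
lemma tv_comp_le {u : X → ℝ} {Ω : Set X} (T : ℝ → ℝ) (hT : ∀ s t, |T s - T t| ≤ |s - t|) :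
    tv μ (fun x => T (u x)) Ω ≤ tv μ u Ω := by
  refine tv_le_of_forall fun a ⟨v, g, h1, h2, h3, h4, h5⟩ => ⟨fun i x => T (v i x), g,
    fun i => (h1 i).comp_le fun x y => hT _ _, fun K hK hs => ?_, h3,
    fun i => (h4 i).comp_le fun x y => hT _ _, h5⟩
  refine tendsto_of_tendsto_of_tendsto_of_le_of_le tendsto_const_nhds (h2 K hK hs)
    (fun _ => zero_le) fun i => lintegral_mono fun x => ENNReal.ofReal_le_ofReal (hT _ _)

/-- Countable superadditivity over disjoint open subsets. -/
lemma tsum_tv_le {ι : Type*} [Countable ι] {u : X → ℝ} {Ω : Set X} (V : ι → Set X)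
    (hV : ∀ i, IsOpen (V i)) (hd : Pairwise (Function.onFun Disjoint V)) (hs : ∀ i, V i ⊆ Ω) :
    ∑' i, tv μ u (V i) ≤ tv μ u Ω := by
  refine le_of_forall_gt fun b hb => ?_
  obtain ⟨a, ha, hab⟩ := exists_between hb
  refine lt_of_le_of_lt ?_ hab
  obtain ⟨v, g, h1, h2, h3, h4, h5⟩ := appr_of_tv_lt ha
  let _ : MeasurableSpace ι := ⊤
  have _ : DiscreteMeasurableSpace ι := ⟨fun _ => trivial⟩
  calc ∑' i, tv μ u (V i) ≤ ∑' i, liminf (fun n => ∫⁻ x in V i, g n x ∂μ) atTop := by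
        refine ENNReal.tsum_le_tsum fun i => tv_le_liminf (fun n => (h1 n).mono (hs i))
          (fun K hK hKs => h2 K hK (hKs.trans (hs i))) h3
          fun n => (h4 n).mono (hs i) fun _ _ => le_rfl
    _ = ∫⁻ i, liminf (fun n => ∫⁻ x in V i, g n x ∂μ) atTop ∂Measure.count := by
        rw [lintegral_count]
    _ ≤ liminf (fun n => ∫⁻ i, ∫⁻ x in V i, g n x ∂μ ∂Measure.count) atTop :=
        lintegral_liminf_le fun n => measurable_of_countable _
    _ ≤ a := by
        refine liminf_le_of_le (h := fun c hc => ?_)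
        obtain ⟨n, hn⟩ := hc.exists
        refine hn.trans ?_
        rw [lintegral_count, ← lintegral_iUnion (fun i => (hV i).measurableSet) hd]
        exact (lintegral_mono_set (iUnion_subset hs)).trans (h5 n)

/-- Lower semicontinuity: approximation of `u` by functions of controlled variation. -/
lemma tv_le_of_tendsto [IsFiniteMeasureOnCompacts μ] {u : X → ℝ} {w : ℕ → X → ℝ} {a : ℝ≥0∞}
    (hw : ∀ n, AEMeasurable (w n) μ)
    (h : TendstoL1Loc μ w u univ) (ha : ∀ n, tv μ (w n) univ ≤ a) : tv μ u univ ≤ a := by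
  refine le_of_forall_gt fun b' hb' => ?_
  obtain ⟨b, hb, hbb⟩ := exists_between hb'
  refine lt_of_le_of_lt ?_ hbb
  rcases isEmpty_or_nonempty X with he | ⟨⟨x0⟩⟩
  · refine (Appr.tv_le (a := 0) ⟨fun _ _ => 0, fun _ _ => 0, fun _ => locLip_const _ _, ?_,
      fun _ => measurable_const, fun _ => ug_const 0 _, fun _ => by simp⟩).trans zero_le
    intro K _ _
    have : K = ∅ := Set.eq_empty_of_isEmpty K
    simp [this]
  have : ∀ n : ℕ, ∃ (v : X → ℝ) (g : X → ℝ≥0∞), LocLipschitzOn v univ ∧ Measurable g ∧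
      IsUpperGradientOn g v univ ∧ ∫⁻ x in univ, g x ∂μ ≤ b ∧
      ∫⁻ x in closedBall x0 n, ENNReal.ofReal |v x - w n x| ∂μ ≤ ((n : ℝ≥0∞) + 1)⁻¹ := by
    intro n
    obtain ⟨v, g, h1, h2, h3, h4, h5⟩ := appr_of_tv_lt ((ha n).trans_lt hb)
    have h6 := h2 (closedBall x0 n) (isCompact_closedBall _ _) (subset_univ _)
    have h7 := h6.eventually (gt_mem_nhds (show (0 : ℝ≥0∞) < ((n : ℝ≥0∞) + 1)⁻¹ from
      ENNReal.inv_pos.mpr (by finiteness)))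
    obtain ⟨i, hi⟩ := h7.exists
    exact ⟨v i, g i, h1 i, h3 i, h4 i, h5 i, hi.le⟩
  choose v g h1 h2 h3 h4 h5 using this
  refine Appr.tv_le ⟨v, g, h1, ?_, h2, h3, h4⟩
  have hvw : TendstoL1Loc μ (fun n x => v n x - w n x) (fun _ => 0) univ := by
    intro K hK _
    obtain ⟨R, hR⟩ := hK.isBounded.subset_closedBall x0
    have ht : Tendsto (fun n : ℕ => ((n : ℝ≥0∞) + 1)⁻¹) atTop (𝓝 0) := by
      have := (ENNReal.tendsto_inv_nat_nhds_zero).comp (tendsto_add_atTop_nat 1)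
      refine this.congr fun n => ?_
      simp
    refine tendsto_of_tendsto_of_tendsto_of_le_of_le' tendsto_const_nhds ht
      (Eventually.of_forall fun _ => zero_le) ?_
    obtain ⟨N, hN⟩ := exists_nat_ge R
    filter_upwards [eventually_ge_atTop N] with n hn
    simp only [sub_zero]
    refine (lintegral_mono_set (hR.trans (closedBall_subset_closedBall ?_))).trans (h5 n)
    exact hN.trans (by exact_mod_cast hn)
  refine hvw.of_le h (M := 1) (N := 1) zero_le_one zero_le_one (fun i => ?_) aemeasurable_const
    fun i x _ => ?_
  · exact (locLip_aemeasurable isOpen_univ (h1 i)).sub (hw i).restrict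
  · rw [one_mul, one_mul, sub_zero]
    refine le_trans (le_of_eq ?_) (abs_add_le _ _)
    congr 1; ring

end TV

section Glue

variable {X : Type*} [MetricSpace X] [MeasurableSpace X] [BorelSpace X] [ProperSpace X]
  {μ : Measure X}

/-- Cutoff profile: `1` on `(-∞, 2 * d]`, `0` on `[3 * d, ∞)`, linear in between. -/
def ramp (d t : ℝ) : ℝ := max 0 (min 1 (3 - t / d))

lemma ramp_nonneg (d t : ℝ) : 0 ≤ ramp d t := le_max_left _ _

lemma ramp_le_one (d t : ℝ) : ramp d t ≤ 1 := max_le zero_le_one (min_le_left _ _)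

lemma ramp_eq_one {d t : ℝ} (hd : 0 < d) (ht : t ≤ 2 * d) : ramp d t = 1 := by
  have : 1 ≤ 3 - t / d := by
    have : t / d ≤ 2 := by rwa [div_le_iff₀ hd]
    linarith
  unfold ramp
  rw [min_eq_left this, max_eq_right zero_le_one]

lemma ramp_eq_zero {d t : ℝ} (hd : 0 < d) (ht : 3 * d ≤ t) : ramp d t = 0 := by
  have : 3 - t / d ≤ 0 := by
    have : 3 ≤ t / d := by rwa [le_div_iff₀ hd]
    linarith
  unfold ramp
  exact max_eq_left ((min_le_right _ _).trans this)

lemma ramp_lip {d : ℝ} (hd : 0 < d) (s t : ℝ) : |ramp d s - ramp d t| ≤ 1 / d * |s - t| := by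
  unfold ramp
  have h1 := abs_max_sub_max_le_abs (min 1 (3 - s / d)) (min 1 (3 - t / d)) 0
  rw [max_comm 0, max_comm 0]
  refine h1.trans ?_
  have h2 := abs_min_sub_min_le_max 1 (3 - s / d) 1 (3 - t / d)
  refine h2.trans ?_
  rw [sub_self, abs_zero, max_eq_right (abs_nonneg _)]
  rw [show 3 - s / d - (3 - t / d) = -(1 / d * (s - t)) by field_simp; ring, abs_neg, abs_mul,
    abs_of_pos (by positivity)]

/-- Interpolation between `v` near `K` and `u` away from `K`. -/
def glue (K : Set X) (d : ℝ) (v u : X → ℝ) (z : X) : ℝ :=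
  ramp d (infDist z K) * v z + (1 - ramp d (infDist z K)) * u z

/-- The upper gradient of the interpolation. -/
def glueGrad (K : Set X) (d : ℝ) (v u : X → ℝ) (h g : X → ℝ≥0∞) (z : X) : ℝ≥0∞ :=
  {z | infDist z K < 4 * d}.indicator h z + {z | d < infDist z K}.indicator g z +
    {z | d < infDist z K ∧ infDist z K < 4 * d}.indicator
      (fun z => ENNReal.ofReal (1 / d * |v z - u z|)) z

lemma isOpen_lt_infDist (K : Set X) (d : ℝ) : IsOpen {z | d < infDist z K} :=
  isOpen_lt continuous_const (continuous_infDist_pt K)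

lemma isOpen_infDist_lt (K : Set X) (d : ℝ) : IsOpen {z | infDist z K < d} :=
  isOpen_lt (continuous_infDist_pt K) continuous_const

lemma ramp_infDist_lip {K : Set X} {d : ℝ} (hd : 0 < d) (x y : X) :
    |ramp d (infDist x K) - ramp d (infDist y K)| ≤ 1 / d * dist x y := by
  refine (ramp_lip hd _ _).trans ?_
  gcongr
  have := (lipschitz_infDist_pt K).dist_le_mul x y
  rwa [NNReal.coe_one, one_mul, Real.dist_eq] at this

lemma glue_ug {K U : Set X} {d : ℝ} (hd : 0 < d)
    (hKU : {z | infDist z K < 4 * d} ⊆ U) {v u : X → ℝ} {h g : X → ℝ≥0∞}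
    (hvc : ContinuousOn v U) (huc : Continuous u) (hv : IsUpperGradientOn h v U)
    (hu : IsUpperGradientOn g u univ) :
    IsUpperGradientOn (glueGrad K d v u h g) (glue K d v u) univ := by
  set V : Fin 3 → Set X := ![{z | infDist z K < 2 * d},
    {z | d < infDist z K ∧ infDist z K < 4 * d}, {z | 3 * d < infDist z K}] with hV
  refine ug_of_cover V ?_ ?_ ?_
  · intro i
    fin_cases i
    · exact isOpen_infDist_lt K _
    · exact (isOpen_lt_infDist K _).inter (isOpen_infDist_lt K _)
    · exact isOpen_lt_infDist K _
  · intro z _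
    rw [mem_iUnion]
    by_cases h1 : infDist z K < 2 * d
    · exact ⟨0, h1⟩
    · by_cases h2 : infDist z K < 4 * d
      · exact ⟨1, by push Not at h1; exact ⟨by linarith, h2⟩⟩
      · exact ⟨2, by push Not at h2; exact (by linarith : 3 * d < infDist z K)⟩
  · intro i
    rw [inter_univ]
    fin_cases i
    · change IsUpperGradientOn _ _ {z | infDist z K < 2 * d}
      refine IsUpperGradientOn.congr (u := v) (hv.mono (fun z hz => hKU ?_) fun z hz => ?_)
        fun z hz => ?_
      · simp only [mem_ofPred_eq] at hz ⊢; linarith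
      · have : z ∈ {z | infDist z K < 4 * d} := by simp only [mem_ofPred_eq] at hz ⊢; linarith
        rw [glueGrad, indicator_of_mem this, add_assoc]
        exact le_self_add
      · rw [glue, ramp_eq_one hd (le_of_lt hz)]; ring
    · change IsUpperGradientOn _ _ {z | d < infDist z K ∧ infDist z K < 4 * d}
      set W := {z | d < infDist z K ∧ infDist z K < 4 * d} with hW
      have hWU : W ⊆ U := fun z hz => hKU hz.2
      have hGW : ∀ z ∈ W, glueGrad K d v u h g z =
          h z + g z + ENNReal.ofReal (1 / d * |v z - u z|) := by
        intro z hz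
        rw [glueGrad, indicator_of_mem (show z ∈ {z | infDist z K < 4 * d} from hz.2),
          indicator_of_mem (show z ∈ {z | d < infDist z K} from hz.1), indicator_of_mem hz]
      refine ug_of_local fun γ hγ L hL ε hε t ht => ?_
      set ε' : ℝ := ε * d / (2 * (L + 1)) with hε'
      have hL0 : (0 : ℝ) ≤ L := L.2
      have hε'0 : 0 < ε' := by have : (0 : ℝ) < ε := hε; positivity
      set q : ℝ → ℝ := fun s => |v (γ.toFun s) - u (γ.toFun s)| with hq
      have hqc : ContinuousOn q (Icc 0 1) := by
        refine continuous_abs.comp_continuousOn (ContinuousOn.sub ?_ ?_)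
        · exact hvc.comp γ.continuousOn fun s hs => hWU (hγ s hs)
        · exact huc.comp_continuousOn γ.continuousOn
      obtain ⟨δ, hδ, hδ'⟩ := Metric.continuousOn_iff.mp hqc t ht ε' hε'0
      refine ⟨δ, hδ, fun a b ha hab hb hs => ?_⟩
      have hab01 : ∀ s ∈ Icc a b, s ∈ Icc (0 : ℝ) 1 := fun s hs => ⟨ha.trans hs.1, hs.2.trans hb⟩
      have hW' : ∀ s ∈ Icc a b, γ.toFun s ∈ W := fun s hs => hγ s (hab01 s hs)
      have hqs : ∀ s ∈ Icc a b, |q s - q t| < ε' := fun s hs' => by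
        have := hδ' s (hab01 s hs') (by rw [Real.dist_eq]; exact hs s hs')
        rwa [Real.dist_eq] at this
      set A := γ.toFun a
      set B := γ.toFun b
      have e1 : glue K d v u B - glue K d v u A =
          ramp d (infDist A K) * (v B - v A) + (1 - ramp d (infDist A K)) * (u B - u A) +
          (ramp d (infDist B K) - ramp d (infDist A K)) * (v B - u B) := by
        unfold glue; ring
      have hr0 := ramp_nonneg d (infDist A K)
      have hr1 := ramp_le_one d (infDist A K)
      set p : ℝ := max 0 (q t - ε') with hp
      have hp0 : 0 ≤ p := le_max_left _ _
      have hqB : |v B - u B| ≤ p + 2 * ε' := by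
        have := (abs_lt.mp (hqs b (right_mem_Icc.mpr hab))).2
        change q b ≤ _
        linarith [le_max_right 0 (q t - ε')]
      have hdist : dist B A ≤ L * (b - a) := by
        have := hL.dist_le_mul b (hab01 b (right_mem_Icc.mpr hab)) a
          (hab01 a (left_mem_Icc.mpr hab))
        rwa [Real.dist_eq, abs_of_nonneg (by linarith)] at this
      have e2 : |glue K d v u B - glue K d v u A| ≤ |v B - v A| + |u B - u A| +
          (p / d) * dist B A + ε * (b - a) := by
        rw [e1]
        refine (abs_add_three _ _ _).trans ?_
        rw [abs_mul, abs_mul, abs_mul, abs_of_nonneg hr0,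
          abs_of_nonneg (by linarith : 0 ≤ 1 - ramp d (infDist A K))]
        have a1 : ramp d (infDist A K) * |v B - v A| ≤ |v B - v A| :=
          mul_le_of_le_one_left (abs_nonneg _) hr1
        have a2 : (1 - ramp d (infDist A K)) * |u B - u A| ≤ |u B - u A| :=
          mul_le_of_le_one_left (abs_nonneg _) (by linarith)
        have a3 : |ramp d (infDist B K) - ramp d (infDist A K)| * |v B - u B| ≤
            (1 / d * dist B A) * (p + 2 * ε') :=
          mul_le_mul (ramp_infDist_lip hd B A) hqB (abs_nonneg _) (by positivity)
        have a4 : (1 / d * dist B A) * (2 * ε') ≤ ε * (b - a) := by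
          calc (1 / d * dist B A) * (2 * ε') ≤ (1 / d * (L * (b - a))) * (2 * ε') := by gcongr
            _ = ε * (b - a) * (L / (L + 1)) := by rw [hε']; field_simp
            _ ≤ ε * (b - a) * 1 := by
              have : 0 ≤ b - a := by linarith
              gcongr
              rw [div_le_one (by positivity)]; linarith
            _ = _ := mul_one _
        have a5 : (1 / d * dist B A) * p = p / d * dist B A := by ring
        linarith
      have b1 : ENNReal.ofReal |v B - v A| ≤
          ∫⁻ s in Icc a b, h (γ.toFun s) * speed γ.toFun s :=
        hv.sub γ ha hab hb fun s hs => hWU (hW' s hs)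
      have b2 : ENNReal.ofReal |u B - u A| ≤
          ∫⁻ s in Icc a b, g (γ.toFun s) * speed γ.toFun s :=
        hu.sub γ ha hab hb fun s hs => mem_univ _
      have b3 : ENNReal.ofReal (p / d * dist B A) ≤
          ∫⁻ s in Icc a b, ENNReal.ofReal (1 / d * |v (γ.toFun s) - u (γ.toFun s)|) *
            speed γ.toFun s := by
        rw [ENNReal.ofReal_mul (by positivity)]
        refine (mul_le_mul_right (dist_le_speed γ ha hab hb) _).trans ?_
        rw [← lintegral_const_mul' _ _ ENNReal.ofReal_ne_top]
        refine setLIntegral_mono' measurableSet_Icc fun s hs' => ?_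
        gcongr
        rw [div_eq_inv_mul, one_div]
        gcongr
        refine max_le (abs_nonneg _) ?_
        have := (abs_lt.mp (hqs s hs')).1
        change _ ≤ q s
        linarith
      refine (ENNReal.ofReal_le_ofReal e2).trans ?_
      have hba : 0 ≤ b - a := by linarith
      rw [ENNReal.ofReal_add (by positivity) (by positivity),
        ENNReal.ofReal_add (by positivity) (by positivity),
        ENNReal.ofReal_add (by positivity) (by positivity)]
      refine add_le_add ?_ ?_
      · refine (add_le_add (add_le_add b1 b2) b3).trans ?_
        refine (add_le_add (le_lintegral_add _ _) le_rfl).trans ((le_lintegral_add _ _).trans ?_)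
        refine setLIntegral_mono' measurableSet_Icc fun s hs' => ?_
        rw [hGW _ (hW' s hs'), add_mul, add_mul]
      · rw [Real.volume_Icc, ENNReal.ofReal_mul (NNReal.coe_nonneg ε), ENNReal.ofReal_coe_nnreal]
    · change IsUpperGradientOn _ _ {z | 3 * d < infDist z K}
      refine IsUpperGradientOn.congr (u := u) (hu.mono (subset_univ _) fun z hz => ?_)
        fun z hz => ?_
      · have : z ∈ {z | d < infDist z K} := by simp only [mem_ofPred_eq] at hz ⊢; linarith
        rw [glueGrad, indicator_of_mem this, add_assoc, add_left_comm]
        exact le_self_add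
      · rw [glue, ramp_eq_zero hd (le_of_lt hz)]; ring

lemma glue_locLip {K U : Set X} {d : ℝ} (hd : 0 < d)
    (hKU : {z | infDist z K < 4 * d} ⊆ U) {v u : X → ℝ}
    (hv : LocLipschitzOn v U) (hu : LocLipschitzOn u univ) :
    LocLipschitzOn (glue K d v u) univ := by
  have hr : LipschitzWith (1 / d).toNNReal fun z => ramp d (infDist z K) := by
    refine LipschitzWith.of_dist_le_mul fun x y => ?_
    rw [Real.dist_eq, Real.coe_toNNReal _ (by positivity)]
    exact ramp_infDist_lip hd x y
  have hr' : LipschitzWith (0 + (1 / d).toNNReal) fun z => 1 - ramp d (infDist z K) :=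
    (LipschitzWith.const 1).sub hr
  refine LocLipschitzOn.of_cover ![{z | infDist z K < 4 * d}, {z | 3 * d < infDist z K}] ?_ ?_ ?_
    isOpen_univ
  · intro i
    fin_cases i
    · exact isOpen_infDist_lt K _
    · exact isOpen_lt_infDist K _
  · intro z _
    rw [mem_iUnion]
    by_cases h1 : infDist z K < 4 * d
    · exact ⟨0, h1⟩
    · exact ⟨1, by push Not at h1; exact (by linarith : 3 * d < infDist z K)⟩
  · intro i
    rw [inter_univ]
    fin_cases i
    · exact ((locLip_of_lipschitz hr _).mul (hv.mono hKU)).add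
        ((locLip_of_lipschitz hr' _).mul (hu.mono (subset_univ _)))
    · refine (hu.mono (subset_univ _)).congr fun z hz => ?_
      rw [glue, ramp_eq_zero hd (le_of_lt hz)]; ring

lemma glueGrad_measurable {K U : Set X} {d : ℝ} (hKU : {z | infDist z K < 4 * d} ⊆ U)
    {v u : X → ℝ} {h g : X → ℝ≥0∞} (hvc : ContinuousOn v U) (huc : Continuous u)
    (hh : Measurable h) (hg : Measurable g) : Measurable (glueGrad K d v u h g) := by
  refine ((hh.indicator (isOpen_infDist_lt K _).measurableSet).add
    (hg.indicator (isOpen_lt_infDist K _).measurableSet)).add ?_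
  have ho : IsOpen {z | d < infDist z K ∧ infDist z K < 4 * d} :=
    (isOpen_lt_infDist K _).inter (isOpen_infDist_lt K _)
  classical
  rw [← piecewise_eq_indicator]
  refine ContinuousOn.measurable_piecewise ?_ continuousOn_const ho.measurableSet
  refine ENNReal.continuous_ofReal.comp_continuousOn (continuousOn_const.mul
    (continuous_abs.comp_continuousOn (ContinuousOn.sub ?_ huc.continuousOn)))
  exact hvc.mono fun z hz => hKU hz.2

lemma lintegral_glueGrad_le {K : Set X} {d : ℝ} (hd : 0 < d)
    {v u : X → ℝ} {h g : X → ℝ≥0∞} (hh : Measurable h) (hg : Measurable g) :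
    ∫⁻ z, glueGrad K d v u h g z ∂μ ≤ ∫⁻ z in {z | infDist z K < 4 * d}, h z ∂μ +
      ∫⁻ z in {z | d < infDist z K}, g z ∂μ + ENNReal.ofReal (1 / d) *
      ∫⁻ z in {z | d < infDist z K ∧ infDist z K < 4 * d}, ENNReal.ofReal |v z - u z| ∂μ := by
  have ho : IsOpen {z | d < infDist z K ∧ infDist z K < 4 * d} :=
    (isOpen_lt_infDist K _).inter (isOpen_infDist_lt K _)
  have hm : Measurable fun z => {z | infDist z K < 4 * d}.indicator h z +
      {z | d < infDist z K}.indicator g z :=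
    (hh.indicator (isOpen_infDist_lt K _).measurableSet).add
      (hg.indicator (isOpen_lt_infDist K _).measurableSet)
  unfold glueGrad
  rw [lintegral_add_left hm,
    lintegral_add_left (hh.indicator (isOpen_infDist_lt K _).measurableSet),
    lintegral_indicator (isOpen_infDist_lt K _).measurableSet,
    lintegral_indicator (isOpen_lt_infDist K _).measurableSet,
    lintegral_indicator ho.measurableSet]
  gcongr
  rw [← lintegral_const_mul' _ _ ENNReal.ofReal_ne_top]
  refine lintegral_mono fun z => ?_
  simp only
  rw [ENNReal.ofReal_mul (by positivity)]

end Glue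

lemma ennreal_liminf_add_le (f g : ℕ → ℝ≥0∞) :
    liminf f atTop + liminf g atTop ≤ liminf (fun i => f i + g i) atTop := by
  rw [liminf_eq_iSup_iInf_of_nat, liminf_eq_iSup_iInf_of_nat, liminf_eq_iSup_iInf_of_nat,
    ENNReal.iSup_add_iSup_of_monotone]
  · refine iSup_mono fun n => le_iInf₂ fun i hi => ?_
    exact add_le_add (iInf₂_le i hi) (iInf₂_le i hi)
  · exact fun m n hmn => le_iInf₂ fun i hi => iInf₂_le i (hmn.trans hi)
  · exact fun m n hmn => le_iInf₂ fun i hi => iInf₂_le i (hmn.trans hi)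

section Comparison

variable {X : Type*} [MetricSpace X] [MeasurableSpace X] [BorelSpace X] [ProperSpace X]
  {μ : Measure X}

/-- The transition energy of the interpolation. -/
def glueCost (μ : Measure X) (K : Set X) (d : ℝ) (v u : X → ℝ) : ℝ≥0∞ :=
  ENNReal.ofReal (1 / d) *
    ∫⁻ z in {z | d < infDist z K ∧ infDist z K < 4 * d}, ENNReal.ofReal |v z - u z| ∂μ

lemma isCompact_infDist_le {K : Set X} (hne : K.Nonempty) (hb : Bornology.IsBounded K) (r : ℝ) :
    IsCompact {z | infDist z K ≤ r} := by
  refine Metric.isCompact_of_isClosed_isBounded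
    (isClosed_le (continuous_infDist_pt K) continuous_const) ?_
  refine (hb.cthickening (δ := r)).subset fun z hz => ?_
  rw [mem_ofPred_eq] at hz
  rw [mem_cthickening_iff, infEDist]
  rw [← infEDist]
  rw [← ENNReal.ofReal_toReal (infEDist_ne_top hne)]
  exact ENNReal.ofReal_le_ofReal hz

lemma glue_sub_le {K : Set X} {d : ℝ} (v u v' u' : X → ℝ) (z : X) :
    |glue K d v u z - glue K d v' u' z| ≤
      1 * (ramp d (infDist z K) * |v z - v' z|) + 1 * |u z - u' z| := by
  have h0 := ramp_nonneg d (infDist z K)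
  have h1 := ramp_le_one d (infDist z K)
  have : glue K d v u z - glue K d v' u' z = ramp d (infDist z K) * (v z - v' z) +
      (1 - ramp d (infDist z K)) * (u z - u' z) := by unfold glue; ring
  rw [this]
  refine (abs_add_le _ _).trans ?_
  rw [abs_mul, abs_mul, abs_of_nonneg h0, abs_of_nonneg (by linarith :
    0 ≤ 1 - ramp d (infDist z K)), one_mul, one_mul]
  gcongr
  exact mul_le_of_le_one_left (abs_nonneg _) (by linarith)

lemma ramp_eq_zero_of_notMem {K U : Set X} {d : ℝ} (hd : 0 < d)
    (hKU : {z | infDist z K ≤ 4 * d} ⊆ U) {z : X} (hz : z ∉ U) : ramp d (infDist z K) = 0 := by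
  refine ramp_eq_zero hd ?_
  by_contra hlt
  push Not at hlt
  exact hz (hKU (by simp only [mem_ofPred_eq]; linarith))

lemma measurable_ramp (K : Set X) (d : ℝ) : Measurable fun z => ramp d (infDist z K) := by
  unfold ramp
  exact measurable_const.max (measurable_const.min
    (measurable_const.sub ((continuous_infDist_pt K).measurable.div_const d)))

lemma TendstoL1Loc.glue {K U : Set X} {d : ℝ} (hd : 0 < d) (hne : K.Nonempty)
    (hb : Bornology.IsBounded K) (hKU : {z | infDist z K ≤ 4 * d} ⊆ U)
    {v u : X → ℝ} {vs us : ℕ → X → ℝ} (hv : TendstoL1Loc μ vs v U) (hu : TendstoL1Loc μ us u univ)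
    (hus : ∀ i, AEMeasurable (us i) μ) (hum : AEMeasurable u μ) :
    TendstoL1Loc μ (fun i => glue K d (vs i) (us i)) (glue K d v u) univ := by
  have h1 : TendstoL1Loc μ (fun i z => ramp d (infDist z K) * (vs i z - v z)) (fun _ => 0) univ := by
    intro C hC _
    refine tendsto_of_tendsto_of_tendsto_of_le_of_le tendsto_const_nhds
      (hv _ (isCompact_infDist_le hne hb (4 * d)) hKU) (fun _ => zero_le) fun i => ?_
    have hcl : IsClosed {z | infDist z K ≤ 4 * d} :=
      (isCompact_infDist_le hne hb (4 * d)).isClosed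
    simp only
    rw [← lintegral_indicator hcl.measurableSet]
    refine (setLIntegral_le_lintegral _ _).trans (lintegral_mono fun z => ?_)
    by_cases hz : z ∈ {z | infDist z K ≤ 4 * d}
    · rw [indicator_of_mem hz, sub_zero, abs_mul, abs_of_nonneg (ramp_nonneg _ _)]
      exact ENNReal.ofReal_le_ofReal (mul_le_of_le_one_left (abs_nonneg _) (ramp_le_one _ _))
    · have : ramp d (infDist z K) = 0 := ramp_eq_zero_of_notMem hd le_rfl hz
      rw [indicator_of_notMem hz]
      simp [this]
  refine hu.of_le h1 (M := 1) (N := 1) zero_le_one zero_le_one (fun i => (hus i).restrict)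
    hum.restrict fun i z _ => ?_
  refine (glue_sub_le _ _ _ _ z).trans ?_
  rw [sub_zero, abs_mul, abs_of_nonneg (ramp_nonneg _ _)]
  linarith

/-- Energy comparison: if `u` does not gain from the competitor `max (glue v u) ψ`, then the
variation of `u` near `K` is bounded by the energies of `v`, `ψ` and the transition energy. -/
theorem tv_le_of_comparison {K U : Set X} {d : ℝ} (hd : 0 < d) (hne : K.Nonempty)
    (hb : Bornology.IsBounded K) (hU : IsOpen U) (hKU : {z | infDist z K ≤ 4 * d} ⊆ U)
    {u v ψ : X → ℝ} {a c : ℝ≥0∞} (hum : AEMeasurable u μ) (hfin : tv μ u univ ≠ ⊤)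
    (hvm : AEMeasurable v (μ.restrict U)) (hv : Appr μ v U a) (hψ : Appr μ ψ univ c)
    (hmin : tv μ u univ ≤ tv μ (fun z => max (glue K d v u z) (ψ z)) univ) :
    tv μ u {z | infDist z K < d} ≤ a + glueCost μ K d v u + c := by
  obtain ⟨vs, h, v1, v2, v3, v4, v5⟩ := hv
  obtain ⟨ψs, k, p1, p2, p3, p4, p5⟩ := hψ
  set O := {z | infDist z K < d} with hO
  set b := glueCost μ K d v u with hbdef
  have hKU' : {z | infDist z K < 4 * d} ⊆ U := fun z hz => hKU (show infDist z K ≤ 4 * d from le_of_lt hz)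
  suffices H : tv μ u O + tv μ u univ ≤ (a + b + c) + tv μ u univ from
    (ENNReal.add_le_add_iff_right hfin).mp H
  refine ENNReal.le_of_forall_pos_le_add fun ε hε _ => ?_
  have hm' : tv μ u univ < tv μ u univ + ε :=
    ENNReal.lt_add_right hfin (by exact_mod_cast hε.ne')
  obtain ⟨us, g, u1, u2, u3, u4, u5⟩ := appr_of_tv_lt hm'
  have husm : ∀ i, AEMeasurable (us i) μ := fun i => (u1 i).continuous.aemeasurable
  -- the competitor sequence
  set G : ℕ → X → ℝ≥0∞ := fun i => glueGrad K d (vs i) (us i) (h i) (g i) with hG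
  have hGm : ∀ i, Measurable (G i) := fun i =>
    glueGrad_measurable hKU' ((v1 i).continuousOn hU) (u1 i).continuous (v3 i) (u3 i)
  have hgl := TendstoL1Loc.glue hd hne hb hKU v2 u2 husm hum
  have hglm : AEMeasurable (glue K d v u) μ := by
    have h1 : AEMeasurable (fun z => U.indicator v z) μ :=
      (aemeasurable_indicator_iff hU.measurableSet).mpr hvm
    have h2 : glue K d v u = fun z => ramp d (infDist z K) * U.indicator v z +
        (1 - ramp d (infDist z K)) * u z := by
      funext z
      unfold glue
      by_cases hz : z ∈ U
      · rw [indicator_of_mem hz]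
      · simp [ramp_eq_zero_of_notMem hd hKU hz]
    rw [h2]
    exact ((measurable_ramp K d).aemeasurable.mul h1).add
      ((measurable_const.sub (measurable_ramp K d)).aemeasurable.mul hum)
  have hle : tv μ (fun z => max (glue K d v u z) (ψ z)) univ ≤
      liminf (fun i => ∫⁻ z in univ, (G i z + k i z) ∂μ) atTop := by
    refine tv_le_liminf (v := fun i z => max (glue K d (vs i) (us i) z) (ψs i z))
      (fun i => (glue_locLip hd hKU' (v1 i) (u1 i)).max (p1 i)) ?_
      (fun i => (hGm i).add (p3 i)) fun i => (glue_ug hd hKU' ((v1 i).continuousOn hU)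
        (u1 i).continuous (v4 i) (u4 i)).max (p4 i)
    refine hgl.of_le p2 (M := 1) (N := 1) zero_le_one zero_le_one
      (fun i => (glue_locLip hd hKU' (v1 i) (u1 i)).continuous.aemeasurable) hglm.restrict
      fun i z _ => ?_
    refine (abs_max_sub_max_le_max _ _ _ _).trans (max_le ?_ ?_)
    · linarith [abs_nonneg (ψs i z - ψ z)]
    · linarith [abs_nonneg (glue K d (vs i) (us i) z - glue K d v u z)]
  have hO2 : tv μ u O ≤ liminf (fun i => ∫⁻ z in O, g i z ∂μ) atTop :=
    tv_le_liminf (fun i => (u1 i).mono (subset_univ _)) (fun K hK _ => u2 K hK (subset_univ _)) u3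
      fun i => (u4 i).mono (subset_univ _) fun _ _ => le_rfl
  -- the transition terms converge
  set S := {z | d < infDist z K ∧ infDist z K < 4 * d} with hS
  set C := {z | infDist z K ≤ 4 * d} with hC
  have hCc : IsCompact C := isCompact_infDist_le hne hb (4 * d)
  have hSC : S ⊆ C := fun z hz => le_of_lt hz.2
  set e : ℕ → ℝ≥0∞ := fun i => ENNReal.ofReal (1 / d) *
    (∫⁻ z in C, ENNReal.ofReal |vs i z - v z| ∂μ + ∫⁻ z in C, ENNReal.ofReal |us i z - u z| ∂μ)
    with he
  have he0 : Tendsto e atTop (𝓝 0) := by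
    have := ENNReal.Tendsto.const_mul (a := ENNReal.ofReal (1 / d))
      ((v2 C hCc hKU).add (u2 C hCc (subset_univ _))) (Or.inr ENNReal.ofReal_ne_top)
    rwa [add_zero, mul_zero] at this
  have hSm : MeasurableSet S :=
    ((isOpen_lt_infDist K _).inter (isOpen_infDist_lt K _)).measurableSet
  have htr : ∀ i, ENNReal.ofReal (1 / d) * ∫⁻ z in S, ENNReal.ofReal |vs i z - us i z| ∂μ ≤
      b + e i := by
    intro i
    rw [hbdef, glueCost, he, ← mul_add]
    gcongr
    have hr : AEMeasurable v (μ.restrict S) :=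
      hvm.mono_measure (Measure.restrict_mono (hSC.trans hKU) le_rfl)
    have hrs : AEMeasurable (vs i) (μ.restrict S) :=
      (locLip_aemeasurable hU (v1 i)).mono_measure (Measure.restrict_mono (hSC.trans hKU) le_rfl)
    have h1 : ∫⁻ z in S, ENNReal.ofReal |vs i z - us i z| ∂μ ≤
        ∫⁻ z in S, (ENNReal.ofReal |v z - u z| + (ENNReal.ofReal |vs i z - v z| +
          ENNReal.ofReal |us i z - u z|)) ∂μ := by
      refine lintegral_mono fun z => ?_
      simp only
      rw [← ENNReal.ofReal_add (abs_nonneg _) (abs_nonneg _),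
        ← ENNReal.ofReal_add (abs_nonneg _) (by positivity)]
      apply ENNReal.ofReal_le_ofReal
      have e1 : vs i z - us i z = (v z - u z) + (vs i z - v z) + (-(us i z - u z)) := by ring
      rw [e1]
      refine (abs_add_three _ _ _).trans ?_
      rw [abs_neg]; linarith
    refine h1.trans ?_
    rw [lintegral_add_left' (aem_diff hr hum.restrict), lintegral_add_left' (aem_diff hrs hr)]
    gcongr
  have hOm : IsOpen O := isOpen_infDist_lt K d
  have htot : ∀ i, ∫⁻ z in O, g i z ∂μ + ∫⁻ z in univ, (G i z + k i z) ∂μ ≤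
      (tv μ u univ + ε + (a + b + c)) + e i := by
    intro i
    rw [Measure.restrict_univ, lintegral_add_left (hGm i)]
    have h1 := lintegral_glueGrad_le (μ := μ) (K := K) hd (v := vs i) (u := us i) (v3 i) (u3 i)
    have h2 : ∫⁻ z in O, g i z ∂μ + ∫⁻ z in {z | d < infDist z K}, g i z ∂μ ≤
        tv μ u univ + ε := by
      rw [← lintegral_union (isOpen_lt_infDist K d).measurableSet]
      · exact (lintegral_mono_set (subset_univ _)).trans (u5 i)
      · rw [Set.disjoint_left]
        intro z hz hz'
        exact lt_asymm (show infDist z K < d from hz) hz'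
    have h3 : ∫⁻ z, k i z ∂μ ≤ c := by simpa using p5 i
    have h4 : ∫⁻ z in {z | infDist z K < 4 * d}, h i z ∂μ ≤ a :=
      (lintegral_mono_set hKU').trans (v5 i)
    calc _ ≤ ∫⁻ z in O, g i z ∂μ + ((a + ∫⁻ z in {z | d < infDist z K}, g i z ∂μ + (b + e i)) + c) := by
          gcongr
          exact h1.trans (add_le_add (add_le_add h4 le_rfl) (htr i))
      _ = (∫⁻ z in O, g i z ∂μ + ∫⁻ z in {z | d < infDist z K}, g i z ∂μ) + (a + b + c) + e i := by
          ring
      _ ≤ _ := by gcongr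
  calc tv μ u O + tv μ u univ
      ≤ liminf (fun i => ∫⁻ z in O, g i z ∂μ) atTop +
        liminf (fun i => ∫⁻ z in univ, (G i z + k i z) ∂μ) atTop :=
        add_le_add hO2 (hmin.trans hle)
    _ ≤ liminf (fun i => (tv μ u univ + ε + (a + b + c)) + e i) atTop :=
        (ennreal_liminf_add_le _ _).trans (liminf_le_liminf (Eventually.of_forall htot))
    _ = tv μ u univ + ε + (a + b + c) := by
        have := he0.const_add (tv μ u univ + ε + (a + b + c))
        rw [add_zero] at this
        exact this.liminf_eq
    _ = _ := by ring

end Comparison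

section Space

variable {X : Type*} [MetricSpace X] [MeasurableSpace X] [BorelSpace X]
  {μ : Measure X} {Cd CP lam : ℝ}

lemma MMS.ball_pos (hX : MMS μ Cd CP lam) (z : X) {r : ℝ} (hr : 0 < r) : 0 < μ (ball z r) := by
  have := (hX.doubling z (r / 2) (by linarith)).1
  rwa [mul_div_cancel₀ _ (two_ne_zero)] at this

lemma MMS.ball_lt_top (hX : MMS μ Cd CP lam) (z : X) (r : ℝ) : μ (ball z r) < ⊤ := by
  by_cases hr : 0 < r
  · exact (hX.doubling z r hr).2.2
  · rw [ball_eq_empty.mpr (not_lt.mp hr)]; simp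

lemma MMS.ball_ne_zero (hX : MMS μ Cd CP lam) (z : X) {r : ℝ} (hr : 0 < r) : μ (ball z r) ≠ 0 :=
  (hX.ball_pos z hr).ne'

lemma MMS.ball_ne_top (hX : MMS μ Cd CP lam) (z : X) (r : ℝ) : μ (ball z r) ≠ ⊤ :=
  (hX.ball_lt_top z r).ne

lemma MMS.exists_doubling (hX : MMS μ Cd CP lam) (N : ℝ) :
    ∃ C : ℝ≥0, 1 ≤ C ∧ ∀ (z : X) (r : ℝ), 0 < r → μ (ball z (N * r)) ≤ C * μ (ball z r) := by
  obtain ⟨n, hn⟩ := pow_unbounded_of_one_lt N (one_lt_two)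
  have h1 : ∀ m : ℕ, ∀ (z : X) (r : ℝ), 0 < r →
      μ (ball z (2 ^ m * r)) ≤ (Cd.toNNReal ^ m : ℝ≥0) * μ (ball z r) := by
    intro m
    induction m with
    | zero => intro z r _; simp
    | succ m ih =>
      intro z r hr
      have h2 := (hX.doubling z (2 ^ m * r) (by positivity)).2.1
      rw [pow_succ', mul_assoc, pow_succ', ENNReal.coe_mul, mul_assoc]
      exact h2.trans (mul_le_mul_right (ih z r hr) _)
  refine ⟨Cd.toNNReal ^ n, one_le_pow₀ ?_, fun z r hr => ?_⟩
  · rw [← Real.toNNReal_one]; exact Real.toNNReal_le_toNNReal hX.hCd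
  · exact (measure_mono (ball_subset_ball (by gcongr))).trans (h1 n z r hr)

lemma MMS.properSpace (hX : MMS μ Cd CP lam) : ProperSpace X := by
  have := hX.complete
  refine ⟨fun x r => ?_⟩
  refine TotallyBounded.isCompact_of_isClosed ?_ isClosed_closedBall
  rw [Metric.totallyBounded_iff]
  intro ε hε
  by_contra hcon
  push Not at hcon
  have hr : 0 ≤ r := by
    by_contra hneg
    refine hcon ∅ finite_empty ?_
    rw [closedBall_eq_empty.mpr (by linarith)]; exact empty_subset _
  obtain ⟨f, hf1, hf2⟩ := exists_seq_of_forall_finset_exists (fun y => y ∈ closedBall x r)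
    (fun y z => ε ≤ dist z y) (fun s _ => by
      have := hcon s s.finite_toSet
      obtain ⟨z, hz, hz'⟩ := not_subset.mp this
      refine ⟨z, hz, fun y hy => ?_⟩
      by_contra hlt
      exact hz' (mem_iUnion₂.mpr ⟨y, hy, mem_ball.mpr (not_le.mp hlt)⟩))
  obtain ⟨C, hC1, hC⟩ := hX.exists_doubling ((2 * r + ε) / (ε / 2))
  have hd : Pairwise (Function.onFun Disjoint fun n => ball (f n) (ε / 2)) := by
    have key : ∀ m n, m < n → Disjoint (ball (f m) (ε / 2)) (ball (f n) (ε / 2)) := fun m n hmn =>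
      ball_disjoint_ball (by rw [dist_comm]; linarith [hf2 m n hmn])
    intro m n hmn
    rcases lt_or_gt_of_ne hmn with h | h
    · exact key m n h
    · exact (key n m h).symm
  have hsub : ⋃ n, ball (f n) (ε / 2) ⊆ ball x (r + ε) := by
    refine iUnion_subset fun n => ball_subset_ball' ?_
    have := mem_closedBall.mp (hf1 n)
    linarith
  have hμ := measure_mono (μ := μ) hsub
  rw [measure_iUnion hd fun n => measurableSet_ball] at hμ
  have hlow : ∀ n, (C : ℝ≥0∞)⁻¹ * μ (ball x ε) ≤ μ (ball (f n) (ε / 2)) := by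
    intro n
    have h1 := hC (f n) (ε / 2) (by linarith)
    rw [div_mul_cancel₀ _ (by linarith)] at h1
    have h2 : ball x ε ⊆ ball (f n) (2 * r + ε) := by
      apply ball_subset_ball'
      have := mem_closedBall'.mp (hf1 n)
      linarith
    have h3 : (C : ℝ≥0∞) ≠ 0 := by exact_mod_cast (zero_lt_one.trans_le hC1).ne'
    rw [ENNReal.inv_mul_le_iff h3 ENNReal.coe_ne_top]
    exact (measure_mono h2).trans h1
  have hc : (C : ℝ≥0∞)⁻¹ * μ (ball x ε) ≠ 0 :=
    mul_ne_zero (ENNReal.inv_ne_zero.mpr ENNReal.coe_ne_top) (hX.ball_ne_zero x hε)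
  have := (ENNReal.tsum_le_tsum hlow).trans hμ
  rw [ENNReal.tsum_const_eq_top_of_ne_zero hc, top_le_iff] at this
  exact hX.ball_ne_top x _ this

lemma MMS.isLocallyFinite (hX : MMS μ Cd CP lam) : IsLocallyFiniteMeasure μ :=
  ⟨fun x => ⟨ball x 1, ball_mem_nhds x one_pos, hX.ball_lt_top x 1⟩⟩

lemma infDist_singleton_set (z0 : X) (r : ℝ) : {z | infDist z {z0} < r} = ball z0 r := by
  ext z; simp [mem_ball]

variable [ProperSpace X]

/-- Poincaré inequality for functions defined only locally. -/
lemma MMS.local_poincare (hX : MMS μ Cd CP lam) (z : X) {ρ : ℝ} (hρ : 0 < ρ)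
    {v : X → ℝ} {h : X → ℝ≥0∞} (hv : LocLipschitzOn v (ball z (4 * lam * ρ))) (hh : Measurable h)
    (hug : IsUpperGradientOn h v (ball z (4 * lam * ρ))) :
    ∃ c : ℝ, ∫⁻ y in ball z ρ, ENNReal.ofReal |v y - c| ∂μ ≤
      ENNReal.ofReal (CP * ρ) * ∫⁻ y in ball z (4 * lam * ρ), h y ∂μ := by
  have hlam := hX.hlam
  have hLF := hX.isLocallyFinite
  have hd : 0 < lam * ρ := by positivity
  set U := ball z (4 * lam * ρ) with hU
  have hKU : {y | infDist y {z} < 4 * (lam * ρ)} ⊆ U := by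
    rw [infDist_singleton_set, ← mul_assoc]
  have hug0 : IsUpperGradientOn (fun _ => (0 : ℝ≥0∞)) (fun _ : X => (0 : ℝ)) univ := ug_const 0 _
  have hvc := hv.continuousOn isOpen_ball
  have hw := glue_ug hd hKU hvc continuous_const hug hug0
  have hwl := glue_locLip hd hKU hv (locLip_const 0 univ)
  have hgm := glueGrad_measurable hKU hvc (continuous_const : Continuous fun _ : X => (0 : ℝ)) hh
    (measurable_const : Measurable fun _ : X => (0 : ℝ≥0∞))
  have hp := hX.poincare z ρ hρ _ (hwl.continuous.locallyIntegrable) _ hgm hw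
  refine ⟨⨍ y in ball z ρ, glue {z} (lam * ρ) v (fun _ => 0) y ∂μ,
    le_trans (le_of_eq ?_) (hp.trans ?_)⟩
  · refine setLIntegral_congr_fun measurableSet_ball fun y hy => ?_
    have : glue {z} (lam * ρ) v (fun _ => 0) y = v y := by
      rw [glue, ramp_eq_one hd]
      · ring
      · rw [infDist_singleton]
        have := mem_ball.mp hy
        nlinarith
    simp only [this]
  · have hratio : μ (ball z ρ) / μ (ball z (lam * ρ)) ≤ 1 := by
      refine ENNReal.div_le_of_le_mul ?_
      rw [one_mul]
      exact measure_mono (ball_subset_ball (by nlinarith))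
    calc _ ≤ ENNReal.ofReal (CP * ρ) * 1 * ∫⁻ y in ball z (lam * ρ), h y ∂μ := by
          refine mul_le_mul' (by gcongr) ?_
          refine le_of_eq (setLIntegral_congr_fun measurableSet_ball fun y hy => ?_)
          have hy' := mem_ball.mp hy
          have e0 : infDist y {z} = dist y z := infDist_singleton
          have n1 : y ∈ {y | infDist y {z} < 4 * (lam * ρ)} := by
            rw [mem_ofPred_eq, e0]; linarith
          have n2 : y ∉ {y | lam * ρ < infDist y {z}} := by
            rw [mem_ofPred_eq, e0]; linarith
          have n3 : y ∉ {y | lam * ρ < infDist y {z} ∧ infDist y {z} < 4 * (lam * ρ)} :=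
            fun h => n2 h.1
          rw [glueGrad, indicator_of_mem n1, indicator_of_notMem n2, indicator_of_notMem n3]
          simp
      _ ≤ _ := by
          rw [mul_one]
          gcongr
          exact ball_subset_ball (by nlinarith)

/-- Relative isoperimetric inequality. -/
lemma MMS.isoperimetric (hX : MMS μ Cd CP lam) {E : Set X} (hE : MeasurableSet E) (z : X) {ρ : ℝ}
    (hρ : 0 < ρ) : min (μ (E ∩ ball z ρ)) (μ (ball z ρ \ E)) ≤
      ENNReal.ofReal (2 * CP * ρ) * tv μ (chi E) (ball z (4 * lam * ρ)) := by
  have hlam := hX.hlam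
  have hCP := hX.hCP
  have hc0 : ENNReal.ofReal (2 * CP * ρ) ≠ 0 := by
    rw [Ne, ENNReal.ofReal_eq_zero, not_le]; positivity
  rw [mul_comm (ENNReal.ofReal _),
    ← ENNReal.div_le_iff_le_mul (Or.inl hc0) (Or.inl ENNReal.ofReal_ne_top)]
  refine le_of_forall_gt_imp_ge_of_dense fun a ha => ?_
  rw [ENNReal.div_le_iff_le_mul (Or.inl hc0) (Or.inl ENNReal.ofReal_ne_top)]
  obtain ⟨v, h, h1, h2, h3, h4, h5⟩ := appr_of_tv_lt ha
  set B := ball z ρ with hB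
  have hBU : closedBall z ρ ⊆ ball z (4 * lam * ρ) := closedBall_subset_ball (by nlinarith)
  have hBC : B ⊆ closedBall z ρ := ball_subset_closedBall
  have hconv := h2 _ (isCompact_closedBall z ρ) hBU
  have hchim : Measurable (chi E) := measurable_const.indicator hE
  have key : ∀ i, min (μ (E ∩ B)) (μ (B \ E)) ≤ ENNReal.ofReal (2 * CP * ρ) * a +
      2 * ∫⁻ y in closedBall z ρ, ENNReal.ofReal |v i y - chi E y| ∂μ := by
    intro i
    obtain ⟨c, hc⟩ := hX.local_poincare z hρ (h1 i) (h3 i) (h4 i)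
    have e1 : ∫⁻ y in B, ENNReal.ofReal |chi E y - c| ∂μ ≤ ENNReal.ofReal (CP * ρ) * a +
        ∫⁻ y in closedBall z ρ, ENNReal.ofReal |v i y - chi E y| ∂μ := by
      have hvm : AEMeasurable (v i) (μ.restrict B) :=
        (locLip_aemeasurable isOpen_ball (h1 i)).mono_measure
          (Measure.restrict_mono (hBC.trans hBU) le_rfl)
      calc _ ≤ ∫⁻ y in B, (ENNReal.ofReal |v i y - c| + ENNReal.ofReal |v i y - chi E y|) ∂μ := by
            refine lintegral_mono fun y => ?_
            simp only
            rw [← ENNReal.ofReal_add (abs_nonneg _) (abs_nonneg _)]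
            apply ENNReal.ofReal_le_ofReal
            rw [show chi E y - c = (v i y - c) + -(v i y - chi E y) by ring]
            exact (abs_add_le _ _).trans_eq (by rw [abs_neg])
        _ ≤ _ := by
            rw [lintegral_add_left' (aem_diff hvm aemeasurable_const)]
            refine add_le_add (hc.trans ?_) (lintegral_mono_set hBC)
            gcongr
            exact h5 i
    have e2 : ∀ S : Set X, S ⊆ B → MeasurableSet S → (∀ y ∈ S, 1 / 2 ≤ |chi E y - c|) →
        μ S ≤ 2 * ∫⁻ y in B, ENNReal.ofReal |chi E y - c| ∂μ := by
      intro S hS hSm hS2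
      calc μ S = 2 * ∫⁻ y in S, ENNReal.ofReal (1 / 2) ∂μ := by
            rw [setLIntegral_const, ← mul_assoc]
            rw [show (2 : ℝ≥0∞) = ENNReal.ofReal 2 by simp,
              ← ENNReal.ofReal_mul (by norm_num)]
            norm_num
        _ ≤ 2 * ∫⁻ y in S, ENNReal.ofReal |chi E y - c| ∂μ := by
            gcongr 2 * ?_
            exact setLIntegral_mono' hSm fun y hy => ENNReal.ofReal_le_ofReal (hS2 y hy)
        _ ≤ _ := by gcongr
    have e3 : min (μ (E ∩ B)) (μ (B \ E)) ≤ 2 * ∫⁻ y in B, ENNReal.ofReal |chi E y - c| ∂μ := by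
      rcases le_total c (1 / 2) with hc2 | hc2
      · refine (min_le_left _ _).trans (e2 _ inter_subset_right (hE.inter measurableSet_ball) ?_)
        intro y hy
        rw [chi, indicator_of_mem hy.1]
        exact le_trans (by linarith) (le_abs_self _)
      · refine (min_le_right _ _).trans (e2 _ sdiff_subset (measurableSet_ball.diff hE) ?_)
        intro y hy
        rw [chi, indicator_of_notMem hy.2]
        exact le_trans (by linarith) (neg_le_abs _)
    refine e3.trans ((mul_le_mul_right e1 2).trans_eq ?_)
    rw [mul_add, ← mul_assoc, show 2 * CP * ρ = 2 * (CP * ρ) by ring,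
      ENNReal.ofReal_mul zero_le_two]
    simp
  have hlim := (ENNReal.Tendsto.const_mul (a := 2) hconv (Or.inr (by simp))).const_add
    (ENNReal.ofReal (2 * CP * ρ) * a)
  rw [mul_zero, add_zero] at hlim
  rw [mul_comm a]
  exact ge_of_tendsto' hlim key

/-- A nonempty exterior forces nonempty annuli. -/
lemma MMS.annulus_nonempty (hX : MMS μ Cd CP lam) {x y : X} {r : ℝ} (hr : 0 < r)
    (hy : 4 * r ≤ dist y x) : ∃ p, 3 * r ≤ dist p x ∧ dist p x < 4 * r := by
  by_contra hcon
  push Not at hcon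
  set E := ball x (3 * r) with hE
  have hcov : ∀ z, dist z x < 3 * r ∨ 7 / 2 * r < dist z x := by
    intro z
    by_cases h : dist z x < 3 * r
    · exact Or.inl h
    · right
      have := hcon z (not_lt.mp h)
      linarith
  have hop : IsOpen {z | 7 / 2 * r < dist z x} :=
    isOpen_lt continuous_const (continuous_id.dist continuous_const)
  have hV : ∀ b : Bool, IsOpen (cond b E {z | 7 / 2 * r < dist z x}) := by
    intro b; cases b
    · exact hop
    · exact isOpen_ball
  have hVc : (univ : Set X) ⊆ ⋃ b : Bool, cond b E {z | 7 / 2 * r < dist z x} := by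
    intro z _
    rw [mem_iUnion]
    rcases hcov z with h | h
    · exact ⟨true, h⟩
    · exact ⟨false, h⟩
  have hone : ∀ z ∈ E, (1 : ℝ) = chi E z := fun z hz => by
    rw [chi, indicator_of_mem hz]
  have hzero : ∀ z ∈ {z | 7 / 2 * r < dist z x}, (0 : ℝ) = chi E z := fun z hz =>
    (indicator_of_notMem (fun h => by
      have h1 := mem_ball.mp h
      rw [mem_ofPred_eq] at hz
      linarith) _).symm
  have hug : IsUpperGradientOn (fun _ => 0) (chi E) univ := by
    refine ug_of_cover _ hV hVc fun b => ?_
    rw [inter_univ]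
    cases b
    · exact (ug_const 0 _).congr hzero
    · exact (ug_const 1 _).congr hone
  have hll : LocLipschitzOn (chi E) univ := by
    refine LocLipschitzOn.of_cover _ hV hVc (fun b => ?_) isOpen_univ
    rw [inter_univ]
    cases b
    · exact (locLip_const 0 _).congr hzero
    · exact (locLip_const 1 _).congr hone
  have htv : tv μ (chi E) univ = 0 := by
    refine le_antisymm (Appr.tv_le ⟨fun _ => chi E, fun _ _ => 0, fun _ => hll,
      tendstoL1Loc_const _ _, fun _ => measurable_const, fun _ => hug, fun _ => by simp⟩) zero_le
  set D := dist y x with hD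
  have hDpos : 0 < D := by linarith
  have hiso := hX.isoperimetric (E := E) measurableSet_ball x (ρ := 2 * D) (by linarith)
  have h0 : tv μ (chi E) (ball x (4 * lam * (2 * D))) = 0 :=
    le_antisymm ((tv_mono (subset_univ _)).trans htv.le) zero_le
  rw [h0, mul_zero, nonpos_iff_eq_zero, min_eq_iff] at hiso
  rcases hiso with ⟨h, _⟩ | ⟨h, _⟩
  · rw [hE, inter_eq_left.mpr (ball_subset_ball (by linarith))] at h
    exact hX.ball_ne_zero x (by linarith) h
  · refine hX.ball_ne_zero y hr (measure_mono_null (fun z hz => ?_) h)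
    have h1 := mem_ball.mp hz
    refine ⟨mem_ball.mpr ?_, fun h2 => ?_⟩
    · linarith [dist_triangle z y x]
    · have := mem_ball.mp h2
      linarith [dist_triangle y z x, dist_comm z y]

/-- Isoperimetric inequality for sets contained in a ball that does not exhaust the space. -/
lemma MMS.small_set (hX : MMS μ Cd CP lam) : ∃ C : ℝ≥0, ∀ (x y : X) (r : ℝ), 0 < r →
    4 * r ≤ dist y x → ∀ E : Set X, MeasurableSet E → E ⊆ ball x (2 * r) →
    μ E ≤ C * ENNReal.ofReal r * tv μ (chi E) univ := by
  obtain ⟨C, hC1, hC⟩ := hX.exists_doubling 6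
  have hCP := hX.hCP
  refine ⟨C * (10 * CP).toNNReal, fun x y r hr hy E hE hEx => ?_⟩
  obtain ⟨p, hp1, hp2⟩ := hX.annulus_nonempty hr hy
  have hiso := hX.isoperimetric hE x (ρ := 5 * r) (by linarith)
  have h1 : E ∩ ball x (5 * r) = E :=
    inter_eq_left.mpr (hEx.trans (ball_subset_ball (by linarith)))
  have h2 : μ E ≤ C * μ (ball x (5 * r) \ E) := by
    calc μ E ≤ μ (ball p (6 * r)) :=
          measure_mono (hEx.trans (ball_subset_ball' (by rw [dist_comm]; linarith)))
      _ ≤ C * μ (ball p r) := hC p r hr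
      _ ≤ _ := by
          gcongr
          intro z hz
          have h3 := mem_ball.mp hz
          refine ⟨mem_ball.mpr (by linarith [dist_triangle z p x]), fun hzE => ?_⟩
          have h4 := mem_ball.mp (hEx hzE)
          linarith [dist_triangle p z x, dist_comm z p]
  have h3 : μ E ≤ C * min (μ (E ∩ ball x (5 * r))) (μ (ball x (5 * r) \ E)) := by
    rw [h1]
    rcases min_choice (μ E) (μ (ball x (5 * r) \ E)) with h | h <;> rw [h]
    · exact le_mul_of_one_le_left zero_le (by exact_mod_cast hC1)
    · exact h2
  refine h3.trans ?_
  calc _ ≤ C * (ENNReal.ofReal (2 * CP * (5 * r)) * tv μ (chi E) univ) := by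
        gcongr
        exact hiso.trans (mul_le_mul_right (tv_mono (subset_univ _)) _)
    _ = _ := by
        rw [show 2 * CP * (5 * r) = (10 * CP) * r by ring, ENNReal.ofReal_mul (by positivity)]
        push_cast
        rw [ENNReal.ofReal]
        ring

end Space

section Cutoff

variable {X : Type*} [MetricSpace X]

/-- Lipschitz cutoff equal to `1` on `ball z ρ` and vanishing outside `ball z (2 * ρ)`. -/
def cut (z : X) (ρ : ℝ) (y : X) : ℝ := max 0 (min 1 ((2 * ρ - dist y z) / ρ))

/-- Upper gradient of `cut`. -/
def cutGrad (z : X) (ρ : ℝ) : X → ℝ≥0∞ := indicator (ball z (3 * ρ)) fun _ => ENNReal.ofReal ρ⁻¹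

lemma cut_zero (z y : X) : cut z 0 y = 0 := by simp [cut]

lemma cut_nonneg (z : X) (ρ : ℝ) (y : X) : 0 ≤ cut z ρ y := le_max_left _ _

lemma cut_le_one (z : X) (ρ : ℝ) (y : X) : cut z ρ y ≤ 1 :=
  max_le zero_le_one (min_le_left _ _)

lemma cut_eq_one {z : X} {ρ : ℝ} {y : X} (hy : y ∈ ball z ρ) : cut z ρ y = 1 := by
  have h1 := mem_ball.mp hy
  have h2 : 0 < ρ := dist_nonneg.trans_lt h1
  rw [cut, min_eq_left ((one_le_div h2).mpr (by linarith)), max_eq_right zero_le_one]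

lemma cut_eq_zero {z : X} {ρ : ℝ} {y : X} (hρ : 0 ≤ ρ) (hy : 2 * ρ ≤ dist y z) :
    cut z ρ y = 0 := by
  refine max_eq_left ((min_le_right _ _).trans ?_)
  exact div_nonpos_of_nonpos_of_nonneg (by linarith) hρ

lemma abs_clamp_sub_le (s t : ℝ) : |max 0 (min 1 s) - max 0 (min 1 t)| ≤ |s - t| := by
  refine (abs_max_sub_max_le_max _ _ _ _).trans ?_
  rw [sub_self, abs_zero, max_eq_right (abs_nonneg _)]
  refine (abs_min_sub_min_le_max _ _ _ _).trans ?_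
  rw [sub_self, abs_zero, max_eq_right (abs_nonneg _)]

lemma cut_lip (z : X) {ρ : ℝ} (hρ : 0 ≤ ρ) (y y' : X) :
    |cut z ρ y - cut z ρ y'| ≤ ρ⁻¹ * dist y y' := by
  refine (abs_clamp_sub_le _ _).trans ?_
  rw [← sub_div, abs_div, abs_of_nonneg hρ, div_eq_inv_mul]
  gcongr
  rw [show 2 * ρ - dist y z - (2 * ρ - dist y' z) = -(dist y z - dist y' z) by ring, abs_neg]
  exact abs_dist_sub_le y y' z

lemma cut_ug (z : X) {ρ : ℝ} (hρ : 0 ≤ ρ) : IsUpperGradientOn (cutGrad z ρ) (cut z ρ) univ := by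
  rcases hρ.eq_or_lt with rfl | hρ'
  · exact ((ug_const 0 univ).congr fun y _ => (cut_zero z y).symm).mono le_rfl fun _ _ => zero_le
  have hop : IsOpen {y | 2 * ρ < dist y z} :=
    isOpen_lt continuous_const (continuous_id.dist continuous_const)
  refine ug_of_cover (fun b : Bool => cond b (ball z (3 * ρ)) {y | 2 * ρ < dist y z}) ?_ ?_ ?_
  · intro b; cases b
    · exact hop
    · exact isOpen_ball
  · intro y _
    rw [mem_iUnion]
    rcases lt_or_ge (2 * ρ) (dist y z) with h | h
    · exact ⟨false, h⟩
    · exact ⟨true, mem_ball.mpr (by linarith)⟩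
  · intro b
    rw [inter_univ]
    cases b
    · refine ((ug_const 0 _).congr fun y hy => ?_).mono le_rfl fun _ _ => zero_le
      have h1 : 2 * ρ < dist y z := hy
      exact (cut_eq_zero hρ h1.le).symm
    · refine (ug_lipschitz (inv_nonneg.mpr hρ) _ fun y _ y' _ => cut_lip z hρ y y').mono le_rfl ?_
      intro y hy
      have h1 : y ∈ ball z (3 * ρ) := hy
      rw [cutGrad, indicator_of_mem h1]

lemma abs_iSup_sub_le {ι : Type*} {f g : ι → ℝ} (hf : ∀ i, 0 ≤ f i ∧ f i ≤ 1)
    (hg : ∀ i, 0 ≤ g i ∧ g i ≤ 1) {t : ℝ} (ht : 0 ≤ t) (h : ∀ i, |f i - g i| ≤ t) :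
    |(⨆ i, f i) - ⨆ i, g i| ≤ t := by
  have bf : BddAbove (range f) := ⟨1, by rintro _ ⟨i, rfl⟩; exact (hf i).2⟩
  have bg : BddAbove (range g) := ⟨1, by rintro _ ⟨i, rfl⟩; exact (hg i).2⟩
  have nf : 0 ≤ ⨆ i, f i := Real.iSup_nonneg fun i => (hf i).1
  have ng : 0 ≤ ⨆ i, g i := Real.iSup_nonneg fun i => (hg i).1
  rw [abs_sub_le_iff]
  constructor
  · have : ⨆ i, f i ≤ (⨆ i, g i) + t := Real.iSup_le (fun i => by
      have h1 := le_ciSup bg i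
      have h2 := (abs_le.mp (h i)).2
      linarith) (by positivity)
    linarith
  · have : ⨆ i, g i ≤ (⨆ i, f i) + t := Real.iSup_le (fun i => by
      have h1 := le_ciSup bf i
      have h2 := (abs_le.mp (h i)).1
      linarith) (by positivity)
    linarith

lemma ug_iSup {ι : Type*} {u : ι → X → ℝ} {g : ι → X → ℝ≥0∞} {G : X → ℝ≥0∞} {Ω : Set X}
    (hu : ∀ i y, 0 ≤ u i y ∧ u i y ≤ 1) (hg : ∀ i, IsUpperGradientOn (g i) (u i) Ω)
    (hG : ∀ i y, g i y ≤ G y) : IsUpperGradientOn G (fun y => ⨆ i, u i y) Ω := by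
  intro γ hγ
  by_cases ht : curveIntegral G γ = ⊤
  · rw [ht]; exact le_top
  rw [ENNReal.ofReal_le_iff_le_toReal ht]
  refine abs_iSup_sub_le (fun i => hu i _) (fun i => hu i _) ENNReal.toReal_nonneg fun i => ?_
  rw [← ENNReal.ofReal_le_iff_le_toReal ht]
  exact (hg i γ hγ).trans (curveIntegral_mono (hG i) γ)

/-- Supremum of a sequence of cutoffs. -/
def supCut (z : ℕ → X) (ρ : ℕ → ℝ) (y : X) : ℝ := ⨆ i, cut (z i) (ρ i) y

lemma supCut_nonneg (z : ℕ → X) (ρ : ℕ → ℝ) (y : X) : 0 ≤ supCut z ρ y :=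
  Real.iSup_nonneg fun _ => cut_nonneg _ _ _

lemma supCut_le_one (z : ℕ → X) (ρ : ℕ → ℝ) (y : X) : supCut z ρ y ≤ 1 :=
  Real.iSup_le (fun _ => cut_le_one _ _ _) zero_le_one

lemma cut_le_supCut (z : ℕ → X) (ρ : ℕ → ℝ) (y : X) (i : ℕ) : cut (z i) (ρ i) y ≤ supCut z ρ y :=
  le_ciSup (f := fun i => cut (z i) (ρ i) y)
    ⟨1, by rintro _ ⟨i, rfl⟩; exact cut_le_one _ _ _⟩ i

lemma supCut_eq_one {z : ℕ → X} {ρ : ℕ → ℝ} {y : X} (hy : y ∈ ⋃ i, ball (z i) (ρ i)) :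
    supCut z ρ y = 1 := by
  obtain ⟨i, hi⟩ := mem_iUnion.mp hy
  exact le_antisymm (supCut_le_one _ _ _) ((cut_eq_one hi).symm.le.trans (cut_le_supCut _ _ _ i))

lemma supCut_eq_zero {z : ℕ → X} {ρ : ℕ → ℝ} {y : X} (hρ : ∀ i, 0 ≤ ρ i)
    (hy : y ∉ ⋃ i, ball (z i) (2 * ρ i)) : supCut z ρ y = 0 := by
  refine le_antisymm (Real.iSup_le (fun i => ?_) le_rfl) (supCut_nonneg _ _ _)
  refine (cut_eq_zero (hρ i) ?_).le
  by_contra h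
  exact hy (mem_iUnion.mpr ⟨i, mem_ball.mpr (not_le.mp h)⟩)

lemma supCut_ug (z : ℕ → X) {ρ : ℕ → ℝ} (hρ : ∀ i, 0 ≤ ρ i) :
    IsUpperGradientOn (fun y => ∑' i, cutGrad (z i) (ρ i) y) (supCut z ρ) univ :=
  ug_iSup (fun _ _ => ⟨cut_nonneg _ _ _, cut_le_one _ _ _⟩) (fun i => cut_ug (z i) (hρ i))
    fun i y => ENNReal.le_tsum (f := fun i => cutGrad (z i) (ρ i) y) i

/-- Keep the first `n` radii and replace the others by `0`. -/
def trunc (ρ : ℕ → ℝ) (n i : ℕ) : ℝ := if i < n then ρ i else 0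

lemma trunc_nonneg {ρ : ℕ → ℝ} (hρ : ∀ i, 0 ≤ ρ i) (n i : ℕ) : 0 ≤ trunc ρ n i := by
  unfold trunc; split_ifs
  · exact hρ i
  · exact le_rfl

lemma supCut_trunc_lip (z : ℕ → X) {ρ : ℕ → ℝ} (hρ : ∀ i, 0 ≤ ρ i) (n : ℕ) :
    ∃ L : ℝ≥0, LipschitzWith L (supCut z (trunc ρ n)) := by
  have hnn : 0 ≤ ∑ i ∈ Finset.range n, (ρ i)⁻¹ :=
    Finset.sum_nonneg fun i _ => inv_nonneg.mpr (hρ i)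
  refine ⟨(∑ i ∈ Finset.range n, (ρ i)⁻¹).toNNReal, LipschitzWith.of_dist_le_mul fun y y' => ?_⟩
  rw [Real.dist_eq, Real.coe_toNNReal _ hnn]
  refine abs_iSup_sub_le (fun i => ⟨cut_nonneg _ _ _, cut_le_one _ _ _⟩)
    (fun i => ⟨cut_nonneg _ _ _, cut_le_one _ _ _⟩) (by positivity) fun i => ?_
  refine (cut_lip _ (trunc_nonneg hρ n i) y y').trans ?_
  gcongr
  unfold trunc; split_ifs with h
  · exact Finset.single_le_sum (f := fun i => (ρ i)⁻¹) (fun i _ => inv_nonneg.mpr (hρ i))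
      (Finset.mem_range.mpr h)
  · rw [inv_zero]; exact hnn

lemma tendsto_supCut_trunc (z : ℕ → X) (ρ : ℕ → ℝ) (y : X) :
    Tendsto (fun n => supCut z (trunc ρ n) y) atTop (𝓝 (supCut z ρ y)) := by
  have hle : ∀ n, supCut z (trunc ρ n) y ≤ supCut z ρ y := by
    intro n
    refine Real.iSup_le (fun i => ?_) (supCut_nonneg _ _ _)
    unfold trunc; split_ifs
    · exact cut_le_supCut _ _ _ i
    · rw [cut_zero]; exact supCut_nonneg _ _ _
  refine tendsto_order.mpr ⟨fun a ha => ?_, fun a ha => ?_⟩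
  · obtain ⟨i, hi⟩ := exists_lt_of_lt_ciSup ha
    filter_upwards [eventually_gt_atTop i] with n hn
    refine hi.trans_le ?_
    have := cut_le_supCut z (trunc ρ n) y i
    rwa [trunc, if_pos hn] at this
  · exact Eventually.of_forall fun n => (hle n).trans_lt ha

end Cutoff

section Content

variable {X : Type*} [MetricSpace X] [MeasurableSpace X] [BorelSpace X]
  {μ : Measure X} {Cd CP lam : ℝ}

lemma measurable_cutGrad (z : X) (ρ : ℝ) : Measurable (cutGrad z ρ) :=
  measurable_const.indicator measurableSet_ball

lemma measurable_supCut (z : ℕ → X) (ρ : ℕ → ℝ) :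
    Measurable (supCut z ρ) := by
  refine Measurable.iSup fun i => Continuous.measurable ?_
  unfold cut
  fun_prop

/-- Codimension-one cost of a ball. -/
def cost (μ : Measure X) (z : X) (ρ : ℝ) : ℝ≥0∞ := μ (ball z ρ) / ENNReal.ofReal ρ

lemma cost_zero (z : X) : cost μ z 0 = 0 := by simp [cost]

lemma MMS.cost_mul_le (hX : MMS μ Cd CP lam) (N : ℝ) (hN : 1 ≤ N) : ∃ C : ℝ≥0, 1 ≤ C ∧
    ∀ z ρ, 0 ≤ ρ → μ (ball z (N * ρ)) / ENNReal.ofReal ρ ≤ C * cost μ z ρ ∧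
      cost μ z (N * ρ) ≤ C * cost μ z ρ := by
  obtain ⟨C, hC1, hC⟩ := hX.exists_doubling N
  have key : ∀ z ρ, 0 ≤ ρ → μ (ball z (N * ρ)) / ENNReal.ofReal ρ ≤ C * cost μ z ρ := by
    intro z ρ hρ
    rcases hρ.eq_or_lt with rfl | hρ'
    · simp
    · rw [cost, ← mul_div_assoc]
      gcongr
      exact hC z ρ hρ'
  refine ⟨C, hC1, fun z ρ hρ => ⟨key z ρ hρ, le_trans ?_ (key z ρ hρ)⟩⟩
  unfold cost
  gcongr
  nlinarith

lemma MMS.supCut_cost (hX : MMS μ Cd CP lam) : ∃ C : ℝ≥0, 1 ≤ C ∧ ∀ (z : ℕ → X) (ρ : ℕ → ℝ),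
    (∀ i, 0 ≤ ρ i) → ∫⁻ y, ∑' i, cutGrad (z i) (ρ i) y ∂μ ≤ C * ∑' i, cost μ (z i) (ρ i) := by
  obtain ⟨C, hC1, hC⟩ := hX.cost_mul_le 3 (by norm_num)
  refine ⟨C, hC1, fun z ρ hρ => ?_⟩
  rw [lintegral_tsum fun i => (measurable_cutGrad _ _).aemeasurable, ← ENNReal.tsum_mul_left]
  refine ENNReal.tsum_le_tsum fun i => ?_
  refine le_trans ?_ (hC (z i) (ρ i) (hρ i)).1
  unfold cutGrad
  rw [lintegral_indicator_const measurableSet_ball]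
  rcases (hρ i).eq_or_lt with h | h
  · rw [← h]; simp
  · rw [ENNReal.ofReal_inv_of_pos h, mul_comm, div_eq_mul_inv]

lemma MMS.supCut_appr [ProperSpace X] (hX : MMS μ Cd CP lam) : ∃ C : ℝ≥0, 1 ≤ C ∧
    ∀ (z : ℕ → X) (ρ : ℕ → ℝ), (∀ i, 0 ≤ ρ i) →
      Appr μ (supCut z ρ) univ (C * ∑' i, cost μ (z i) (ρ i)) := by
  obtain ⟨C, hC1, hC⟩ := hX.supCut_cost
  have hLF := hX.isLocallyFinite
  refine ⟨C, hC1, fun z ρ hρ => ⟨fun n => supCut z (trunc ρ n),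
    fun n y => ∑' i, cutGrad (z i) (trunc ρ n i) y, fun n => ?_, fun K hK _ => ?_, fun n => ?_,
    fun n => supCut_ug z (trunc_nonneg hρ n), fun n => ?_⟩⟩
  · obtain ⟨L, hL⟩ := supCut_trunc_lip z hρ n
    exact locLip_of_lipschitz hL _
  · have h0 : ∫⁻ y in K, ENNReal.ofReal |supCut z ρ y - supCut z ρ y| ∂μ = 0 := by simp
    rw [← h0]
    refine tendsto_lintegral_of_dominated_convergence (fun _ => 1) (fun n => ?_) (fun n => ?_) ?_ ?_
    · exact (((measurable_supCut z (trunc ρ n)).sub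
        (measurable_supCut z ρ)).abs).ennreal_ofReal
    · refine Eventually.of_forall fun y => ?_
      rw [← ENNReal.ofReal_one]
      refine ENNReal.ofReal_le_ofReal (abs_le.mpr ⟨?_, ?_⟩) <;>
        linarith [supCut_nonneg z ρ y, supCut_le_one z ρ y, supCut_nonneg z (trunc ρ n) y,
          supCut_le_one z (trunc ρ n) y]
    · rw [setLIntegral_const, one_mul]
      exact hK.measure_lt_top.ne
    · refine Eventually.of_forall fun y => ?_
      exact (ENNReal.continuous_ofReal.tendsto _).comp
        (((tendsto_supCut_trunc z ρ y).sub tendsto_const_nhds).abs)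
  · exact Measurable.tsum fun i => measurable_cutGrad _ _
  · rw [setLIntegral_univ]
    refine (hC z _ (trunc_nonneg hρ n)).trans ?_
    gcongr with i
    unfold trunc; split_ifs
    · exact le_rfl
    · rw [cost_zero]; exact zero_le

/-- `D` is covered by countably many balls of radius at most `τ` and total cost at most `a`. -/
def Cov (μ : Measure X) (τ : ℝ) (D : Set X) (a : ℝ≥0∞) : Prop :=
  ∃ (z : ℕ → X) (ρ : ℕ → ℝ), (∀ i, 0 ≤ ρ i ∧ ρ i ≤ τ) ∧ D ⊆ ⋃ i, ball (z i) (ρ i) ∧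
    ∑' i, cost μ (z i) (ρ i) ≤ a

lemma Cov.mono {τ τ' : ℝ} {D D' : Set X} {a a' : ℝ≥0∞} (h : Cov μ τ D a) (hτ : τ ≤ τ')
    (hD : D' ⊆ D) (ha : a ≤ a') : Cov μ τ' D' a' := by
  obtain ⟨z, ρ, h1, h2, h3⟩ := h
  exact ⟨z, ρ, fun i => ⟨(h1 i).1, (h1 i).2.trans hτ⟩, hD.trans h2, h3.trans ha⟩

lemma cov_of_countable [Nonempty X] {ι : Type*} [Countable ι] (z : ι → X) (ρ : ι → ℝ) {τ : ℝ}
    {D : Set X} {a : ℝ≥0∞} (hτ : 0 ≤ τ) (h1 : ∀ i, 0 ≤ ρ i ∧ ρ i ≤ τ)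
    (h2 : D ⊆ ⋃ i, ball (z i) (ρ i)) (h3 : ∑' i, cost μ (z i) (ρ i) ≤ a) : Cov μ τ D a := by
  obtain ⟨e, he⟩ := exists_injective_nat ι
  refine ⟨Function.extend e z fun _ => Classical.arbitrary X, Function.extend e ρ 0, fun n => ?_,
    fun y hy => ?_, ?_⟩
  · by_cases hn : ∃ i, e i = n
    · obtain ⟨i, rfl⟩ := hn
      rw [he.extend_apply]; exact h1 i
    · rw [Function.extend_apply' _ _ _ hn]; exact ⟨le_rfl, hτ⟩
  · obtain ⟨i, hi⟩ := mem_iUnion.mp (h2 hy)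
    refine mem_iUnion.mpr ⟨e i, ?_⟩
    rwa [he.extend_apply, he.extend_apply]
  · refine le_trans (le_of_eq ?_) h3
    rw [← tsum_extend_zero he]
    refine tsum_congr fun n => ?_
    by_cases hn : ∃ i, e i = n
    · obtain ⟨i, rfl⟩ := hn
      simp only [he.extend_apply]
    · simp only [Function.extend_apply' _ _ _ hn, Pi.zero_apply, cost_zero]

lemma Cov.iUnion [Nonempty X] {ι : Type*} [Countable ι] {τ : ℝ} (hτ : 0 ≤ τ) {D : ι → Set X}
    {a : ι → ℝ≥0∞} (h : ∀ i, Cov μ τ (D i) (a i)) : Cov μ τ (⋃ i, D i) (∑' i, a i) := by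
  choose z ρ h1 h2 h3 using h
  refine cov_of_countable (ι := ι × ℕ) (fun p => z p.1 p.2) (fun p => ρ p.1 p.2) hτ
    (fun p => h1 p.1 p.2) ?_ ?_
  · refine iUnion_subset fun i y hy => ?_
    obtain ⟨n, hn⟩ := mem_iUnion.mp (h2 i hy)
    exact mem_iUnion.mpr ⟨(i, n), hn⟩
  · rw [ENNReal.tsum_prod']
    exact ENNReal.tsum_le_tsum h3

lemma Cov.union [Nonempty X] {τ : ℝ} (hτ : 0 ≤ τ) {D D' : Set X} {a a' : ℝ≥0∞}
    (h : Cov μ τ D a) (h' : Cov μ τ D' a') : Cov μ τ (D ∪ D') (a + a') := by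
  have := Cov.iUnion (ι := Bool) hτ (D := fun b => cond b D D') (a := fun b => cond b a a')
    (fun b => by cases b; exacts [h', h])
  rw [tsum_bool] at this
  refine this.mono le_rfl ?_ (by simp [add_comm])
  rintro y (hy | hy)
  · exact mem_iUnion.mpr ⟨true, hy⟩
  · exact mem_iUnion.mpr ⟨false, hy⟩

/-- A set of cost zero at every threshold is negligible for the content. -/
lemma Cov.iUnion_zero [Nonempty X] {τ : ℝ} (hτ : 0 ≤ τ) {D : ℕ → Set X}
    (h : ∀ i, ∀ ε : ℝ≥0∞, ε ≠ 0 → Cov μ τ (D i) ε) {ε : ℝ≥0∞} (hε : ε ≠ 0) :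
    Cov μ τ (⋃ i, D i) ε := by
  obtain ⟨δ, hδ, hs⟩ := ENNReal.exists_pos_sum_of_countable' hε ℕ
  exact (Cov.iUnion hτ fun i => h i (δ i) (hδ i).ne').mono le_rfl le_rfl hs.le

lemma Cov.measure_le {τ : ℝ} {D : Set X} {a : ℝ≥0∞} (h : Cov μ τ D a) :
    μ D ≤ ENNReal.ofReal τ * a := by
  obtain ⟨z, ρ, h1, h2, h3⟩ := h
  calc μ D ≤ ∑' i, μ (ball (z i) (ρ i)) := (measure_mono h2).trans (measure_iUnion_le _)
    _ ≤ ∑' i, ENNReal.ofReal τ * cost μ (z i) (ρ i) := by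
        refine ENNReal.tsum_le_tsum fun i => ?_
        rcases (h1 i).1.eq_or_lt with h0 | h0
        · rw [← h0]; simp
        · calc μ (ball (z i) (ρ i)) = ENNReal.ofReal (ρ i) * cost μ (z i) (ρ i) := by
                rw [cost, ENNReal.mul_div_cancel (by simpa using h0) ENNReal.ofReal_ne_top]
            _ ≤ _ := by
                gcongr
                exact (h1 i).2
    _ ≤ _ := by rw [ENNReal.tsum_mul_left]; gcongr

lemma MMS.cov_of_disjoint [ProperSpace X] (hX : MMS μ Cd CP lam) (N : ℝ) (hN : 1 ≤ N) :
    ∃ C : ℝ≥0, 1 ≤ C ∧ ∀ (D : Set X) (ρ : X → ℝ) (τ : ℝ) (a : ℝ≥0∞), 0 ≤ τ →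
      (∀ z ∈ D, 0 < ρ z ∧ ρ z ≤ τ) →
      (∀ T : Set X, T ⊆ D → T.Countable → T.PairwiseDisjoint (fun z => ball z (N * ρ z)) →
        ∑' z : T, cost μ (z : X) (ρ z) ≤ a) →
      Cov μ (6 * N * τ) D (C * a) := by
  obtain ⟨C, hC1, hC⟩ := hX.cost_mul_le (6 * N) (by linarith)
  have : Nonempty X := hX.nontrivial.to_nonempty
  refine ⟨C, hC1, fun D ρ τ a hτ hρ ha => ?_⟩
  obtain ⟨T, hTD, hTd, hTc⟩ := Vitali.exists_disjoint_subfamily_covering_enlargement_closedBall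
    D (fun z : X => z) (fun z => N * ρ z) (N * τ) (fun z hz => by
      have := hρ z hz
      gcongr; exact this.2) 5 (by norm_num)
  have hTd' : T.PairwiseDisjoint (fun z => ball z (N * ρ z)) :=
    hTd.mono fun z => ball_subset_closedBall
  have hcount : T.Countable := by
    refine hTd'.countable_of_isOpen (fun _ _ => isOpen_ball) fun z hz => ⟨z, mem_ball_self ?_⟩
    have := (hρ z (hTD hz)).1
    positivity
  have := hcount.to_subtype
  refine cov_of_countable (ι := T) (fun z => (z : X)) (fun z => 6 * N * ρ z) (by positivity)
    (fun z => ?_) (fun y hy => ?_) ?_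
  · have := hρ z (hTD z.2)
    refine ⟨by have := this.1; positivity, ?_⟩
    gcongr; exact this.2
  · obtain ⟨b, hb, hsub⟩ := hTc y hy
    refine mem_iUnion.mpr ⟨⟨b, hb⟩, ?_⟩
    have h1 := (hρ y hy).1
    have h2 := (hρ b (hTD hb)).1
    have h3 := mem_closedBall.mp (hsub (mem_closedBall_self (by positivity)))
    refine mem_ball.mpr (h3.trans_lt ?_)
    have : 0 < N * ρ b := by positivity
    simp only
    nlinarith
  · calc _ ≤ ∑' z : T, C * cost μ (z : X) (ρ z) :=
          ENNReal.tsum_le_tsum fun z => (hC _ _ (hρ z (hTD z.2)).1.le).2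
      _ ≤ _ := by
          rw [ENNReal.tsum_mul_left]
          gcongr
          exact ha T hTD hcount hTd'

open Classical in
lemma MMS.vcap1_le_of_cov (hX : MMS μ Cd CP lam) : ∃ C : ℝ≥0, 1 ≤ C ∧
    ∀ (D : Set X) (x : X) (r τ : ℝ) (a : ℝ≥0∞), a ≠ ⊤ → D ⊆ ball x r → τ ≤ r / 8 →
      Cov μ τ D a → vcap1 μ D (ball x (2 * r)) ≤ C * a := by
  have := hX.properSpace
  obtain ⟨C, hC1, hC⟩ := hX.supCut_cost
  refine ⟨C, hC1, fun D x r τ a hatop hD hτ hcov => ?_⟩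
  obtain ⟨z, ρ, h1, h2, h3⟩ := hcov
  set σ : ℕ → ℝ := fun i => if (ball (z i) (ρ i) ∩ D).Nonempty then ρ i else 0 with hσ
  have hσ0 : ∀ i, 0 ≤ σ i := fun i => by
    simp only [hσ]; split_ifs
    · exact (h1 i).1
    · exact le_rfl
  have hint : ∫⁻ y, ∑' i, cutGrad (z i) (σ i) y ∂μ ≤ C * a := by
    refine (hC z σ hσ0).trans ?_
    gcongr
    refine le_trans (ENNReal.tsum_le_tsum fun i => ?_) h3
    simp only [hσ]; split_ifs
    · exact le_rfl
    · rw [cost_zero]; exact zero_le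
  have hzero : ∀ y ∈ (ball x (2 * r))ᶜ, supCut z σ y = 0 := by
    intro y hy
    refine supCut_eq_zero hσ0 fun hy' => hy ?_
    obtain ⟨i, hi⟩ := mem_iUnion.mp hy'
    simp only [hσ] at hi
    split_ifs at hi with hne
    · obtain ⟨p, hp1, hp2⟩ := hne
      have e1 := mem_ball.mp hi
      have e2 := mem_ball'.mp hp1
      have e3 := mem_ball.mp (hD hp2)
      have e4 := (h1 i).2
      exact mem_ball.mpr (by linarith [dist_triangle4 y (z i) p x, dist_nonneg (x := p) (y := x)])
    · simp at hi
  have hm := measurable_supCut z σ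
  have hmg : Measurable fun y => ∑' i, cutGrad (z i) (σ i) y :=
    Measurable.tsum fun i => measurable_cutGrad _ _
  have hwug := (supCut_ug z hσ0).weak (μ := μ)
  have hN : MemN11 μ (supCut z σ) := by
    refine ⟨?_, _, hmg, hwug, hint.trans_lt (ENNReal.mul_lt_top ENNReal.coe_lt_top
      (lt_top_iff_ne_top.mpr hatop))⟩
    refine Integrable.mono' (g := indicator (ball x (2 * r)) fun _ => (1 : ℝ)) ?_
      hm.aestronglyMeasurable (Eventually.of_forall fun y => ?_)
    · exact (integrableOn_const (hX.ball_ne_top _ _)).integrable_indicator measurableSet_ball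
    · rw [Real.norm_of_nonneg (supCut_nonneg _ _ _)]
      by_cases hy : y ∈ ball x (2 * r)
      · rw [indicator_of_mem hy]; exact supCut_le_one _ _ _
      · rw [hzero y hy, indicator_of_notMem hy]
  refine le_trans ?_ hint
  refine iInf_le_of_le (supCut z σ) (iInf_le_of_le hN (iInf_le_of_le (fun y hy => ?_)
    (iInf_le_of_le hzero (iInf_le_of_le _ (iInf_le_of_le hmg (iInf_le_of_le hwug le_rfl))))))
  obtain ⟨i, hi⟩ := mem_iUnion.mp (h2 hy)
  refine (supCut_eq_one (mem_iUnion.mpr ⟨i, ?_⟩)).symm.le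
  simp only [hσ]
  rwa [if_pos ⟨y, hi, hy⟩]

end Content

section Boxing

variable {X : Type*} [MetricSpace X] [MeasurableSpace X] [BorelSpace X]
  {μ : Measure X} {Cd CP lam : ℝ}

lemma MMS.isUnifLocDoubling (hX : MMS μ Cd CP lam) : IsUnifLocDoublingMeasure μ := by
  obtain ⟨C, hC1, hC⟩ := hX.exists_doubling 4
  refine ⟨C, ?_⟩
  filter_upwards [self_mem_nhdsWithin] with ε hε z
  have hε' : 0 < ε := hε
  calc μ (closedBall z (2 * ε)) ≤ μ (ball z (4 * ε)) :=
        measure_mono (closedBall_subset_ball (by linarith))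
    _ ≤ C * μ (ball z ε) := hC z ε hε'
    _ ≤ _ := by gcongr; exact ball_subset_closedBall

/-- Lebesgue density in terms of open balls. -/
lemma MMS.ae_density [ProperSpace X] (hX : MMS μ Cd CP lam) {E : Set X} (hE : MeasurableSet E) :
    ∀ᵐ z ∂μ, z ∈ E → Tendsto (fun r => μ (ball z r \ E) / μ (ball z r)) (𝓝[>] (0 : ℝ)) (𝓝 0) := by
  have := hX.isUnifLocDoubling
  have := hX.isLocallyFinite
  obtain ⟨C, hC1, hC⟩ := hX.exists_doubling 2
  rw [← ae_restrict_iff' hE]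
  filter_upwards [IsUnifLocDoublingMeasure.ae_tendsto_measure_inter_div μ E 1] with z hz
  have h1 := hz (fun _ : ℝ => z) (fun r => r) (l := 𝓝[>] 0) tendsto_id (by
    filter_upwards [self_mem_nhdsWithin] with r hr
    have hr' : 0 < r := hr
    exact mem_closedBall_self (by linarith))
  have h2 := ENNReal.Tendsto.sub (tendsto_const_nhds (x := (1 : ℝ≥0∞)) (f := 𝓝[>] (0 : ℝ))) h1
    (Or.inl ENNReal.one_ne_top)
  rw [tsub_self] at h2
  have h3 := ENNReal.Tendsto.const_mul (a := (C : ℝ≥0∞)) h2 (Or.inr ENNReal.coe_ne_top)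
  rw [mul_zero] at h3
  refine tendsto_of_tendsto_of_tendsto_of_le_of_le' tendsto_const_nhds h3
    (Eventually.of_forall fun _ => zero_le) ?_
  filter_upwards [self_mem_nhdsWithin] with r hr
  have hr' : 0 < r := hr
  have hb0 := hX.ball_ne_zero z hr'
  have hbt := hX.ball_ne_top z r
  have hcb : μ (closedBall z r) ≤ C * μ (ball z r) :=
    (measure_mono (closedBall_subset_ball (by linarith))).trans (hC z r hr')
  have hcb0 : μ (closedBall z r) ≠ 0 := fun h =>
    hb0 (measure_mono_null ball_subset_closedBall h)
  have hcbt : μ (closedBall z r) ≠ ⊤ :=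
    (hcb.trans_lt (ENNReal.mul_lt_top ENNReal.coe_lt_top (hX.ball_lt_top z r))).ne
  have e1 : (1 : ℝ≥0∞) - μ (E ∩ closedBall z r) / μ (closedBall z r) =
      μ (closedBall z r \ E) / μ (closedBall z r) := by
    rw [← ENNReal.div_self hcb0 hcbt, ← ENNReal.sub_div (fun _ _ => hcb0)]
    congr 1
    refine (ENNReal.eq_sub_of_add_eq (ne_top_of_le_ne_top hcbt (measure_mono inter_subset_right))
      ?_).symm
    rw [add_comm, inter_comm]
    exact measure_inter_add_sdiff _ hE
  rw [e1]
  rw [ENNReal.div_le_iff hb0 hbt, mul_comm, ← mul_assoc, ← mul_div_assoc,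
    ENNReal.le_div_iff_mul_le (Or.inl hcb0) (Or.inl hcbt), mul_comm, mul_comm (μ (ball z r))]
  exact mul_le_mul' hcb (measure_mono (sdiff_subset_sdiff_left ball_subset_closedBall))

/-- Boxing inequality. -/
lemma MMS.boxing [ProperSpace X] (hX : MMS μ Cd CP lam) {γ : ℝ≥0} (hγ0 : 0 < γ) (hγ : γ ≤ 1 / 2) :
    ∃ C : ℝ≥0, 1 ≤ C ∧ ∀ (E : Set X) (y : X) (s δ : ℝ), MeasurableSet E → 0 < s → 0 < δ →
      4 * lam * δ ≤ 1 → (∀ z ∈ ball y s, μ (E ∩ ball z (δ * s)) ≤ γ * μ (ball z (δ * s))) →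
      Cov μ (24 * lam * (δ * s)) {z | z ∈ ball y s ∧ ∃ j : ℕ,
        γ * μ (ball z (δ * s / 2 ^ j)) < μ (E ∩ ball z (δ * s / 2 ^ j))}
        (C * tv μ (chi E) (ball y (2 * s))) := by
  classical
  have hlam := hX.hlam
  have hCP := hX.hCP
  obtain ⟨C2, hC21, hC2⟩ := hX.exists_doubling 2
  obtain ⟨C1, hC11, hC1⟩ := hX.cov_of_disjoint (4 * lam) (by linarith)
  set M : ℝ≥0 := γ⁻¹ * C2 * (2 * CP).toNNReal with hM
  refine ⟨C1 * (M + 1), one_le_mul hC11 (by simp), fun E y s δ hE hs hδ hδ1 hsmall => ?_⟩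
  set D := {z | z ∈ ball y s ∧ ∃ j : ℕ,
        γ * μ (ball z (δ * s / 2 ^ j)) < μ (E ∩ ball z (δ * s / 2 ^ j))} with hD
  have hchoose : ∀ z ∈ D, ∃ ρ, 0 < ρ ∧ ρ ≤ δ * s ∧
      μ (E ∩ ball z ρ) ≤ γ * μ (ball z ρ) ∧ γ * μ (ball z (ρ / 2)) < μ (E ∩ ball z (ρ / 2)) := by
    intro z hz
    have hz' : z ∈ ball y s ∧ ∃ j : ℕ,
        γ * μ (ball z (δ * s / 2 ^ j)) < μ (E ∩ ball z (δ * s / 2 ^ j)) := hz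
    obtain ⟨hzs, hj⟩ := hz'
    have hfind := Nat.find_spec hj
    rcases hn : Nat.find hj with _ | n
    · rw [hn, pow_zero, div_one] at hfind
      exact absurd (hsmall z hzs) (not_le.mpr hfind)
    · refine ⟨δ * s / 2 ^ n, by positivity, div_le_self (by positivity)
        (one_le_pow₀ one_le_two), ?_, ?_⟩
      · exact not_lt.mp (Nat.find_min hj (m := n) (by omega))
      · rw [hn, pow_succ, ← div_div] at hfind
        exact hfind
  choose! ρ hρ0 hρ1 hρ2 hρ3 using hchoose
  have hcost : ∀ z ∈ D, cost μ z (ρ z) ≤ M * tv μ (chi E) (ball z (4 * lam * ρ z)) := by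
    intro z hz
    have hr := hρ0 z hz
    have hiso := hX.isoperimetric hE z hr
    have hEt : μ (E ∩ ball z (ρ z)) ≠ ⊤ :=
      ((measure_mono inter_subset_right).trans_lt (hX.ball_lt_top z _)).ne
    have hhalf : μ (E ∩ ball z (ρ z)) ≤ μ (ball z (ρ z) \ E) := by
      have h1 : μ (E ∩ ball z (ρ z)) + μ (E ∩ ball z (ρ z)) ≤ μ (ball z (ρ z)) := by
        rw [← two_mul]
        calc _ ≤ 2 * (γ * μ (ball z (ρ z))) := by gcongr; exact hρ2 z hz
          _ = ((2 * γ : ℝ≥0) : ℝ≥0∞) * μ (ball z (ρ z)) := by push_cast; ring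
          _ ≤ 1 * μ (ball z (ρ z)) := by
              gcongr
              have : 2 * γ ≤ 1 := by
                calc 2 * γ ≤ 2 * (1 / 2) := by gcongr
                  _ = 1 := by norm_num
              exact_mod_cast this
          _ = _ := one_mul _
      have h2 : μ (ball z (ρ z)) ≤ μ (E ∩ ball z (ρ z)) + μ (ball z (ρ z) \ E) := by
        rw [inter_comm]; exact measure_le_inter_add_sdiff _ _ _
      exact (ENNReal.add_le_add_iff_left hEt).mp (h1.trans h2)
    rw [min_eq_left hhalf] at hiso
    have hlow : (γ : ℝ≥0∞) * μ (ball z (ρ z)) ≤ C2 * μ (E ∩ ball z (ρ z)) := by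
      have h1 := hC2 z (ρ z / 2) (by linarith)
      rw [mul_div_cancel₀ _ two_ne_zero] at h1
      calc (γ : ℝ≥0∞) * μ (ball z (ρ z)) ≤ γ * (C2 * μ (ball z (ρ z / 2))) := by gcongr
        _ = C2 * (γ * μ (ball z (ρ z / 2))) := by ring
        _ ≤ C2 * μ (E ∩ ball z (ρ z / 2)) := by gcongr; exact (hρ3 z hz).le
        _ ≤ _ := by gcongr; linarith
    have hγ' : (γ : ℝ≥0∞) ≠ 0 := by exact_mod_cast hγ0.ne'
    unfold cost
    refine ENNReal.div_le_of_le_mul ?_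
    calc μ (ball z (ρ z)) = (γ : ℝ≥0∞)⁻¹ * (γ * μ (ball z (ρ z))) := by
          rw [← mul_assoc, ENNReal.inv_mul_cancel hγ' ENNReal.coe_ne_top, one_mul]
      _ ≤ (γ : ℝ≥0∞)⁻¹ * (C2 * (ENNReal.ofReal (2 * CP * ρ z) *
            tv μ (chi E) (ball z (4 * lam * ρ z)))) := by
          exact mul_le_mul_right (hlow.trans (mul_le_mul_right hiso _)) _
      _ = _ := by
          rw [ENNReal.ofReal_mul (by positivity), hM, ENNReal.coe_mul, ENNReal.coe_mul,
            ENNReal.coe_inv hγ0.ne', ENNReal.ofReal]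
          ring
  have hcov := hC1 D ρ (δ * s) (M * tv μ (chi E) (ball y (2 * s))) (by positivity)
    (fun z hz => ⟨hρ0 z hz, hρ1 z hz⟩) fun T hT hTc hTd => ?_
  · refine hcov.mono (by linarith) le_rfl ?_
    rw [← mul_assoc]
    gcongr
    push_cast
    gcongr
    exact le_self_add
  · have := hTc.to_subtype
    calc _ ≤ ∑' z : T, M * tv μ (chi E) (ball (z : X) (4 * lam * ρ z)) :=
          ENNReal.tsum_le_tsum fun z => hcost z (hT z.2)
      _ ≤ _ := by
          rw [ENNReal.tsum_mul_left]
          gcongr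
          refine tsum_tv_le (fun z : T => ball (z : X) (4 * lam * ρ z)) (fun _ => isOpen_ball) ?_ ?_
          · intro a b hab
            exact hTd a.2 b.2 (fun h => hab (Subtype.ext h))
          · intro z
            refine ball_subset_ball' ?_
            have hzD : (z : X) ∈ ball y s := (hT z.2).1
            have h1 := mem_ball.mp hzD
            have h2 := hρ1 z (hT z.2)
            have h3 : 4 * lam * ρ z ≤ 4 * lam * (δ * s) := by gcongr
            nlinarith

/-- Sets of small density gain a factor `δ` in the relative isoperimetric inequality. -/
lemma MMS.measure_gain [ProperSpace X] (hX : MMS μ Cd CP lam) :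
    ∃ C : ℝ≥0, 1 ≤ C ∧ ∀ (E : Set X) (y : X) (s δ : ℝ), MeasurableSet E → 0 < s → 0 < δ →
      4 * lam * δ ≤ 1 →
      (∀ z ∈ ball y s, μ (E ∩ ball z (δ * s)) ≤ (1 / 2 : ℝ≥0) * μ (ball z (δ * s))) →
      μ (E ∩ ball y s) ≤ C * ENNReal.ofReal (δ * s) * tv μ (chi E) (ball y (2 * s)) := by
  have hlam := hX.hlam
  obtain ⟨C, hC1, hC⟩ := hX.boxing (γ := 1 / 2) (by norm_num) le_rfl
  refine ⟨(24 * lam).toNNReal * C, one_le_mul ?_ hC1, fun E y s δ hE hs hδ hδ1 hsmall => ?_⟩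
  · rw [← Real.toNNReal_one]; exact Real.toNNReal_le_toNNReal (by linarith)
  have hcov := hC E y s δ hE hs hδ hδ1 hsmall
  have h1 : μ (E ∩ ball y s) ≤ μ {z | z ∈ ball y s ∧ ∃ j : ℕ,
        (1 / 2 : ℝ≥0) * μ (ball z (δ * s / 2 ^ j)) < μ (E ∩ ball z (δ * s / 2 ^ j))} := by
    refine measure_mono_ae ?_
    filter_upwards [hX.ae_density hE] with z hz hzE
    obtain ⟨hzE, hzy⟩ := hzE
    refine ⟨hzy, ?_⟩
    have hseq : Tendsto (fun j : ℕ => δ * s / 2 ^ j) atTop (𝓝[>] 0) := by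
      refine tendsto_nhdsWithin_iff.mpr ⟨?_, Eventually.of_forall fun j => ?_⟩
      · have := (tendsto_pow_atTop_nhds_zero_of_lt_one (r := (1 / 2 : ℝ)) (by norm_num)
          (by norm_num)).const_mul (δ * s)
        rw [mul_zero] at this
        refine this.congr fun j => ?_
        rw [one_div, inv_pow, div_eq_mul_inv]
      · exact mem_Ioi.mpr (by positivity)
    have h2 := (hz hzE).comp hseq
    obtain ⟨j, hj⟩ := ((tendsto_order.mp h2).2 ((1 / 2 : ℝ≥0) : ℝ≥0∞)
      (by exact_mod_cast (by norm_num : (0 : ℝ≥0) < 1 / 2))).exists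
    refine ⟨j, ?_⟩
    have hr : 0 < δ * s / 2 ^ j := by positivity
    simp only [Function.comp] at hj
    rw [ENNReal.div_lt_iff (Or.inl (hX.ball_ne_zero z hr)) (Or.inl (hX.ball_ne_top z _))] at hj
    by_contra hcon
    push Not at hcon
    have h3 : μ (ball z (δ * s / 2 ^ j)) ≤
        μ (E ∩ ball z (δ * s / 2 ^ j)) + μ (ball z (δ * s / 2 ^ j) \ E) := by
      rw [inter_comm]; exact measure_le_inter_add_sdiff _ _ _
    have h4 := ENNReal.add_lt_add_of_le_of_lt
      (ne_top_of_le_ne_top (hX.ball_ne_top z _) (measure_mono inter_subset_right)) hcon hj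
    rw [← add_mul, ← ENNReal.coe_add, show (1 / 2 + 1 / 2 : ℝ≥0) = 1 by norm_num,
      ENNReal.coe_one, one_mul] at h4
    exact absurd h3 (not_le.mpr h4)
  refine (h1.trans hcov.measure_le).trans (le_of_eq ?_)
  rw [ENNReal.ofReal_mul (by positivity), ENNReal.coe_mul, ENNReal.ofReal]
  ring

/-- Small density at one scale passes to nearby smaller balls. -/
lemma MMS.density_transfer (hX : MMS μ Cd CP lam) {δ : ℝ} (hδ : 0 < δ) : ∃ C : ℝ≥0, 1 ≤ C ∧
    ∀ (E : Set X) (y z : X) (s t : ℝ) (κ : ℝ≥0∞), 0 < s → 2 * s ≤ t → t ≤ 8 * s → δ ≤ 1 →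
      μ (E ∩ ball y t) ≤ κ * μ (ball y t) → z ∈ ball y s →
      μ (E ∩ ball z (δ * s)) ≤ C * κ * μ (ball z (δ * s)) := by
  obtain ⟨C, hC1, hC⟩ := hX.exists_doubling (9 / δ)
  refine ⟨C, hC1, fun E y z s t κ hs hst hts hδ1 hE hz => ?_⟩
  have hz' := mem_ball.mp hz
  calc μ (E ∩ ball z (δ * s)) ≤ μ (E ∩ ball y t) := by
        refine measure_mono (inter_subset_inter_right _ (ball_subset_ball' ?_))
        nlinarith
    _ ≤ κ * μ (ball y t) := hE
    _ ≤ κ * μ (ball z (9 / δ * (δ * s))) := by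
        gcongr
        refine ball_subset_ball' ?_
        rw [← mul_assoc, div_mul_cancel₀ _ hδ.ne', dist_comm]
        linarith
    _ ≤ κ * (C * μ (ball z (δ * s))) := by gcongr; exact hC z _ (by positivity)
    _ = _ := by ring

end Boxing

section Hilbert

lemma exists_cauchySeq_of_nested {H : Type*} [NormedAddCommGroup H] [InnerProductSpace ℝ H]
    (K : ℕ → Set H) (hK : Antitone K) (hne : ∀ n, (K n).Nonempty)
    (hmid : ∀ n, ∀ f ∈ K n, ∀ g ∈ K n, (2⁻¹ : ℝ) • (f + g) ∈ K n) {M : ℝ}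
    (hM : ∀ f ∈ K 0, ‖f‖ ≤ M) : ∃ w : ℕ → H, (∀ n, w n ∈ K n) ∧ CauchySeq w := by
  set I : ℕ → ℝ := fun n => sInf ((fun f : H => ‖f‖ ^ 2) '' K n) with hI
  have hbdd : ∀ n, BddBelow ((fun f : H => ‖f‖ ^ 2) '' K n) := fun n =>
    ⟨0, by rintro _ ⟨f, _, rfl⟩; positivity⟩
  have hIle : ∀ n, ∀ f ∈ K n, I n ≤ ‖f‖ ^ 2 := fun n f hf => csInf_le (hbdd n) ⟨f, hf, rfl⟩
  have hmono : Monotone I := fun m n hmn =>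
    csInf_le_csInf (hbdd m) ((hne n).image _) (image_mono (hK hmn))
  have hbd : ∀ n, I n ≤ M ^ 2 := fun n => by
    obtain ⟨f, hf⟩ := hne n
    refine (hIle n f hf).trans ?_
    have := hM f (hK (Nat.zero_le n) hf)
    gcongr
  have hB : BddAbove (range I) := ⟨M ^ 2, by rintro _ ⟨n, rfl⟩; exact hbd n⟩
  have hlim := tendsto_atTop_ciSup hmono hB
  have hex : ∀ n : ℕ, ∃ f ∈ K n, ‖f‖ ^ 2 < I n + 1 / ((n : ℝ) + 1) := by
    intro n
    obtain ⟨_, ⟨f, hf, rfl⟩, h⟩ := exists_lt_of_csInf_lt ((hne n).image (fun f : H => ‖f‖ ^ 2))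
      (show I n < I n + 1 / ((n : ℝ) + 1) from lt_add_of_pos_right _ (by positivity))
    exact ⟨f, hf, h⟩
  choose w hw1 hw2 using hex
  refine ⟨w, hw1, ?_⟩
  set b : ℕ → ℝ := fun n => 2 * ((⨆ i, I i) - I n) + 4 * (1 / ((n : ℝ) + 1)) with hb
  have hblim : Tendsto (fun n => Real.sqrt (b n)) atTop (𝓝 0) := by
    have h1 : Tendsto b atTop (𝓝 (2 * ((⨆ i, I i) - ⨆ i, I i) + 4 * 0)) :=
      ((tendsto_const_nhds.sub hlim).const_mul 2).add
        (tendsto_one_div_add_atTop_nhds_zero_nat.const_mul 4)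
    have h2 := (Real.continuous_sqrt.tendsto _).comp h1
    simpa [Function.comp_def] using h2
  refine cauchySeq_of_le_tendsto_0' _ (fun n m hnm => ?_) hblim
  rw [dist_eq_norm]
  refine Real.le_sqrt_of_sq_le ?_
  have hpar := parallelogram_law_with_norm ℝ (w n) (w m)
  have h1 := hIle n _ (hmid n _ (hw1 n) _ (hK hnm (hw1 m)))
  rw [norm_smul, mul_pow] at h1
  have h2 := hw2 n
  have h3 := hw2 m
  have h4 : I m ≤ ⨆ i, I i := le_ciSup hB m
  have h5 : 1 / ((m : ℝ) + 1) ≤ 1 / ((n : ℝ) + 1) := by gcongr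
  norm_num at h1
  simp only [hb]
  nlinarith

end Hilbert

section Minimizer

variable {X : Type*} [MetricSpace X] [MeasurableSpace X] [BorelSpace X] [ProperSpace X]
  {μ : Measure X}

lemma tendstoL1Loc_of_bounded [IsFiniteMeasureOnCompacts μ] {w : ℕ → X → ℝ} {u : X → ℝ}
    (hw : ∀ n, AEMeasurable (w n) μ) (hu : AEMeasurable u μ) (hb : ∀ n, ∀ᵐ y ∂μ, |w n y - u y| ≤ 1)
    (hlim : ∀ᵐ y ∂μ, Tendsto (fun n => w n y) atTop (𝓝 (u y))) (Ω : Set X) :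
    TendstoL1Loc μ w u Ω := by
  intro K hK _
  have h0 : ∫⁻ y in K, ENNReal.ofReal |u y - u y| ∂μ = 0 := by simp
  rw [← h0]
  refine tendsto_lintegral_of_dominated_convergence' (fun _ => 1) (fun n => ?_) (fun n => ?_) ?_ ?_
  · exact aem_diff (hw n).restrict hu.restrict
  · refine ae_restrict_of_ae ?_
    filter_upwards [hb n] with y hy
    rw [← ENNReal.ofReal_one]
    exact ENNReal.ofReal_le_ofReal hy
  · rw [setLIntegral_const, one_mul]
    exact hK.measure_lt_top.ne
  · refine ae_restrict_of_ae ?_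
    filter_upwards [hlim] with y hy
    exact (ENNReal.continuous_ofReal.tendsto _).comp ((hy.sub tendsto_const_nhds).abs)

lemma tv_const_mul_le {u : X → ℝ} (hu : AEMeasurable u μ) {p : ℝ} (hp : 0 ≤ p) :
    tv μ (fun y => p * u y) univ ≤ ENNReal.ofReal p * tv μ u univ := by
  by_cases htop : tv μ u univ = ⊤
  · rcases hp.eq_or_lt with rfl | hp'
    · refine le_trans (Appr.tv_le (a := 0) ?_) zero_le
      refine ⟨fun _ _ => 0, fun _ _ => 0, fun _ => locLip_const 0 _, ?_, fun _ => measurable_const,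
        fun _ => ug_const 0 _, fun _ => by simp⟩
      simpa using tendstoL1Loc_const (μ := μ) (fun _ : X => (0 : ℝ)) univ
    · rw [htop, ENNReal.mul_top (by simpa using hp')]; exact le_top
  · have h0 : tv μ (fun _ : X => (0 : ℝ)) univ < 1 := by
      refine lt_of_le_of_lt (Appr.tv_le (a := 0) ?_) one_pos
      exact ⟨fun _ _ => 0, fun _ _ => 0, fun _ => locLip_const 0 _, tendstoL1Loc_const _ _,
        fun _ => measurable_const, fun _ => ug_const 0 _, fun _ => by simp⟩
    have key : ∀ n : ℕ, tv μ (fun y => p * u y) univ ≤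
        ENNReal.ofReal p * (tv μ u univ + ((n : ℝ≥0∞) + 1)⁻¹) := by
      intro n
      have h1 : tv μ u univ < tv μ u univ + ((n : ℝ≥0∞) + 1)⁻¹ :=
        ENNReal.lt_add_right htop (ENNReal.inv_ne_zero.mpr (by finiteness))
      have := tv_lin isOpen_univ hu hp le_rfl h1 h0
      simpa using this
    have hlim : Tendsto (fun n : ℕ => ENNReal.ofReal p * (tv μ u univ + ((n : ℝ≥0∞) + 1)⁻¹)) atTop
        (𝓝 (ENNReal.ofReal p * (tv μ u univ + 0))) := by
      refine ENNReal.Tendsto.const_mul (Tendsto.const_add _ ?_) (Or.inr ENNReal.ofReal_ne_top)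
      have := (tendsto_add_atTop_iff_nat 1).mpr ENNReal.tendsto_inv_nat_nhds_zero
      simpa using this
    rw [add_zero] at hlim
    exact ge_of_tendsto' hlim key

lemma ug_cut_below {v : X → ℝ} {g : X → ℝ≥0∞} (hv : Continuous v)
    (hg : IsUpperGradientOn g v univ) {b c : ℝ} (hbc : b < c) :
    IsUpperGradientOn ({y | v y < c}.indicator g) (fun y => min (v y) b) univ := by
  have hmin : ∀ s t : ℝ, |min s b - min t b| ≤ |s - t| := fun s t => by
    refine (abs_min_sub_min_le_max _ _ _ _).trans ?_
    rw [sub_self, abs_zero, max_eq_left (abs_nonneg _)]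
  refine ug_of_cover (fun k : Bool => cond k {y | v y < c} {y | b < v y}) ?_ ?_ ?_
  · intro k; cases k
    · exact isOpen_lt continuous_const hv
    · exact isOpen_lt hv continuous_const
  · intro y _
    rw [mem_iUnion]
    rcases lt_or_ge (v y) c with h | h
    · exact ⟨true, h⟩
    · exact ⟨false, hbc.trans_le h⟩
  · intro k
    rw [inter_univ]
    cases k
    · refine ((ug_const b _).congr fun y hy => ?_).mono le_rfl fun _ _ => zero_le
      have h : b < v y := hy
      exact (min_eq_right h.le).symm
    · refine (hg.comp_le fun y y' => hmin _ _).mono (subset_univ _) fun y hy => ?_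
      have h : y ∈ {y | v y < c} := hy
      rw [indicator_of_mem h]

lemma ug_cut_above {v : X → ℝ} {g : X → ℝ≥0∞} (hv : Continuous v)
    (hg : IsUpperGradientOn g v univ) {b c : ℝ} (hcb : c < b) :
    IsUpperGradientOn ({y | v y < c}ᶜ.indicator g) (fun y => max (v y) b) univ := by
  have hmax : ∀ s t : ℝ, |max s b - max t b| ≤ |s - t| := fun s t => by
    refine (abs_max_sub_max_le_max _ _ _ _).trans ?_
    rw [sub_self, abs_zero, max_eq_left (abs_nonneg _)]
  refine ug_of_cover (fun k : Bool => cond k {y | c < v y} {y | v y < b}) ?_ ?_ ?_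
  · intro k; cases k
    · exact isOpen_lt hv continuous_const
    · exact isOpen_lt continuous_const hv
  · intro y _
    rw [mem_iUnion]
    rcases lt_or_ge c (v y) with h | h
    · exact ⟨true, h⟩
    · exact ⟨false, h.trans_lt hcb⟩
  · intro k
    rw [inter_univ]
    cases k
    · refine ((ug_const b _).congr fun y hy => ?_).mono le_rfl fun _ _ => zero_le
      have h : v y < b := hy
      exact (max_eq_right h.le).symm
    · refine (hg.comp_le fun y y' => hmax _ _).mono (subset_univ _) fun y hy => ?_
      have h : c < v y := hy
      have h' : y ∈ {y | v y < c}ᶜ := fun h'' => by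
        have h3 : v y < c := h''
        linarith
      rw [indicator_of_mem h']

lemma TendstoL1Loc.comp_contraction {v : ℕ → X → ℝ} {u : X → ℝ} (h : TendstoL1Loc μ v u univ)
    (hv : ∀ i, LocLipschitzOn (v i) univ) (hu : AEMeasurable u μ) {T : ℝ → ℝ}
    (hT : ∀ s t, |T s - T t| ≤ |s - t|) :
    TendstoL1Loc μ (fun i y => T (v i y)) (fun y => T (u y)) univ :=
  h.of_le h zero_le_one le_rfl (fun i => locLip_aemeasurable isOpen_univ (hv i)) hu.restrict
    fun i y _ => by
      have := hT (v i y) (u y)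
      linarith [abs_nonneg (v i y - u y)]

/-- Splitting the total variation between two levels. -/
lemma tv_split {u : X → ℝ} (hu : AEMeasurable u μ) {b b' : ℝ} (hb : b < b') :
    tv μ (fun y => min (u y) b) univ + tv μ (fun y => max (u y) b') univ ≤ tv μ u univ := by
  refine le_of_forall_gt_imp_ge_of_dense fun a ha => ?_
  obtain ⟨v, g, h1, h2, h3, h4, h5⟩ := appr_of_tv_lt ha
  obtain ⟨c, hbc, hcb⟩ := exists_between hb
  have hvc : ∀ i, Continuous (v i) := fun i => (h1 i).continuous
  have hSo : ∀ i, MeasurableSet {y | v i y < c} := fun i =>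
    (isOpen_lt (hvc i) continuous_const).measurableSet
  have hmin : ∀ s t : ℝ, |min s b - min t b| ≤ |s - t| := fun s t => by
    refine (abs_min_sub_min_le_max _ _ _ _).trans ?_
    rw [sub_self, abs_zero, max_eq_left (abs_nonneg _)]
  have hmax : ∀ s t : ℝ, |max s b' - max t b'| ≤ |s - t| := fun s t => by
    refine (abs_max_sub_max_le_max _ _ _ _).trans ?_
    rw [sub_self, abs_zero, max_eq_left (abs_nonneg _)]
  have l1 : ∀ i, LocLipschitzOn (fun y => min (v i y) b) univ := fun i =>
    (h1 i).comp_le fun y y' => hmin _ _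
  have l2 : ∀ i, LocLipschitzOn (fun y => max (v i y) b') univ := fun i =>
    (h1 i).comp_le fun y y' => hmax _ _
  have c1 : TendstoL1Loc μ (fun i y => min (v i y) b) (fun y => min (u y) b) univ :=
    h2.comp_contraction h1 hu (T := fun s => min s b) hmin
  have c2 : TendstoL1Loc μ (fun i y => max (v i y) b') (fun y => max (u y) b') univ :=
    h2.comp_contraction h1 hu (T := fun s => max s b') hmax
  have t1 := tv_le_liminf l1 c1 (fun i => (h3 i).indicator (hSo i))
    fun i => ug_cut_below (hvc i) (h4 i) hbc
  have t2 := tv_le_liminf l2 c2 (fun i => (h3 i).indicator (hSo i).compl)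
    fun i => ug_cut_above (hvc i) (h4 i) hcb
  refine (add_le_add t1 t2).trans ((ennreal_liminf_add_le _ _).trans ?_)
  refine (liminf_le_liminf (v := fun _ => a) (Eventually.of_forall fun i => ?_)).trans_eq
    (liminf_const a)
  refine le_trans (le_of_eq ?_) (h5 i)
  simp only [setLIntegral_univ]
  rw [lintegral_indicator (hSo i), lintegral_indicator (hSo i).compl]
  exact lintegral_add_compl _ (hSo i)

/-- Functions admissible for the capacitary problem of `G` relative to `Ω`. -/
def Adm (μ : Measure X) (G Ω : Set X) (w : X → ℝ) : Prop :=
  AEMeasurable w μ ∧ ∀ᵐ y ∂μ, 0 ≤ w y ∧ w y ≤ 1 ∧ (y ∈ G → w y = 1) ∧ (y ∉ Ω → w y = 0)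

lemma Adm.congr {G Ω : Set X} {w w' : X → ℝ} (h : Adm μ G Ω w) (hw : w =ᵐ[μ] w') :
    Adm μ G Ω w' := by
  refine ⟨h.1.congr hw, ?_⟩
  filter_upwards [h.2, hw] with y h1 h2
  rwa [← h2]

lemma Adm.memLp {G Ω : Set X} {w : X → ℝ} (h : Adm μ G Ω w) (hΩ : MeasurableSet Ω)
    (hΩt : μ Ω ≠ ⊤) : MemLp w 2 μ ∧ eLpNorm w 2 μ ≤ eLpNorm (Ω.indicator fun _ => (1 : ℝ)) 2 μ := by
  have h1 : MemLp (Ω.indicator fun _ => (1 : ℝ)) 2 μ := memLp_indicator_const 2 hΩ 1 (Or.inr hΩt)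
  have h2 : ∀ᵐ y ∂μ, ‖w y‖ ≤ ‖Ω.indicator (fun _ => (1 : ℝ)) y‖ := by
    filter_upwards [h.2] with y hy
    rw [Real.norm_of_nonneg hy.1]
    by_cases hyΩ : y ∈ Ω
    · rw [indicator_of_mem hyΩ, norm_one]; exact hy.2.1
    · rw [hy.2.2.2 hyΩ]; exact norm_nonneg _
  exact ⟨h1.mono h.1.aestronglyMeasurable h2, eLpNorm_mono_ae h2⟩

/-- Existence of an admissible function of least total variation. -/
lemma exists_adm_minimizer [IsFiniteMeasureOnCompacts μ] {G Ω : Set X} (hΩ : MeasurableSet Ω)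
    (hΩt : μ Ω ≠ ⊤) {w0 : X → ℝ} (hw0 : Adm μ G Ω w0) (hfin : tv μ w0 univ ≠ ⊤) :
    ∃ u, Adm μ G Ω u ∧ ∀ w, Adm μ G Ω w → tv μ u univ ≤ tv μ w univ := by
  set m : ℝ≥0∞ := ⨅ (w : X → ℝ) (_ : Adm μ G Ω w), tv μ w univ with hm
  have hmle : ∀ w, Adm μ G Ω w → m ≤ tv μ w univ := fun w hw => iInf₂_le w hw
  have hmt : m ≠ ⊤ := ne_top_of_le_ne_top hfin (hmle w0 hw0)
  set c : ℕ → ℝ≥0∞ := fun n => m + ((n : ℝ≥0∞) + 1)⁻¹ with hc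
  have hmc : ∀ n, m < c n := fun n =>
    ENNReal.lt_add_right hmt (ENNReal.inv_ne_zero.mpr (by finiteness))
  have hcanti : Antitone c := fun i j hij => by
    simp only [hc]
    gcongr
  have hclim : Tendsto c atTop (𝓝 m) := by
    have h1 : Tendsto (fun n : ℕ => ((n : ℝ≥0∞) + 1)⁻¹) atTop (𝓝 0) := by
      have := (tendsto_add_atTop_iff_nat 1).mpr ENNReal.tendsto_inv_nat_nhds_zero
      simpa using this
    simpa using h1.const_add m
  set K : ℕ → Set (Lp ℝ 2 μ) := fun n => {f | Adm μ G Ω f ∧ tv μ f univ < c n} with hK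
  obtain ⟨f, hfK, hfc⟩ := exists_cauchySeq_of_nested K
    (fun i j hij f hf => ⟨hf.1, hf.2.trans_le (hcanti hij)⟩) (fun n => by
      have h1 : ∃ w, Adm μ G Ω w ∧ tv μ w univ < c n := by
        have := hmc n
        rw [hm, iInf_lt_iff] at this
        obtain ⟨w, hw⟩ := this
        obtain ⟨hw1, hw2⟩ := iInf_lt_iff.mp hw
        exact ⟨w, hw1, hw2⟩
      obtain ⟨w, hw1, hw2⟩ := h1
      have hL := (hw1.memLp hΩ hΩt).1
      refine ⟨hL.toLp w, hw1.congr hL.coeFn_toLp.symm, ?_⟩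
      rwa [tv_congr_ae (w := w) (by filter_upwards [hL.coeFn_toLp] with y hy _ using hy)])
    (fun n f hf g hg => by
      have hco : ((2⁻¹ : ℝ) • (f + g) : Lp ℝ 2 μ) =ᵐ[μ] fun y => 2⁻¹ * f y + 2⁻¹ * g y := by
        filter_upwards [Lp.coeFn_smul (2⁻¹ : ℝ) (f + g), Lp.coeFn_add f g] with y h1 h2
        rw [h1, Pi.smul_apply, h2, Pi.add_apply, smul_eq_mul, mul_add]
      obtain ⟨⟨hf1, hf2⟩, hf3⟩ := hf
      obtain ⟨⟨hg1, hg2⟩, hg3⟩ := hg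
      refine ⟨Adm.congr (w := fun y => 2⁻¹ * f y + 2⁻¹ * g y) ⟨by fun_prop, ?_⟩ hco.symm, ?_⟩
      · filter_upwards [hf2, hg2] with y h1 h2
        refine ⟨by linarith [h1.1, h2.1], by linarith [h1.2.1, h2.2.1], fun hy => ?_, fun hy => ?_⟩
        · rw [h1.2.2.1 hy, h2.2.2.1 hy]; norm_num
        · rw [h1.2.2.2 hy, h2.2.2.2 hy]; norm_num
      · obtain ⟨a, ha1, ha2⟩ := exists_between (max_lt hf3 hg3)
        rw [tv_congr_ae (w := fun y => 2⁻¹ * f y + 2⁻¹ * g y)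
          (by filter_upwards [hco] with y hy _ using hy)]
        refine lt_of_le_of_lt (tv_lin isOpen_univ hf1 (by norm_num) (by norm_num)
          ((le_max_left _ _).trans_lt ha1) ((le_max_right _ _).trans_lt ha1)) ?_
        rw [← add_mul, ← ENNReal.ofReal_add (by norm_num) (by norm_num)]
        norm_num
        exact ha2)
    (M := (eLpNorm (Ω.indicator fun _ => (1 : ℝ)) 2 μ).toReal) (fun f hf => by
      rw [Lp.norm_def]
      exact ENNReal.toReal_mono (memLp_indicator_const 2 hΩ (1 : ℝ) (Or.inr hΩt)).2.ne
        (hf.1.memLp hΩ hΩt).2)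
  obtain ⟨u, hu⟩ := cauchySeq_tendsto_of_complete hfc
  have huL := (Lp.tendsto_Lp_iff_tendsto_eLpNorm' f u).mp hu
  have hmeas := tendstoInMeasure_of_tendsto_eLpNorm (by norm_num)
    (fun n => Lp.aestronglyMeasurable (f n)) (Lp.aestronglyMeasurable u) huL
  obtain ⟨ns, hns, hae⟩ := hmeas.exists_seq_tendsto_ae
  have huA : Adm μ G Ω u := by
    refine ⟨(Lp.aestronglyMeasurable u).aemeasurable, ?_⟩
    filter_upwards [hae, ae_all_iff.mpr fun n => (hfK n).1.2] with y h1 h2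
    refine ⟨ge_of_tendsto' h1 fun n => (h2 _).1, le_of_tendsto' h1 fun n => (h2 _).2.1,
      fun hy => ?_, fun hy => ?_⟩
    · refine tendsto_nhds_unique h1 ?_
      simp only [(h2 _).2.2.1 hy]
      exact tendsto_const_nhds
    · refine tendsto_nhds_unique h1 ?_
      simp only [(h2 _).2.2.2 hy]
      exact tendsto_const_nhds
  refine ⟨u, huA, fun w hw => le_trans ?_ (hmle w hw)⟩
  refine ge_of_tendsto' hclim fun n => ?_
  refine tv_le_of_tendsto (w := fun i => f (ns (i + n))) (fun i => (hfK _).1.1)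
    (tendstoL1Loc_of_bounded (fun i => (hfK _).1.1) huA.1 (fun i => ?_) ?_ univ) fun i => ?_
  · filter_upwards [huA.2, (hfK (ns (i + n))).1.2] with y h1 h2
    exact abs_le.mpr ⟨by linarith [h1.2.1, h2.1], by linarith [h1.1, h2.2.1]⟩
  · filter_upwards [hae] with y hy
    exact (tendsto_add_atTop_iff_nat (f := fun i => f (ns i) y) n).mpr hy
  · refine (hfK _).2.le.trans (hcanti ?_)
    have := hns.id_le (i + n)
    simp only [id] at this
    omega

/-- Existence of a least perimeter set among all admissible functions. -/
theorem exists_least_perimeter [IsFiniteMeasureOnCompacts μ] {G Ω : Set X} (hΩ : MeasurableSet Ω)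
    (hG : MeasurableSet G) (hGΩ : G ⊆ Ω) (hΩt : μ Ω ≠ ⊤) {w0 : X → ℝ} (hw0 : Adm μ G Ω w0)
    (hfin : tv μ w0 univ ≠ ⊤) : ∃ E : Set X, MeasurableSet E ∧ G ⊆ E ∧ E ⊆ Ω ∧
      ∀ w, Adm μ G Ω w → tv μ (chi E) univ ≤ tv μ w univ := by
  obtain ⟨u, hu, humin⟩ := exists_adm_minimizer hΩ hΩt hw0 hfin
  set m := tv μ u univ with hm
  have hmt : m ≠ ⊤ := ne_top_of_le_ne_top hfin (humin w0 hw0)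
  have hum := hu.1
  have hlevel : ∀ b : ℝ, 0 < b → b < 1 → tv μ (fun y => b⁻¹ * min (u y) b) univ ≤ m := by
    intro b hb0 hb1
    set α := tv μ (fun y => min (u y) b) univ with hα
    have hmm : AEMeasurable (fun y => min (u y) b) μ := hum.min aemeasurable_const
    have h1 : ∀ b', b < b' → b' < 1 → α + ENNReal.ofReal (1 - b') * m ≤ m := by
      intro b' hb' hb1'
      have hxm : AEMeasurable (fun y => max (u y) b') μ := hum.max aemeasurable_const
      refine le_trans (add_le_add le_rfl ?_) (tv_split hum hb')
      have hpos : 0 < 1 - b' := by linarith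
      have hA : Adm μ G Ω fun y => (1 - b')⁻¹ * (max (u y) b' - b') := by
        refine ⟨by fun_prop, ?_⟩
        filter_upwards [hu.2] with y hy
        refine ⟨mul_nonneg (by positivity) (by linarith [le_max_right (u y) b']), ?_, fun h => ?_,
          fun h => ?_⟩
        · rw [inv_mul_le_iff₀ hpos, mul_one]
          linarith [max_le hy.2.1 hb1'.le]
        · rw [hy.2.2.1 h, max_eq_left hb1'.le, inv_mul_cancel₀ hpos.ne']
        · rw [hy.2.2.2 h, max_eq_right (by linarith), sub_self, mul_zero]
      calc ENNReal.ofReal (1 - b') * m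
          ≤ ENNReal.ofReal (1 - b') * (ENNReal.ofReal (1 - b')⁻¹ *
              tv μ (fun y => max (u y) b' - b') univ) := by
            gcongr
            exact (humin _ hA).trans (tv_const_mul_le (hxm.sub aemeasurable_const) (by positivity))
        _ = tv μ (fun y => max (u y) b' - b') univ := by
            rw [← mul_assoc, ← ENNReal.ofReal_mul hpos.le, mul_inv_cancel₀ hpos.ne',
              ENNReal.ofReal_one, one_mul]
        _ ≤ _ := tv_comp_le (u := fun y => max (u y) b') (fun s => s - b')
            fun s t => by rw [sub_sub_sub_cancel_right]
    have hαt : α ≠ ⊤ := by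
      obtain ⟨b', h2, h3⟩ := exists_between hb1
      exact ne_top_of_le_ne_top hmt (le_self_add.trans (h1 b' h2 h3))
    have h2 : α.toReal ≤ b * m.toReal := by
      have hlim : Tendsto (fun b' : ℝ => b' * m.toReal) (𝓝[>] b) (𝓝 (b * m.toReal)) :=
        ((continuous_id.mul continuous_const).tendsto b).mono_left nhdsWithin_le_nhds
      refine ge_of_tendsto hlim ?_
      filter_upwards [Ioo_mem_nhdsGT hb1] with b' hb'
      have h4 := ENNReal.toReal_mono hmt (h1 b' hb'.1 hb'.2)
      rw [ENNReal.toReal_add hαt (ENNReal.mul_ne_top ENNReal.ofReal_ne_top hmt),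
        ENNReal.toReal_mul, ENNReal.toReal_ofReal (by linarith [hb'.2])] at h4
      linarith
    refine (tv_const_mul_le hmm (by positivity)).trans ?_
    rw [← hα, ← ENNReal.ofReal_toReal hαt, ← ENNReal.ofReal_mul (by positivity)]
    refine ENNReal.ofReal_le_of_le_toReal ?_
    rwa [inv_mul_le_iff₀ hb0]
  obtain ⟨u', hu'm, huu'⟩ := hum
  set E := ({y | 0 < u' y} ∪ G) ∩ Ω with hE
  have hEm : MeasurableSet E := ((measurableSet_lt measurable_const hu'm).union hG).inter hΩ
  refine ⟨E, hEm, fun y hy => ⟨Or.inr hy, hGΩ hy⟩, inter_subset_right, fun w hw =>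
    le_trans ?_ (humin w hw)⟩
  set b : ℕ → ℝ := fun n => 1 / ((n : ℝ) + 2) with hb
  have hb0 : ∀ n, 0 < b n := fun n => by simp only [hb]; positivity
  have hb1 : ∀ n, b n < 1 := fun n => by
    simp only [hb]
    rw [div_lt_one (by positivity)]
    have : (0 : ℝ) ≤ n := Nat.cast_nonneg n
    linarith
  have hblim : Tendsto b atTop (𝓝 0) := by
    have := (tendsto_add_atTop_iff_nat 1).mpr (tendsto_one_div_add_atTop_nhds_zero_nat (𝕜 := ℝ))
    refine this.congr fun n => ?_
    simp only [hb]; push_cast; ring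
  have hchi : ∀ᵐ y ∂μ, (0 < u y → chi E y = 1) ∧ (¬ 0 < u y → chi E y = 0) := by
    filter_upwards [huu', hu.2] with y h1 h2
    constructor
    · intro h
      have hyE : y ∈ E := by
        refine ⟨Or.inl (show 0 < u' y by rwa [← h1]), ?_⟩
        by_contra hy
        rw [h2.2.2.2 hy] at h
        exact lt_irrefl _ h
      rw [chi, indicator_of_mem hyE]
    · intro h
      have hyE : y ∉ E := by
        rintro ⟨h3 | h3, _⟩
        · have h4 : 0 < u' y := h3
          rw [← h1] at h4
          exact h h4
        · rw [h2.2.2.1 h3] at h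
          exact h one_pos
      rw [chi, indicator_of_notMem hyE]
  refine tv_le_of_tendsto (w := fun n y => (b n)⁻¹ * min (u y) (b n))
    (fun n => (hu.1.min aemeasurable_const).const_mul _)
    (tendstoL1Loc_of_bounded (fun n => (hu.1.min aemeasurable_const).const_mul _)
      (measurable_const.indicator hEm).aemeasurable (fun n => ?_) ?_ univ)
    fun n => hlevel _ (hb0 n) (hb1 n)
  · filter_upwards [hchi, hu.2] with y h1 h2
    have h3 : (b n)⁻¹ * min (u y) (b n) ≤ 1 := by
      rw [inv_mul_le_iff₀ (hb0 n), mul_one]; exact min_le_right _ _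
    have h4 : 0 ≤ (b n)⁻¹ * min (u y) (b n) :=
      mul_nonneg (inv_nonneg.mpr (hb0 n).le) (le_min h2.1 (hb0 n).le)
    change |(b n)⁻¹ * min (u y) (b n) - chi E y| ≤ 1
    by_cases h : 0 < u y
    · rw [h1.1 h]; exact abs_le.mpr ⟨by linarith, by linarith⟩
    · rw [h1.2 h]; exact abs_le.mpr ⟨by linarith, by linarith⟩
  · filter_upwards [hchi, hu.2] with y h1 h2
    change Tendsto (fun n => (b n)⁻¹ * min (u y) (b n)) atTop (𝓝 (chi E y))
    by_cases h : 0 < u y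
    · rw [h1.1 h]
      refine tendsto_const_nhds.congr' ?_
      filter_upwards [(tendsto_order.mp hblim).2 _ h] with n hn
      rw [min_eq_right hn.le, inv_mul_cancel₀ (hb0 n).ne']
    · rw [h1.2 h, le_antisymm (not_lt.mp h) h2.1]
      refine tendsto_const_nhds.congr fun n => ?_
      rw [min_eq_left (hb0 n).le, mul_zero]

end Minimizer

section Chains

variable {X : Type*} [MetricSpace X]

lemma le_of_quadratic_increments {F : ℝ → ℝ} {C : ℝ}
    (h : ∀ a b, 0 ≤ a → a ≤ b → b ≤ 1 → F b - F a ≤ C * (b - a) ^ 2) : F 1 ≤ F 0 := by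
  have key : ∀ n : ℕ, F 1 - F 0 ≤ C * (1 / ((n : ℝ) + 1)) := by
    intro n
    have hn : (0 : ℝ) < (n : ℝ) + 1 := by positivity
    have h1 := Finset.sum_range_sub (fun i : ℕ => F ((i : ℝ) / ((n : ℝ) + 1))) (n + 1)
    have h2 : (((n + 1 : ℕ) : ℝ) / ((n : ℝ) + 1)) = 1 := by
      push_cast; exact div_self hn.ne'
    simp only [h2, Nat.cast_zero, zero_div] at h1
    rw [← h1]
    refine (Finset.sum_le_card_nsmul _ _ (C * (1 / ((n : ℝ) + 1)) ^ 2) fun i hi => ?_).trans_eq ?_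
    · have hi' : (i : ℝ) + 1 ≤ (n : ℝ) + 1 := by
        exact_mod_cast Finset.mem_range.mp hi
      refine (h _ _ (by positivity) (by push_cast; gcongr; linarith) ?_).trans_eq ?_
      · push_cast; rw [div_le_one hn]; exact hi'
      · push_cast
        rw [← sub_div, add_sub_cancel_left]
    · rw [Finset.card_range, nsmul_eq_mul]
      push_cast
      field_simp
  have hlim : Tendsto (fun n : ℕ => C * (1 / ((n : ℝ) + 1))) atTop (𝓝 (C * 0)) :=
    tendsto_one_div_add_atTop_nhds_zero_nat.const_mul C
  rw [mul_zero] at hlim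
  linarith [ge_of_tendsto' hlim key]

/-- Length of the first `i` steps of a chain. -/
def chainLen (p : ℕ → X) (i : ℕ) : ℝ := ∑ j ∈ Finset.range i, dist (p j) (p (j + 1))

/-- Weighted length of the first `i` steps of a chain. -/
def chainCost (f : X → ℝ) (p : ℕ → X) (i : ℕ) : ℝ :=
  ∑ j ∈ Finset.range i, f (p j) * dist (p j) (p (j + 1))

lemma chainLen_mono (p : ℕ → X) : Monotone (chainLen p) := fun _ _ hij =>
  Finset.sum_le_sum_of_subset_of_nonneg (Finset.range_mono hij) fun _ _ _ => dist_nonneg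

lemma chainCost_mono {f : X → ℝ} (hf : ∀ z, 0 ≤ f z) (p : ℕ → X) : Monotone (chainCost f p) :=
  fun _ _ hij => Finset.sum_le_sum_of_subset_of_nonneg (Finset.range_mono hij)
    fun _ _ _ => mul_nonneg (hf _) dist_nonneg

lemma dist_le_chainLen (p : ℕ → X) {i j : ℕ} (hij : i ≤ j) :
    dist (p i) (p j) ≤ chainLen p j - chainLen p i := by
  induction j, hij using Nat.le_induction with
  | base => simp
  | succ j hij ih =>
    have h1 : chainLen p (j + 1) = chainLen p j + dist (p j) (p (j + 1)) :=
      Finset.sum_range_succ _ _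
    linarith [dist_triangle (p i) (p j) (p (j + 1))]

lemma chainCost_sub_ge {f : X → ℝ} {K : ℝ≥0} (hf : LipschitzWith K f) (p : ℕ → X) {i j : ℕ}
    (hij : i ≤ j) :
    (f (p i) - K * (chainLen p j - chainLen p i)) * (chainLen p j - chainLen p i) ≤
      chainCost f p j - chainCost f p i := by
  have h : ∀ l, i ≤ l → l ≤ j →
      (f (p i) - K * (chainLen p j - chainLen p i)) * (chainLen p l - chainLen p i) ≤
        chainCost f p l - chainCost f p i := by
    intro l hil
    induction l, hil using Nat.le_induction with
    | base => intro _; simp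
    | succ l hil ih =>
      intro hlj
      have h1 : chainLen p (l + 1) = chainLen p l + dist (p l) (p (l + 1)) :=
        Finset.sum_range_succ _ _
      have h2 : chainCost f p (l + 1) = chainCost f p l + f (p l) * dist (p l) (p (l + 1)) :=
        Finset.sum_range_succ _ _
      have h3 := hf.dist_le_mul (p i) (p l)
      have h4 := dist_le_chainLen p hil
      have h5 := chainLen_mono p (show l ≤ j by omega)
      have h6 : f (p i) - K * (chainLen p j - chainLen p i) ≤ f (p l) := by
        rw [Real.dist_eq] at h3
        have h7 : (K : ℝ) * dist (p i) (p l) ≤ K * (chainLen p j - chainLen p i) := by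
          gcongr; linarith
        linarith [le_abs_self (f (p i) - f (p l))]
      have h8 := mul_le_mul_of_nonneg_right h6 (dist_nonneg (x := p l) (y := p (l + 1)))
      have h9 := ih (by omega)
      rw [h1, h2]
      nlinarith
  exact h j hij le_rfl

lemma chain_index (p : ℕ → X) (m : ℕ) {δ : ℝ} (hδ : 0 ≤ δ)
    (hstep : ∀ j < m, dist (p j) (p (j + 1)) ≤ δ) :
    ∃ I : ℝ → ℕ, (∀ t, I t ≤ m) ∧ p (I 0) = p 0 ∧ I 1 = m ∧ ∀ a b, 0 ≤ a → a ≤ b → b ≤ 1 →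
      I a ≤ I b ∧ chainLen p (I a) ≤ a * chainLen p m ∧ a * chainLen p m - δ ≤ chainLen p (I a) := by
  classical
  have hL : 0 ≤ chainLen p m := by
    have := chainLen_mono p (Nat.zero_le m)
    simpa [chainLen] using this
  set I : ℝ → ℕ := fun t => Nat.findGreatest (fun i => chainLen p i ≤ t * chainLen p m) m with hI
  have hspec : ∀ t, 0 ≤ t → chainLen p (I t) ≤ t * chainLen p m := by
    intro t ht
    refine Nat.findGreatest_spec (P := fun i => chainLen p i ≤ t * chainLen p m) (Nat.zero_le m) ?_
    simpa [chainLen] using mul_nonneg ht hL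
  refine ⟨I, fun t => Nat.findGreatest_le m, ?_, ?_, fun a b ha hab hb => ⟨?_, hspec a ha, ?_⟩⟩
  · have h1 := hspec 0 le_rfl
    rw [zero_mul] at h1
    have h2 := dist_le_chainLen p (Nat.zero_le (I 0))
    have h3 : chainLen p 0 = 0 := by simp [chainLen]
    refine dist_le_zero.mp ?_
    rw [dist_comm]
    linarith
  · refine le_antisymm (Nat.findGreatest_le m) ?_
    exact Nat.le_findGreatest le_rfl (by rw [one_mul])
  · refine Nat.findGreatest_mono_left (fun i hi => hi.trans ?_) m
    gcongr
  · rcases (Nat.findGreatest_le (P := fun i => chainLen p i ≤ a * chainLen p m) m).lt_or_eq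
      with h | h
    · have h1 : ¬ chainLen p (I a + 1) ≤ a * chainLen p m :=
        Nat.findGreatest_is_greatest (Nat.lt_succ_self _) h
      have h2 : chainLen p (I a + 1) = chainLen p (I a) + dist (p (I a)) (p (I a + 1)) :=
        Finset.sum_range_succ _ _
      have h3 := hstep (I a) h
      linarith
    · have h1 : I a = m := h
      rw [h1]
      nlinarith

lemma exists_hyperfilter_lim {Y : Type*} [TopologicalSpace Y] {s : Set Y} (hs : IsCompact s)
    {w : ℕ → Y} (hw : ∀ᶠ n in (hyperfilter ℕ : Filter ℕ), w n ∈ s) :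
    ∃ z ∈ s, Tendsto w (hyperfilter ℕ) (𝓝 z) := by
  obtain ⟨z, hz, h⟩ := hs.ultrafilter_le_nhds ((hyperfilter ℕ).map w) (le_principal_iff.mpr hw)
  exact ⟨z, hz, h⟩

/-- Limits of chains with steps tending to zero and bounded cost. -/
lemma exists_limit_curve [ProperSpace X] {Z : Set X} (hZ : IsClosed Z) {f : ℕ → X → ℝ}
    {K : ℕ → ℝ≥0} {c t : ℝ} (hc : 0 < c) (hf : ∀ n, LipschitzWith (K n) (f n)) (hmono : Monotone f)
    (hfc : ∀ n z, c ≤ f n z) {y : X} (hch : ∀ n : ℕ, ∃ (m : ℕ) (p : ℕ → X), p 0 = y ∧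
      (∀ j < m, dist (p j) (p (j + 1)) ≤ 1 / ((n : ℝ) + 1)) ∧ p m ∈ Z ∧ chainCost (f n) p m ≤ t) :
    ∃ γ : Curve X, γ.toFun 0 = y ∧ γ.toFun 1 ∈ Z ∧
      curveIntegral (fun z => ⨆ n, ENNReal.ofReal (f n z)) γ ≤ ENNReal.ofReal t := by
  choose m p hp0 hstep hpZ hcost using hch
  have hδ : ∀ n : ℕ, (0 : ℝ) ≤ 1 / ((n : ℝ) + 1) := fun n => by positivity
  choose I hIm hI0 hI1 hI using fun n => chain_index (p n) (m n) (hδ n) (hstep n)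
  have hf0 : ∀ n z, 0 ≤ f n z := fun n z => hc.le.trans (hfc n z)
  have hlen0 : ∀ n i, 0 ≤ chainLen (p n) i := fun n i => by
    have := chainLen_mono (p n) (Nat.zero_le i)
    simpa [chainLen] using this
  have hcost0 : ∀ k n i, 0 ≤ chainCost (f k) (p n) i := fun k n i => by
    have := chainCost_mono (hf0 k) (p n) (Nat.zero_le i)
    simpa [chainCost] using this
  set ℓ := t / c with hℓ
  have hlen : ∀ n, chainLen (p n) (m n) ≤ ℓ := by
    intro n
    rw [hℓ, le_div_iff₀ hc, mul_comm]
    refine le_trans ?_ (hcost n)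
    rw [chainLen, Finset.mul_sum]
    exact Finset.sum_le_sum fun j _ => mul_le_mul_of_nonneg_right (hfc n _) dist_nonneg
  set U := hyperfilter ℕ with hU
  have hUle : (U : Filter ℕ) ≤ atTop := Nat.hyperfilter_le_atTop
  have hlimδ : Tendsto (fun n : ℕ => 1 / ((n : ℝ) + 1)) U (𝓝 0) :=
    tendsto_one_div_add_atTop_nhds_zero_nat.mono_left hUle
  have hγex : ∀ s : ℝ, ∃ z ∈ closedBall y ℓ, Tendsto (fun n => p n (I n s)) U (𝓝 z) := fun s =>
    exists_hyperfilter_lim (isCompact_closedBall y ℓ) (Eventually.of_forall fun n => by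
      have h1 := dist_le_chainLen (p n) (Nat.zero_le (I n s))
      have h2 := chainLen_mono (p n) (hIm n s)
      have h3 := hlen0 n 0
      have h4 := hlen n
      rw [hp0] at h1
      rw [mem_closedBall, dist_comm]
      linarith)
  choose γ _ hγ using hγex
  obtain ⟨L, hL, hLlim⟩ := exists_hyperfilter_lim (isCompact_Icc (a := (0 : ℝ)) (b := ℓ))
    (w := fun n => chainLen (p n) (m n)) (Eventually.of_forall fun n => ⟨hlen0 n _, hlen n⟩)
  have hL0 : 0 ≤ L := hL.1
  have hsl : ∀ s, 0 ≤ s → s ≤ 1 →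
      Tendsto (fun n => chainLen (p n) (I n s)) U (𝓝 (s * L)) := by
    intro s h0 h1
    have e1 : Tendsto (fun n => s * chainLen (p n) (m n) - 1 / ((n : ℝ) + 1)) U
        (𝓝 (s * L - 0)) := (hLlim.const_mul s).sub hlimδ
    rw [sub_zero] at e1
    exact tendsto_of_tendsto_of_tendsto_of_le_of_le e1 (hLlim.const_mul s)
      (fun n => (hI n s s h0 le_rfl h1).2.2) fun n => (hI n s s h0 le_rfl h1).2.1
  have hdist : ∀ a b, 0 ≤ a → a ≤ b → b ≤ 1 → dist (γ a) (γ b) ≤ L * (b - a) := by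
    intro a b ha hab hb
    have e1 := (hsl b (ha.trans hab) hb).sub (hsl a ha (hab.trans hb))
    have e2 := (hγ a).dist (hγ b)
    refine (le_of_tendsto_of_tendsto' e2 e1 fun n =>
      dist_le_chainLen (p n) (hI n a b ha hab hb).1).trans_eq (by ring)
  have hlip : LipschitzOnWith L.toNNReal γ (Icc 0 1) := by
    refine LipschitzOnWith.of_dist_le_mul fun a ha b hb => ?_
    rw [Real.coe_toNNReal _ hL0, Real.dist_eq]
    rcases le_total a b with hab | hab
    · rw [abs_sub_comm, abs_of_nonneg (by linarith : 0 ≤ b - a)]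
      exact hdist a b ha.1 hab hb.2
    · rw [abs_of_nonneg (by linarith : 0 ≤ a - b), dist_comm]
      exact hdist b a hb.1 hab ha.2
  have hγ0 : γ 0 = y := by
    refine tendsto_nhds_unique (hγ 0) ?_
    simp only [hI0, hp0]
    exact tendsto_const_nhds
  have hγ1 : γ 1 ∈ Z := by
    refine hZ.mem_of_tendsto (hγ 1) (Eventually.of_forall fun n => ?_)
    rw [hI1]; exact hpZ n
  have hfγ : ∀ k, ContinuousOn (fun s => L * f k (γ s)) (Icc 0 1) := fun k =>
    continuousOn_const.mul ((hf k).continuous.comp_continuousOn hlip.continuousOn)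
  have hint : ∀ k, ∫ s in (0 : ℝ)..1, L * f k (γ s) ≤ t := by
    intro k
    have hC : ∀ s, ∃ z ∈ Icc 0 t, Tendsto (fun n => chainCost (f k) (p n) (I n s)) U (𝓝 z) := by
      intro s
      refine exists_hyperfilter_lim isCompact_Icc (hUle ?_)
      filter_upwards [eventually_ge_atTop k] with n hn
      refine ⟨hcost0 k n _, (chainCost_mono (hf0 k) (p n) (hIm n s)).trans (le_trans ?_ (hcost n))⟩
      exact Finset.sum_le_sum fun j _ => mul_le_mul_of_nonneg_right (hmono hn _) dist_nonneg
    choose C hC1 hC2 using hC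
    have hinc : ∀ a b, 0 ≤ a → a ≤ b → b ≤ 1 →
        (f k (γ a) - K k * (L * (b - a))) * (L * (b - a)) ≤ C b - C a := by
      intro a b ha hab hb
      have e1 := (hsl b (ha.trans hab) hb).sub (hsl a ha (hab.trans hb))
      have e2 : Tendsto (fun n => f k (p n (I n a))) U (𝓝 (f k (γ a))) :=
        ((hf k).continuous.tendsto _).comp (hγ a)
      have e3 := (e2.sub (e1.const_mul (K k : ℝ))).mul e1
      refine le_trans (le_of_eq (by ring)) (le_of_tendsto_of_tendsto' e3 ((hC2 b).sub (hC2 a))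
        fun n => chainCost_sub_ge (hf k) (p n) (hI n a b ha hab hb).1)
    have hii : ∀ a b, 0 ≤ a → a ≤ b → b ≤ 1 →
        IntervalIntegrable (fun s => L * f k (γ s)) volume a b := fun a b ha hab hb =>
      ((hfγ k).mono (by rw [uIcc_of_le hab]; exact Icc_subset_Icc ha hb)).intervalIntegrable
    have hF := le_of_quadratic_increments (F := fun s => (∫ r in (0 : ℝ)..s, L * f k (γ r)) - C s)
      (C := 2 * K k * L ^ 2) (by
        intro a b ha hab hb
        have e1 := intervalIntegral.integral_add_adjacent_intervals
          (hii 0 a le_rfl ha (hab.trans hb)) (hii a b ha hab hb)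
        have e2 : ∫ s in a..b, L * f k (γ s) ≤
            ∫ _s in a..b, L * (f k (γ a) + K k * (L * (b - a))) := by
          refine intervalIntegral.integral_mono_on hab (hii a b ha hab hb)
            intervalIntegrable_const fun s hs => ?_
          refine mul_le_mul_of_nonneg_left ?_ hL0
          have e3 := (hf k).dist_le_mul (γ s) (γ a)
          have e4 := hdist a s ha hs.1 (hs.2.trans hb)
          have e5 : L * (s - a) ≤ L * (b - a) := by gcongr; exact hs.2
          rw [Real.dist_eq, dist_comm (γ s)] at e3
          have e6 : (K k : ℝ) * dist (γ a) (γ s) ≤ K k * (L * (b - a)) := by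
            gcongr; linarith
          linarith [le_abs_self (f k (γ s) - f k (γ a))]
        rw [intervalIntegral.integral_const, smul_eq_mul] at e2
        have e7 := hinc a b ha hab hb
        nlinarith)
    simp only [intervalIntegral.integral_same] at hF
    linarith [(hC1 1).2, (hC1 0).1]
  refine ⟨⟨γ, L.toNNReal, hlip⟩, hγ0, hγ1, ?_⟩
  have hIoo : (volume : Measure ℝ).restrict (Icc 0 1) = volume.restrict (Ioo 0 1) :=
    Measure.restrict_congr_set Ioo_ae_eq_Icc.symm
  calc curveIntegral (fun z => ⨆ n, ENNReal.ofReal (f n z)) ⟨γ, L.toNNReal, hlip⟩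
      = ∫⁻ s in Ioo (0 : ℝ) 1, (⨆ n, ENNReal.ofReal (f n (γ s))) * speed γ s := by
        rw [curveIntegral, hIoo]
    _ ≤ ∫⁻ s in Ioo (0 : ℝ) 1, ⨆ n, ENNReal.ofReal (L * f n (γ s)) := by
        refine setLIntegral_mono' measurableSet_Ioo fun s hs => ?_
        refine (mul_le_mul_right (speed_le hlip hs) _).trans ?_
        rw [ENNReal.iSup_mul]
        refine iSup_mono fun n => ?_
        rw [mul_comm, ENNReal.ofReal_mul hL0]
        rfl
    _ = ∫⁻ s in Icc (0 : ℝ) 1, ⨆ n, ENNReal.ofReal (L * f n (γ s)) := by rw [hIoo]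
    _ = ⨆ n, ∫⁻ s in Icc (0 : ℝ) 1, ENNReal.ofReal (L * f n (γ s)) := by
        refine lintegral_iSup' (fun n => ?_) (Eventually.of_forall fun s i j hij => ?_)
        · exact ((hfγ n).aemeasurable measurableSet_Icc).ennreal_ofReal
        · exact ENNReal.ofReal_le_ofReal (mul_le_mul_of_nonneg_left (hmono hij _) hL0)
    _ ≤ ENNReal.ofReal t := by
        refine iSup_le fun n => ?_
        rw [← ofReal_integral_eq_lintegral_ofReal ((hfγ n).integrableOn_Icc)
          (Eventually.of_forall fun s => mul_nonneg hL0 (hf0 n _)),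
          integral_Icc_eq_integral_Ioc, ← intervalIntegral.integral_of_le zero_le_one]
        exact ENNReal.ofReal_le_ofReal (hint n)

end Chains

section Potential

variable {X : Type*} [MetricSpace X]

/-- The weighted chain distance to `Z` with steps at most `δ`, truncated at `1`. -/
def chainPot (f : X → ℝ) (Z : Set X) (δ : ℝ) (y : X) : ℝ :=
  sInf {t | t = 1 ∨ ∃ (m : ℕ) (p : ℕ → X), p 0 = y ∧ (∀ j < m, dist (p j) (p (j + 1)) ≤ δ) ∧
    p m ∈ Z ∧ chainCost f p m = t}

variable {f : X → ℝ} {Z : Set X} {δ : ℝ}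

lemma chainCost_nonneg (hf : ∀ z, 0 ≤ f z) (p : ℕ → X) (m : ℕ) : 0 ≤ chainCost f p m :=
  Finset.sum_nonneg fun _ _ => mul_nonneg (hf _) dist_nonneg

lemma chainPot_bddBelow (hf : ∀ z, 0 ≤ f z) (y : X) :
    BddBelow {t | t = 1 ∨ ∃ (m : ℕ) (p : ℕ → X), p 0 = y ∧
      (∀ j < m, dist (p j) (p (j + 1)) ≤ δ) ∧ p m ∈ Z ∧ chainCost f p m = t} := by
  refine ⟨0, ?_⟩
  rintro t (rfl | ⟨m, p, -, -, -, rfl⟩)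
  · exact zero_le_one
  · exact chainCost_nonneg hf p m

lemma chainPot_nonneg (hf : ∀ z, 0 ≤ f z) (y : X) : 0 ≤ chainPot f Z δ y := by
  refine Real.sInf_nonneg ?_
  rintro t (rfl | ⟨m, p, -, -, -, rfl⟩)
  · exact zero_le_one
  · exact chainCost_nonneg hf p m

lemma chainPot_le_one (hf : ∀ z, 0 ≤ f z) (y : X) : chainPot f Z δ y ≤ 1 :=
  csInf_le (chainPot_bddBelow hf y) (Or.inl rfl)

lemma chainPot_le_cost (hf : ∀ z, 0 ≤ f z) {m : ℕ} {p : ℕ → X}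
    (hp : ∀ j < m, dist (p j) (p (j + 1)) ≤ δ) (hm : p m ∈ Z) :
    chainPot f Z δ (p 0) ≤ chainCost f p m :=
  csInf_le (chainPot_bddBelow hf _) (Or.inr ⟨m, p, rfl, hp, hm, rfl⟩)

lemma chainPot_eq_zero (hf : ∀ z, 0 ≤ f z) {y : X} (hy : y ∈ Z) : chainPot f Z δ y = 0 := by
  refine le_antisymm ?_ (chainPot_nonneg hf y)
  have := chainPot_le_cost (δ := δ) (m := 0) (p := fun _ => y) hf (by simp) hy
  simpa [chainCost] using this

lemma exists_chain_of_chainPot_lt {y : X} {s : ℝ} (hs : s ≤ 1) (h : chainPot f Z δ y < s) :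
    ∃ (m : ℕ) (p : ℕ → X), p 0 = y ∧ (∀ j < m, dist (p j) (p (j + 1)) ≤ δ) ∧
      p m ∈ Z ∧ chainCost f p m ≤ s := by
  have hne : {t | t = 1 ∨ ∃ (m : ℕ) (p : ℕ → X), p 0 = y ∧ (∀ j < m, dist (p j) (p (j + 1)) ≤ δ) ∧
    p m ∈ Z ∧ chainCost f p m = t}.Nonempty := ⟨1, Or.inl rfl⟩
  obtain ⟨t, (rfl | ⟨m, p, h1, h2, h3, rfl⟩), ht⟩ := exists_lt_of_csInf_lt hne h
  · exact absurd ht (not_lt.mpr hs)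
  · exact ⟨m, p, h1, h2, h3, ht.le⟩

lemma chainPot_le_add (hf : ∀ z, 0 ≤ f z) {y y' : X} (h : dist y y' ≤ δ) :
    chainPot f Z δ y ≤ f y * dist y y' + chainPot f Z δ y' := by
  rw [← sub_le_iff_le_add']
  refine le_csInf ⟨1, Or.inl rfl⟩ ?_
  rintro t (rfl | ⟨m, p, rfl, h2, h3, rfl⟩)
  · linarith [chainPot_le_one (Z := Z) (δ := δ) hf y, mul_nonneg (hf y) (dist_nonneg (x := y) (y := y'))]
  · have := chainPot_le_cost (δ := δ) (Z := Z) (m := m + 1)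
      (p := fun i => Nat.casesOn i y p) hf (fun j hj => by
        cases j with
        | zero => exact h
        | succ j => exact h2 j (by omega)) h3
    have e : chainCost f (fun i => Nat.casesOn i y p) (m + 1) =
        chainCost f p m + f y * dist y (p 0) := by
      rw [chainCost, Finset.sum_range_succ']
      rfl
    rw [e] at this
    have h4 : chainPot f Z δ y ≤ chainCost f p m + f y * dist y (p 0) := this
    linarith

lemma chainPot_mono {f' : X → ℝ} {δ' : ℝ} (hf : ∀ z, 0 ≤ f z) (hff : ∀ z, f z ≤ f' z)
    (hδ : δ' ≤ δ) (y : X) : chainPot f Z δ y ≤ chainPot f' Z δ' y := by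
  refine le_csInf ⟨1, Or.inl rfl⟩ ?_
  rintro t (rfl | ⟨m, p, rfl, h2, h3, rfl⟩)
  · exact chainPot_le_one hf y
  · refine (chainPot_le_cost hf (fun j hj => (h2 j hj).trans hδ) h3).trans ?_
    exact Finset.sum_le_sum fun j _ => mul_le_mul_of_nonneg_right (hff _) dist_nonneg

lemma abs_chainPot_sub_le (hf : ∀ z, 0 ≤ f z) {y y' : X} (h : dist y y' ≤ δ) {M : ℝ}
    (hy : f y ≤ M) (hy' : f y' ≤ M) :
    |chainPot f Z δ y - chainPot f Z δ y'| ≤ M * dist y y' := by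
  have h1 := chainPot_le_add (Z := Z) hf h
  have h2 := chainPot_le_add (Z := Z) hf ((dist_comm y' y).trans_le h)
  rw [dist_comm y' y] at h2
  have h3 := mul_le_mul_of_nonneg_right hy (dist_nonneg (x := y) (y := y'))
  have h4 := mul_le_mul_of_nonneg_right hy' (dist_nonneg (x := y) (y := y'))
  exact abs_le.mpr ⟨by linarith, by linarith⟩

lemma chainPot_locLip [ProperSpace X] (hδ : 0 < δ) (hf : ∀ z, 0 ≤ f z) {M : ℝ≥0}
    (hM : ∀ z, f z ≤ M) : LocLipschitzOn (chainPot f Z δ) univ := by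
  rw [locLip_iff isOpen_univ]
  intro y _
  refine ⟨M, ball y (δ / 2), ball_mem_nhds y (by positivity), LipschitzOnWith.of_dist_le_mul ?_⟩
  intro z hz z' hz'
  rw [Real.dist_eq]
  refine abs_chainPot_sub_le hf ?_ (hM z) (hM z')
  have e1 := mem_ball.mp hz
  have e2 := mem_ball'.mp hz'
  linarith [dist_triangle z y z']

lemma chainPot_ug (hδ : 0 < δ) (hf : ∀ z, 0 ≤ f z) (hfc : Continuous f) :
    IsUpperGradientOn (fun z => ENNReal.ofReal (f z)) (chainPot f Z δ) univ := by
  refine ug_of_local fun γ _ K hK ε hε t ht => ?_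
  set η : ℝ := ε / (2 * (K + 1)) with hη
  have hη0 : 0 < η := by positivity
  have hcont : ContinuousWithinAt (fun s => f (γ.toFun s)) (Icc 0 1) t :=
    (hfc.comp_continuousOn γ.continuousOn) t ht
  obtain ⟨δ₁, hδ₁, h1⟩ := Metric.continuousWithinAt_iff.mp hcont η hη0
  refine ⟨min δ₁ (δ / (2 * (K + 1))), lt_min hδ₁ (by positivity), fun a b ha hab hb hs => ?_⟩
  have hsub : Icc a b ⊆ Icc 0 1 := Icc_subset_Icc ha hb
  have hnear : ∀ s ∈ Icc a b, |f (γ.toFun s) - f (γ.toFun t)| < η := fun s hsm => by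
    have := h1 (hsub hsm) (by rw [Real.dist_eq]; exact (hs s hsm).trans_le (min_le_left _ _))
    rwa [Real.dist_eq] at this
  have haI : a ∈ Icc a b := ⟨le_rfl, hab⟩
  have hbI : b ∈ Icc a b := ⟨hab, le_rfl⟩
  have hd : dist (γ.toFun b) (γ.toFun a) ≤ δ := by
    refine (hK.dist_le_mul _ (hsub hbI) _ (hsub haI)).trans ?_
    have e1 := (hs a haI).trans_le (min_le_right _ _)
    have e2 := (hs b hbI).trans_le (min_le_right _ _)
    rw [Real.dist_eq]
    have e3 : |b - a| ≤ 2 * (δ / (2 * ((K : ℝ) + 1))) := by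
      calc |b - a| = |(b - t) - (a - t)| := by ring_nf
        _ ≤ |b - t| + |a - t| := abs_sub _ _
        _ ≤ _ := by linarith
    calc (K : ℝ) * |b - a| ≤ (K + 1) * (2 * (δ / (2 * ((K : ℝ) + 1)))) := by
          gcongr; linarith
      _ = δ := by field_simp
  have hpot := abs_chainPot_sub_le (Z := Z) hf hd (M := f (γ.toFun t) + η)
    (by linarith [(abs_lt.mp (hnear b hbI)).2]) (by linarith [(abs_lt.mp (hnear a haI)).2])
  have hM0 : 0 ≤ f (γ.toFun t) + η := by linarith [hf (γ.toFun t)]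
  have hIoo : (volume : Measure ℝ).restrict (Icc a b) = volume.restrict (Ioo a b) :=
    Measure.restrict_congr_set Ioo_ae_eq_Icc.symm
  calc ENNReal.ofReal |chainPot f Z δ (γ.toFun b) - chainPot f Z δ (γ.toFun a)|
      ≤ ENNReal.ofReal (f (γ.toFun t) + η) * ∫⁻ s in Icc a b, speed γ.toFun s := by
        refine (ENNReal.ofReal_le_ofReal hpot).trans ?_
        rw [ENNReal.ofReal_mul hM0]
        exact mul_le_mul_right (dist_le_speed γ ha hab hb) _
    _ = ∫⁻ s in Ioo a b, ENNReal.ofReal (f (γ.toFun t) + η) * speed γ.toFun s := by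
        rw [hIoo, lintegral_const_mul' _ _ ENNReal.ofReal_ne_top]
    _ ≤ ∫⁻ s in Ioo a b, (ENNReal.ofReal (f (γ.toFun s)) * speed γ.toFun s + ε) := by
        refine setLIntegral_mono' measurableSet_Ioo fun s hsm => ?_
        have e1 : f (γ.toFun t) + η ≤ f (γ.toFun s) + 2 * η := by
          linarith [(abs_lt.mp (hnear s (Ioo_subset_Icc_self hsm))).1]
        refine (mul_le_mul_left (ENNReal.ofReal_le_ofReal e1) _).trans ?_
        rw [ENNReal.ofReal_add (hf _) (by positivity), add_mul]
        refine add_le_add le_rfl ?_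
        refine (mul_le_mul_right (speed_le hK ⟨ha.trans_lt hsm.1, hsm.2.trans_le hb⟩) _).trans ?_
        rw [← ENNReal.ofReal_coe_nnreal, ← ENNReal.ofReal_mul (by positivity),
          ← ENNReal.ofReal_coe_nnreal (p := ε)]
        refine ENNReal.ofReal_le_ofReal ?_
        rw [hη]
        have : (K : ℝ) / (K + 1) ≤ 1 := by rw [div_le_one (by positivity)]; linarith
        calc 2 * ((ε : ℝ) / (2 * (K + 1))) * K = ε * ((K : ℝ) / (K + 1)) := by field_simp
          _ ≤ ε * 1 := by gcongr
          _ = ε := mul_one _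
    _ = (∫⁻ s in Icc a b, ENNReal.ofReal (f (γ.toFun s)) * speed γ.toFun s) +
          ε * volume (Icc a b) := by
        rw [lintegral_add_right _ measurable_const, hIoo, setLIntegral_const, Real.volume_Ioo,
          Real.volume_Icc]

end Potential

section LowerApprox

variable {X : Type*} [MetricSpace X]

/-- Lipschitz approximations from below of a lower semicontinuous function. -/
def lipApprox (h : X → ℝ≥0∞) (n : ℕ) (y : X) : ℝ :=
  (⨅ z, (min (h z) n + n * edist y z)).toReal

lemma lipApprox_ofReal (h : X → ℝ≥0∞) (n : ℕ) (y : X) :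
    ENNReal.ofReal (lipApprox h n y) = ⨅ z, (min (h z) n + n * edist y z) := by
  refine ENNReal.ofReal_toReal (ne_top_of_le_ne_top (b := (n : ℝ≥0∞)) (ENNReal.natCast_ne_top n) ?_)
  refine (iInf_le _ y).trans ?_
  rw [edist_self, mul_zero, add_zero]
  exact min_le_right _ _

lemma lipApprox_le_nat (h : X → ℝ≥0∞) (n : ℕ) (y : X) : lipApprox h n y ≤ n := by
  refine (ENNReal.ofReal_le_ofReal_iff (Nat.cast_nonneg n)).mp ?_
  rw [lipApprox_ofReal, ENNReal.ofReal_natCast]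
  refine (iInf_le _ y).trans ?_
  rw [edist_self, mul_zero, add_zero]
  exact min_le_right _ _

lemma lipApprox_nonneg (h : X → ℝ≥0∞) (n : ℕ) (y : X) : 0 ≤ lipApprox h n y :=
  ENNReal.toReal_nonneg

lemma lipApprox_le (h : X → ℝ≥0∞) (n : ℕ) (y : X) : ENNReal.ofReal (lipApprox h n y) ≤ h y := by
  rw [lipApprox_ofReal]
  refine (iInf_le _ y).trans ?_
  rw [edist_self, mul_zero, add_zero]
  exact min_le_left _ _

lemma lipApprox_mono (h : X → ℝ≥0∞) (y : X) : Monotone fun n => lipApprox h n y := by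
  intro i j hij
  refine (ENNReal.ofReal_le_ofReal_iff (lipApprox_nonneg _ _ _)).mp ?_
  rw [lipApprox_ofReal, lipApprox_ofReal]
  have : (i : ℝ≥0∞) ≤ j := by exact_mod_cast hij
  exact iInf_mono fun z => add_le_add (min_le_min le_rfl this) (mul_le_mul_left this _)

lemma lipApprox_lipschitz (h : X → ℝ≥0∞) (n : ℕ) : LipschitzWith n (lipApprox h n) := by
  refine LipschitzWith.of_le_add_mul _ fun y y' => ?_
  refine (ENNReal.ofReal_le_ofReal_iff (by
    have := lipApprox_nonneg h n y'
    positivity)).mp ?_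
  rw [ENNReal.ofReal_add (lipApprox_nonneg _ _ _) (by positivity), lipApprox_ofReal,
    lipApprox_ofReal, ENNReal.iInf_add]
  refine le_iInf fun z => (iInf_le _ z).trans ?_
  rw [add_assoc]
  refine add_le_add le_rfl ?_
  rw [ENNReal.ofReal_mul (by positivity), ← edist_dist]
  have : ENNReal.ofReal ((n : ℝ≥0) : ℝ) = n := by simp
  rw [this, ← mul_add, add_comm]
  exact mul_le_mul_right (edist_triangle _ _ _) _

lemma iSup_lipApprox {h : X → ℝ≥0∞} (hh : LowerSemicontinuous h) (y : X) :
    h y ≤ ⨆ n, ENNReal.ofReal (lipApprox h n y) := by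
  refine le_of_forall_lt fun t ht => ?_
  obtain ⟨s, hts, hs⟩ := exists_between ht
  have hst : s ≠ ⊤ := (hs.trans_le le_top).ne
  obtain ⟨δ, hδ, hb⟩ := EMetric.mem_nhds_iff.mp (hh y s hs)
  obtain ⟨n, hn1, hn2⟩ : ∃ n : ℕ, s ≤ n ∧ s ≤ n * δ := by
    have hδ' : min δ 1 ≠ 0 := (lt_min hδ one_pos).ne'
    obtain ⟨n, hn⟩ := ENNReal.exists_nat_mul_gt hδ' hst
    refine ⟨n, hn.le.trans ?_, hn.le.trans (mul_le_mul_right (min_le_left _ _) _)⟩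
    exact (mul_le_mul_right (min_le_right _ _) _).trans_eq (mul_one _)
  refine hts.trans_le (le_trans ?_ (le_iSup _ n))
  rw [lipApprox_ofReal]
  refine le_iInf fun z => ?_
  by_cases hz : edist y z < δ
  · have h1 : s < h z := hb (Metric.mem_eball'.mpr hz)
    exact (le_min h1.le hn1).trans le_self_add
  · exact (hn2.trans (mul_le_mul_right (not_lt.mp hz) _)).trans le_add_self

end LowerApprox

section OuterCapacity

variable {X : Type*} [MetricSpace X] [MeasurableSpace X] [BorelSpace X] [ProperSpace X]
  {μ : Measure X}

lemma exists_ug_of_vcap1_lt {D Ω : Set X} {a : ℝ≥0∞} (h : vcap1 μ D Ω < a) :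
    ∃ (u : X → ℝ) (g : X → ℝ≥0∞), (∀ y ∈ D, 1 ≤ u y) ∧ (∀ y ∈ Ωᶜ, u y = 0) ∧ Measurable g ∧
      IsUpperGradientOn g u univ ∧ ∫⁻ y, g y ∂μ < a := by
  simp only [vcap1, iInf_lt_iff] at h
  obtain ⟨u, -, h1, h2, g, h3, h4, h5⟩ := h
  have hε : a - ∫⁻ y, g y ∂μ ≠ 0 := (tsub_pos_of_lt h5).ne'
  obtain ⟨ε, hε0, hε1⟩ := exists_between (pos_iff_ne_zero.mpr hε)
  obtain ⟨g', h6, h7, h8⟩ := h4.exists_ug h3 hε0.ne'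
  refine ⟨u, g', h1, h2, h6, h7, ?_⟩
  have h9 := h8 univ
  rw [setLIntegral_univ, setLIntegral_univ] at h9
  exact h9.trans_lt (lt_tsub_iff_left.mp hε1)

/-- The variational capacity is an outer capacity, up to a factor. -/
theorem exists_open_of_vcap1_lt [IsFiniteMeasureOnCompacts μ] {D : Set X} {x : X} {r : ℝ}
    (hr : 0 < r) {a : ℝ≥0∞} (h : vcap1 μ D (ball x (2 * r)) < a) :
    ∃ (O : Set X) (w : X → ℝ), IsOpen O ∧ D ⊆ O ∧ O ⊆ ball x (2 * r) ∧
      Adm μ O (ball x (2 * r)) w ∧ tv μ w univ ≤ 2 * a := by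
  obtain ⟨u, g, hu1, hu0, hgm, hg, hga⟩ := exists_ug_of_vcap1_lt h
  have hε : a - ∫⁻ y, g y ∂μ ≠ 0 := (tsub_pos_of_lt hga).ne'
  obtain ⟨ε, hε0, hε1⟩ := exists_between (pos_iff_ne_zero.mpr hε)
  obtain ⟨k, hgk, hk, hkint⟩ := exists_le_lowerSemicontinuous_lintegral_ge μ g hgm hε0.ne'
  have hka : ∫⁻ y, k y ∂μ < a := hkint.trans_lt (lt_tsub_iff_left.mp hε1)
  have hku : IsUpperGradientOn k u univ := hg.mono le_rfl fun y _ => hgk y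
  have hB : μ (ball x (3 * r)) ≠ ⊤ :=
    ne_top_of_le_ne_top (isCompact_closedBall x (3 * r)).measure_lt_top.ne
      (measure_mono ball_subset_closedBall)
  obtain ⟨c, hc0, hc⟩ : ∃ c : ℝ, 0 < c ∧
      ∫⁻ y, k y ∂μ + ENNReal.ofReal c * μ (ball x (3 * r)) ≤ a := by
    obtain ⟨e, he0, he⟩ := ENNReal.exists_nnreal_pos_mul_lt hB (tsub_pos_of_lt hka).ne'
    refine ⟨e, he0, ?_⟩
    rw [ENNReal.ofReal_coe_nnreal]
    exact (lt_tsub_iff_left.mp he).le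
  set f : ℕ → X → ℝ := fun n y => max (lipApprox k n y) c with hf
  have hfc : ∀ n y, c ≤ f n y := fun n y => le_max_right _ _
  have hf0 : ∀ n y, 0 ≤ f n y := fun n y => hc0.le.trans (hfc n y)
  have hfmono : Monotone f := fun i j hij y => max_le_max (lipApprox_mono k y hij) le_rfl
  have hflip : ∀ n : ℕ, LipschitzWith (n : ℝ≥0) (f n) := fun n => (lipApprox_lipschitz k n).max_const c
  have hfM : ∀ (n : ℕ) y, f n y ≤ ((n + c.toNNReal : ℝ≥0) : ℝ) := fun n y => by
    push_cast
    rw [Real.coe_toNNReal _ hc0.le]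
    exact max_le ((lipApprox_le_nat k n y).trans (by linarith)) (by
      have : (0 : ℝ) ≤ n := Nat.cast_nonneg n
      linarith)
  set Ω := ball x (2 * r) with hΩ
  set U : ℕ → X → ℝ := fun n => chainPot (f n) Ωᶜ (1 / ((n : ℝ) + 1)) with hU
  have hδ : ∀ n : ℕ, (0 : ℝ) < 1 / ((n : ℝ) + 1) := fun n => by positivity
  have hU0 : ∀ n y, 0 ≤ U n y := fun n y => chainPot_nonneg (hf0 n) y
  have hU1 : ∀ n y, U n y ≤ 1 := fun n y => chainPot_le_one (hf0 n) y
  have hUlip : ∀ n, LocLipschitzOn (U n) univ := fun n => chainPot_locLip (hδ n) (hf0 n) (hfM n)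
  have hUc : ∀ n, Continuous (U n) := fun n => (hUlip n).continuous
  have hUmono : ∀ y, Monotone fun n => U n y := fun y i j hij =>
    chainPot_mono (hf0 i) (hfmono hij) (by gcongr) y
  have hUΩ : ∀ n, ∀ y ∉ Ω, U n y = 0 := fun n y hy => chainPot_eq_zero (hf0 n) hy
  have hUg : ∀ n, IsUpperGradientOn
      ((ball x (3 * r)).indicator fun y => ENNReal.ofReal (f n y)) (U n) univ := by
    intro n
    refine ug_of_cover (fun b : Bool => cond b (ball x (3 * r)) (closedBall x (2 * r))ᶜ) ?_ ?_ ?_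
    · intro b; cases b
      · exact isClosed_closedBall.isOpen_compl
      · exact isOpen_ball
    · intro y _
      rw [mem_iUnion]
      rcases lt_or_ge (dist y x) (3 * r) with hy | hy
      · exact ⟨true, hy⟩
      · refine ⟨false, fun hy' => ?_⟩
        have := mem_closedBall.mp hy'
        linarith
    · intro b
      rw [inter_univ]
      cases b
      · refine ((ug_const 0 _).congr fun y hy => ?_).mono le_rfl fun _ _ => zero_le
        exact (hUΩ n y fun hy' => hy (ball_subset_closedBall hy')).symm
      · refine (chainPot_ug (hδ n) (hf0 n) (hflip n).continuous).mono (subset_univ _)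
          fun y hy => ?_
        have hy' : y ∈ ball x (3 * r) := hy
        rw [indicator_of_mem hy']
  have hUtv : ∀ n, tv μ (U n) univ ≤ a := by
    intro n
    refine Appr.tv_le ⟨fun _ => U n, fun _ => _, fun _ => hUlip n, tendstoL1Loc_const _ _,
      fun _ => (hflip n).continuous.measurable.ennreal_ofReal.indicator measurableSet_ball,
      fun _ => hUg n, fun _ => ?_⟩
    rw [setLIntegral_univ, lintegral_indicator measurableSet_ball]
    calc ∫⁻ y in ball x (3 * r), ENNReal.ofReal (f n y) ∂μ
        ≤ ∫⁻ y in ball x (3 * r), (k y + ENNReal.ofReal c) ∂μ := by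
          refine lintegral_mono fun y => ?_
          change ENNReal.ofReal (max _ _) ≤ _
          rw [ENNReal.ofReal_max]
          exact max_le ((lipApprox_le k n y).trans le_self_add) le_add_self
      _ ≤ ∫⁻ y, k y ∂μ + ENNReal.ofReal c * μ (ball x (3 * r)) := by
          rw [lintegral_add_right _ measurable_const, setLIntegral_const]
          exact add_le_add (setLIntegral_le_lintegral _ _) le_rfl
      _ ≤ a := hc
  set W : X → ℝ := fun y => ⨆ n, U n y with hW
  have hbdd : ∀ y, BddAbove (range fun n => U n y) := fun y => ⟨1, by
    rintro _ ⟨n, rfl⟩; exact hU1 n y⟩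
  have hlim : ∀ y, Tendsto (fun n => U n y) atTop (𝓝 (W y)) := fun y =>
    tendsto_atTop_ciSup (hUmono y) (hbdd y)
  have hWm : Measurable W := Measurable.iSup fun n => (hUc n).measurable
  have hW0 : ∀ y, 0 ≤ W y := fun y => (hU0 0 y).trans (le_ciSup (hbdd y) 0)
  refine ⟨⋃ n, {y | 2⁻¹ < U n y}, fun y => 2 * min (W y) 2⁻¹,
    isOpen_iUnion fun n => isOpen_lt continuous_const (hUc n), ?_, ?_, ⟨?_, ?_⟩, ?_⟩
  · intro y hy
    by_contra hcon
    have hle : ∀ n, U n y ≤ 2⁻¹ := fun n => not_lt.mp fun hn => hcon (mem_iUnion.mpr ⟨n, hn⟩)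
    obtain ⟨γ, hγ0, hγ1, hγ⟩ := exists_limit_curve (Z := Ωᶜ) (t := 3 / 4)
      isOpen_ball.isClosed_compl hc0 hflip hfmono hfc (y := y) fun n =>
        exists_chain_of_chainPot_lt (by norm_num) ((hle n).trans_lt (by norm_num))
    have h1 := hku γ fun _ _ => mem_univ _
    rw [hγ0, hu0 _ hγ1, zero_sub, abs_neg] at h1
    have h2 : (1 : ℝ) ≤ |u y| := (hu1 y hy).trans (le_abs_self _)
    have h3 := ((ENNReal.ofReal_le_ofReal h2).trans h1).trans
      ((curveIntegral_mono (fun z => (iSup_lipApprox hk z).trans (iSup_mono fun n =>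
        ENNReal.ofReal_le_ofReal (le_max_left _ c))) γ).trans hγ)
    rw [ENNReal.ofReal_le_ofReal_iff (by norm_num)] at h3
    norm_num at h3
  · intro y hy
    obtain ⟨n, hn⟩ := mem_iUnion.mp hy
    by_contra hcon
    have h1 : 2⁻¹ < U n y := hn
    rw [hUΩ n y hcon] at h1
    norm_num at h1
  · exact ((hWm.min measurable_const).const_mul _).aemeasurable
  · refine Eventually.of_forall fun y => ⟨?_, ?_, fun hy => ?_, fun hy => ?_⟩
    · exact mul_nonneg zero_le_two (le_min (hW0 y) (by norm_num))
    · linarith [min_le_right (W y) 2⁻¹]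
    · obtain ⟨n, hn⟩ := mem_iUnion.mp hy
      have h1 : 2⁻¹ < U n y := hn
      have h2 : 2⁻¹ ≤ W y := h1.le.trans (le_ciSup (hbdd y) n)
      change 2 * min (W y) 2⁻¹ = 1
      rw [min_eq_right h2]
      norm_num
    · have h1 : W y = 0 := by
        change ⨆ n, U n y = 0
        simp only [hUΩ _ y hy, ciSup_const]
      change 2 * min (W y) 2⁻¹ = 0
      rw [h1, min_eq_left (by norm_num), mul_zero]
  · have hm : ∀ n, AEMeasurable (fun y => min (U n y) 2⁻¹) μ := fun n =>
      ((hUc n).measurable.min measurable_const).aemeasurable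
    refine tv_le_of_tendsto (w := fun n y => 2 * min (U n y) 2⁻¹) (fun n => (hm n).const_mul _)
      (tendstoL1Loc_of_bounded (fun n => (hm n).const_mul _)
        ((hWm.min measurable_const).const_mul _).aemeasurable (fun n => ?_) ?_ univ) fun n => ?_
    · refine Eventually.of_forall fun y => ?_
      have h1 : 0 ≤ min (U n y) 2⁻¹ := le_min (hU0 n y) (by norm_num)
      have h2 : 0 ≤ min (W y) 2⁻¹ := le_min (hW0 y) (by norm_num)
      exact abs_le.mpr ⟨by linarith [min_le_right (W y) 2⁻¹], by linarith [min_le_right (U n y) 2⁻¹]⟩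
    · exact Eventually.of_forall fun y =>
        ((hlim y).min tendsto_const_nhds).const_mul 2
    · refine (tv_const_mul_le (hm n) zero_le_two).trans ?_
      rw [ENNReal.ofReal_ofNat]
      refine mul_le_mul_right (le_trans ?_ (hUtv n)) _
      exact tv_comp_le (u := U n) (fun s => min s 2⁻¹) fun s t => by
        refine (abs_min_sub_min_le_max _ _ _ _).trans ?_
        rw [sub_self, abs_zero, max_eq_left (abs_nonneg _)]

end OuterCapacity

section Obstacle

variable {X : Type*} [MetricSpace X] [MeasurableSpace X] [BorelSpace X] [ProperSpace X]
  {μ : Measure X} {Cd CP lam : ℝ}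

/-- `E` has least perimeter among the sets, and functions with values in `[0,1]`, that contain
the obstacle `G` and vanish outside `Ω`. -/
structure LeastPerim (μ : Measure X) (G Ω E : Set X) : Prop where
  meas : MeasurableSet E
  subset : G ⊆ E
  subset_dom : E ⊆ Ω
  finite : tv μ (chi E) univ ≠ ⊤
  le_tv : ∀ w : X → ℝ, Adm μ G Ω w → tv μ (chi E) univ ≤ tv μ w univ

lemma chi_nonneg (E : Set X) (y : X) : 0 ≤ chi E y := indicator_nonneg (fun _ _ => zero_le_one) y

lemma chi_le_one (E : Set X) (y : X) : chi E y ≤ 1 :=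
  indicator_le' (fun _ _ => le_rfl) (fun _ _ => zero_le_one) y

lemma chi_of_mem {E : Set X} {y : X} (h : y ∈ E) : chi E y = 1 := indicator_of_mem h _

lemma chi_of_notMem {E : Set X} {y : X} (h : y ∉ E) : chi E y = 0 := indicator_of_notMem h _

lemma measurable_chi {E : Set X} (hE : MeasurableSet E) : Measurable (chi E) :=
  measurable_const.indicator hE

lemma appr_const (c : ℝ) (Ω : Set X) : Appr μ (fun _ => c) Ω 0 :=
  ⟨fun _ _ => c, fun _ _ => 0, fun _ => locLip_const c Ω, tendstoL1Loc_const _ _,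
    fun _ => measurable_const, fun _ => ug_const c Ω, fun _ => by simp⟩

variable {G Ω E : Set X}

lemma LeastPerim.memBV (h : LeastPerim μ G Ω E) (hΩ : μ Ω ≠ ⊤) : MemBV μ (chi E) univ := by
  refine ⟨?_, h.finite.lt_top⟩
  rw [integrableOn_univ]
  exact (integrable_indicator_iff h.meas).mpr
    (integrableOn_const (((measure_mono h.subset_dom).trans_lt hΩ.lt_top).ne) (by simp))

/-- Local comparison with the obstacle solution for functions above it. -/
lemma LeastPerim.le_tv_add (h : LeastPerim μ G Ω E) {φ : X → ℝ} (hφm : AEMeasurable φ μ)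
    (hφ : ∀ y, 0 ≤ φ y) (hφΩ : ∀ y ∉ Ω, φ y = 0) :
    tv μ (chi E) univ ≤ tv μ (fun y => chi E y + φ y) univ := by
  refine (h.le_tv (fun y => min (chi E y + φ y) 1) ⟨?_, ?_⟩).trans ?_
  · exact ((measurable_chi h.meas).aemeasurable.add hφm).min aemeasurable_const
  · refine Eventually.of_forall fun y => ⟨?_, min_le_right _ _, fun hy => ?_, fun hy => ?_⟩
    · exact le_min (add_nonneg (chi_nonneg E y) (hφ y)) zero_le_one
    · refine min_eq_right ?_
      rw [chi_of_mem (h.subset hy)]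
      linarith [hφ y]
    · change min (chi E y + φ y) 1 = 0
      rw [chi_of_notMem fun hE => hy (h.subset_dom hE), hφΩ y hy]
      norm_num
  · exact tv_comp_le (u := fun y => chi E y + φ y) (fun s => min s 1) fun s t => by
      refine (abs_min_sub_min_le_max _ _ _ _).trans ?_
      rw [sub_self, abs_zero, max_eq_left (abs_nonneg _)]

lemma LeastPerim.superminimizer (h : LeastPerim μ G Ω E) (hΩ : μ Ω ≠ ⊤) {V : Set X}
    (hV : IsOpen V) (hVΩ : V ⊆ Ω) : IsSuperminimizer μ (chi E) V := by
  refine ⟨fun K _ hKV => ⟨V, hV, hKV, le_rfl, (h.memBV hΩ).1.mono_set (subset_univ V),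
    (tv_mono (subset_univ V)).trans_lt h.finite.lt_top⟩, ?_⟩
  rintro φ ⟨hφBV, hK, hKV⟩ hφ
  rcases (tsupport φ).eq_empty_or_nonempty with he | hne
  · have h0 : φ = 0 := by rwa [tsupport_eq_empty_iff] at he
    simp [h0]
  have hφ0 : ∀ y ∉ tsupport φ, φ y = 0 := fun y hy => image_eq_zero_of_notMem_tsupport hy
  have hφm : AEMeasurable φ μ := by
    have h1 : V.indicator φ = φ := by
      refine indicator_eq_self.mpr fun y hy => hKV (subset_tsupport φ hy)
    rw [← h1]
    exact (aemeasurable_indicator_iff hV.measurableSet).mpr hφBV.1.aemeasurable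
  refine le_iInf fun U => le_iInf fun hU => le_iInf fun hKU => ?_
  refine le_of_forall_gt fun b hb => ?_
  obtain ⟨a, ha, hab⟩ := exists_between hb
  refine lt_of_le_of_lt ?_ hab
  obtain ⟨ε, hε, hεU⟩ := hK.exists_cthickening_subset_open hU hKU
  set d := ε / 5 with hd
  have hd0 : 0 < d := by positivity
  have hKU' : {z | infDist z (tsupport φ) ≤ 4 * d} ⊆ U := by
    intro z hz
    have hz' : infDist z (tsupport φ) ≤ 4 * d := hz
    refine hεU ?_
    have h1 : infDist z (tsupport φ) < ε := by linarith
    exact thickening_subset_cthickening ε _ (mem_thickening_iff_infDist_lt hne |>.mpr h1)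
  have hsum : (fun z => max (glue (tsupport φ) d (fun y => chi E y + φ y) (chi E) z) 0) =
      fun y => chi E y + φ y := by
    funext z
    have : glue (tsupport φ) d (fun y => chi E y + φ y) (chi E) z = chi E z + φ z := by
      unfold glue
      by_cases hz : z ∈ tsupport φ
      · rw [ramp_eq_one hd0 (by rw [infDist_zero_of_mem hz]; positivity)]; ring
      · simp only [hφ0 z hz]; ring
    rw [this, max_eq_left (add_nonneg (chi_nonneg E z) (hφ z))]
  have key := tv_le_of_comparison hd0 hne hK.isBounded hU hKU' (u := chi E)
    (v := fun y => chi E y + φ y) (ψ := fun _ => 0) (a := a) (c := 0) (μ := μ)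
    (measurable_chi h.meas).aemeasurable h.finite
    ((measurable_chi h.meas).aemeasurable.add hφm).restrict (appr_of_tv_lt ha)
    (appr_const 0 univ) (by
      rw [hsum]
      exact h.le_tv_add hφm hφ fun y hy => hφ0 y fun hy' => hy (hVΩ (hKV hy')))
  have hglue : glueCost μ (tsupport φ) d (fun y => chi E y + φ y) (chi E) = 0 := by
    unfold glueCost
    rw [setLIntegral_congr_fun (g := fun _ => 0), lintegral_zero, mul_zero]
    · exact (((isOpen_lt_infDist _ _).inter (isOpen_infDist_lt _ _))).measurableSet
    · intro z hz
      have hz1 : d < infDist z (tsupport φ) := hz.1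
      have : z ∉ tsupport φ := fun hz' => by
        rw [infDist_zero_of_mem hz'] at hz1
        linarith
      simp [hφ0 z this]
  rw [hglue, add_zero, add_zero] at key
  refine le_trans ?_ key
  refine iInf_le_of_le _ (iInf_le_of_le (isOpen_infDist_lt _ _) (iInf_le_of_le ?_ le_rfl))
  intro z hz
  show infDist z (tsupport φ) < d
  rwa [infDist_zero_of_mem hz]

/-- Caccioppoli inequality for the obstacle solution, with the obstacle covered by balls. -/
lemma MMS.caccioppoli (hX : MMS μ Cd CP lam) : ∃ C : ℝ≥0, 1 ≤ C ∧ ∀ (G Ω E : Set X),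
    LeastPerim μ G Ω E → ∀ (y : X) (s : ℝ) (z : ℕ → X) (ρ : ℕ → ℝ), 0 < s → (∀ i, 0 ≤ ρ i) →
    G ∩ ball y (4 * s) ⊆ ⋃ i, ball (z i) (ρ i) → (⋃ i, ball (z i) (2 * ρ i)) ⊆ Ω →
    tv μ (chi E) (ball y s) ≤
      ENNReal.ofReal (1 / s) * μ (E ∩ ball y (4 * s)) + C * ∑' i, cost μ (z i) (ρ i) := by
  obtain ⟨C, hC1, hC⟩ := hX.supCut_appr
  refine ⟨C, hC1, fun G Ω E h y s z ρ hs hρ hG hΩ => ?_⟩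
  have hball : ∀ t, {w : X | infDist w {y} < t} = ball y t := fun t => by
    ext w; simp [infDist_singleton]
  have hmin : tv μ (chi E) univ ≤
      tv μ (fun w => max (glue {y} s (fun _ => 0) (chi E) w) (supCut z ρ w)) univ := by
    refine h.le_tv _ ⟨?_, Eventually.of_forall fun w => ⟨?_, ?_, fun hw => ?_, fun hw => ?_⟩⟩
    · refine Measurable.aemeasurable (Measurable.max ?_ (measurable_supCut z ρ))
      exact ((measurable_ramp {y} s).mul measurable_const).add
        ((measurable_const.sub (measurable_ramp {y} s)).mul (measurable_chi h.meas))
    · exact le_max_of_le_right (supCut_nonneg z ρ w)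
    · refine max_le ?_ (supCut_le_one z ρ w)
      unfold glue
      nlinarith [ramp_nonneg s (infDist w {y}), ramp_le_one s (infDist w {y}), chi_nonneg E w,
        chi_le_one E w]
    · by_cases hwb : w ∈ ball y (4 * s)
      · change max (glue {y} s (fun _ => 0) (chi E) w) (supCut z ρ w) = 1
        rw [supCut_eq_one (hG ⟨hw, hwb⟩)]
        refine max_eq_right ?_
        unfold glue
        nlinarith [ramp_nonneg s (infDist w {y}), ramp_le_one s (infDist w {y}), chi_nonneg E w,
          chi_le_one E w]
      · have h1 : ramp s (infDist w {y}) = 0 := by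
          refine ramp_eq_zero hs ?_
          rw [infDist_singleton]
          have := not_lt.mp (fun h' => hwb (mem_ball.mpr h'))
          linarith
        change max (glue {y} s (fun _ => 0) (chi E) w) (supCut z ρ w) = 1
        unfold glue
        rw [h1, chi_of_mem (h.subset hw)]
        simpa using supCut_le_one z ρ w
    · change max (glue {y} s (fun _ => 0) (chi E) w) (supCut z ρ w) = 0
      unfold glue
      rw [supCut_eq_zero hρ fun hw' => hw (hΩ hw'), chi_of_notMem fun hE => hw (h.subset_dom hE)]
      simp
  have key := tv_le_of_comparison hs (singleton_nonempty y) Bornology.isBounded_singleton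
    isOpen_univ (subset_univ _) (u := chi E) (v := fun _ => 0) (ψ := supCut z ρ) (a := 0)
    (μ := μ) (measurable_chi h.meas).aemeasurable h.finite aemeasurable_const
    (appr_const 0 univ) (hC z ρ hρ) hmin
  rw [hball, zero_add] at key
  refine key.trans (add_le_add_left (mul_le_mul_right ?_ _) _)
  have hmeas : MeasurableSet (ball y (4 * s)) := measurableSet_ball
  calc _ ≤ ∫⁻ w in ball y (4 * s), E.indicator 1 w ∂μ := by
        refine (lintegral_mono_set (t := ball y (4 * s)) ?_).trans (lintegral_mono fun w => ?_)
        · intro w hw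
          rw [← hball]; exact hw.2
        · by_cases hw : w ∈ E
          · simp [chi_of_mem hw, hw]
          · simp [chi_of_notMem hw]
    _ = _ := by
        rw [lintegral_indicator_one h.meas, Measure.restrict_apply h.meas]

end Obstacle

section ThinCover

variable {X : Type*} [MetricSpace X] [MeasurableSpace X] [BorelSpace X] [ProperSpace X]
  {μ : Measure X} {Cd CP lam : ℝ}

/-- Sets of small variational capacity can be covered by balls with small total cost. -/
lemma MMS.cov_of_vcap1 (hX : MMS μ Cd CP lam) {τ : ℝ} (hτ : 0 < τ) :
    ∃ C : ℝ≥0, 1 ≤ C ∧ ∃ ε : ℝ≥0, 0 < ε ∧ ∀ (D : Set X) (x y : X) (r : ℝ) (a : ℝ≥0∞), 0 < r →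
      4 * r ≤ dist y x → ENNReal.ofReal r * a ≤ ε * μ (ball x r) →
      vcap1 μ D (ball x (2 * r)) < a → Cov μ (τ * r) D (C * a) := by
  have hLF := hX.isLocallyFinite
  have hlam := hX.hlam
  set δ : ℝ := min (1 / (4 * lam)) (τ / (48 * lam)) with hδ
  have hδ0 : 0 < δ := lt_min (by positivity) (by positivity)
  have hδ1 : 4 * lam * δ ≤ 1 := by
    have h1 : δ ≤ 1 / (4 * lam) := min_le_left _ _
    rw [le_div_iff₀ (by positivity)] at h1
    linarith
  have hδ2 : 48 * lam * δ ≤ τ := by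
    have h1 : δ ≤ τ / (48 * lam) := min_le_right _ _
    rw [le_div_iff₀ (by positivity)] at h1
    linarith
  obtain ⟨C₁, hC₁⟩ := hX.small_set
  obtain ⟨C₂, hC₂1, hC₂⟩ := hX.density_transfer hδ0
  obtain ⟨C₃, hC₃1, hC₃⟩ := hX.boxing (γ := 1 / 2) (by norm_num) le_rfl
  refine ⟨2 * C₃, by linarith, 1 / (4 * (C₁ + 1) * C₂), by positivity, ?_⟩
  intro D x y r a hr hy ha hcap
  set ε : ℝ≥0 := 1 / (4 * (C₁ + 1) * C₂) with hε
  obtain ⟨O, w, hO, hDO, hOB, hw, hwtv⟩ := exists_open_of_vcap1_lt hr hcap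
  have hat : a ≠ ⊤ := by
    rintro rfl
    rw [ENNReal.mul_top (by simpa using hr)] at ha
    exact (ENNReal.mul_ne_top ENNReal.coe_ne_top (hX.ball_ne_top x r)) (top_le_iff.mp ha)
  obtain ⟨E, hE, hOE, hEB, hmin⟩ := exists_least_perimeter measurableSet_ball hO.measurableSet hOB
    (hX.ball_ne_top x (2 * r)) hw
    ((hwtv.trans_lt (ENNReal.mul_lt_top (by simp) hat.lt_top)).ne)
  have hP : tv μ (chi E) univ ≤ 2 * a := (hmin w hw).trans hwtv
  have hμE : μ E ≤ (2 * C₁ * ε : ℝ≥0) * μ (ball x r) := by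
    calc μ E ≤ C₁ * ENNReal.ofReal r * tv μ (chi E) univ := hC₁ x y r hr hy E hE hEB
      _ ≤ C₁ * ENNReal.ofReal r * (2 * a) := mul_le_mul_right hP _
      _ = 2 * C₁ * (ENNReal.ofReal r * a) := by ring
      _ ≤ 2 * C₁ * (ε * μ (ball x r)) := mul_le_mul_right ha _
      _ = _ := by push_cast; ring
  have hsmall : C₂ * (2 * C₁ * ε) ≤ 1 / 2 := by
    have : C₂ * (2 * C₁ * ε) = C₁ / (2 * (C₁ + 1)) := by
      rw [hε]; field_simp; ring
    rw [this, div_le_div_iff₀ (by positivity) (by positivity)]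
    nlinarith [zero_le (a := C₁)]
  have hbox := hC₃ E x (2 * r) δ hE (by positivity) hδ0 hδ1 fun z hz => by
    refine (hC₂ E x z (2 * r) (4 * r) (2 * C₁ * ε : ℝ≥0) (by positivity) (by linarith)
      (by linarith) (by nlinarith) ?_ hz).trans ?_
    · calc μ (E ∩ ball x (4 * r)) ≤ μ E := measure_mono inter_subset_left
        _ ≤ _ := hμE
        _ ≤ _ := mul_le_mul_right (measure_mono (ball_subset_ball (by linarith))) _
    · refine mul_le_mul_left ?_ _
      exact_mod_cast hsmall
  refine hbox.mono ?_ ?_ ?_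
  · nlinarith
  · intro z hz
    refine ⟨hOB (hDO hz), ?_⟩
    obtain ⟨η, hη, hηO⟩ := Metric.isOpen_iff.mp hO z (hDO hz)
    obtain ⟨j, hj⟩ := exists_pow_lt_of_lt_one (y := (1 / 2 : ℝ)) (x := η / (δ * (2 * r)))
      (by positivity) (by norm_num)
    have hj' : δ * (2 * r) / 2 ^ j < η := by
      rw [lt_div_iff₀ (by positivity)] at hj
      calc δ * (2 * r) / 2 ^ j = (1 / 2) ^ j * (δ * (2 * r)) := by
            rw [one_div, inv_pow]; ring
        _ < η := hj
    have hρ : 0 < δ * (2 * r) / 2 ^ j := by positivity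
    refine ⟨j, ?_⟩
    rw [inter_eq_right.mpr ((ball_subset_ball hj'.le).trans (hηO.trans hOE))]
    calc ((1 / 2 : ℝ≥0) : ℝ≥0∞) * μ (ball z (δ * (2 * r) / 2 ^ j))
        < 1 * μ (ball z (δ * (2 * r) / 2 ^ j)) := by
          refine ENNReal.mul_lt_mul_left (hX.ball_ne_zero z hρ) (hX.ball_ne_top z _) ?_
          norm_num
      _ = _ := one_mul _
  · calc C₃ * tv μ (chi E) (ball x (2 * (2 * r))) ≤ C₃ * (2 * a) :=
          mul_le_mul_right ((tv_mono (subset_univ _)).trans hP) _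
      _ = _ := by push_cast; ring

/-- Thinness in terms of covers, first direction. -/
lemma MMS.cov_of_thin (hX : MMS μ Cd CP lam) {A : Set X} {x : X} (hA : IsThinAt μ A x)
    {τ : ℝ} (hτ : 0 < τ) {ε : ℝ≥0∞} (hε : ε ≠ 0) :
    ∀ᶠ r in 𝓝[>] (0 : ℝ), Cov μ (τ * r) (A ∩ ball x r) (ε * cost μ x r) := by
  obtain ⟨C, hC1, ε₀, hε₀, hC⟩ := hX.cov_of_vcap1 hτ
  obtain ⟨y, hy⟩ : ∃ y, y ≠ x := by
    have := hX.nontrivial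
    exact exists_ne x
  have hC0 : (C : ℝ≥0∞) ≠ 0 := by
    simpa using (zero_lt_one.trans_le hC1).ne'
  set ε₁ : ℝ≥0∞ := min (ε / C) ε₀ with hε₁
  have hε₁0 : 0 < ε₁ := lt_min (ENNReal.div_pos hε (by simp)) (by simpa using hε₀)
  filter_upwards [(tendsto_order.mp hA).2 ε₁ hε₁0, self_mem_nhdsWithin,
    nhdsWithin_le_nhds (Iio_mem_nhds (div_pos (dist_pos.mpr hy) (by norm_num : (0 : ℝ) < 4)))]
    with r h1 hr h3
  have hr' : 0 < r := hr
  have h3' : r < dist y x / 4 := h3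
  have hr0 : ENNReal.ofReal r ≠ 0 := by simpa using hr'
  have hB0 := hX.ball_ne_zero x hr'
  have hBt := hX.ball_ne_top x r
  have hcap : vcap1 μ (A ∩ ball x r) (ball x (2 * r)) < ε₁ * cost μ x r := by
    rw [ENNReal.div_lt_iff (Or.inl hB0) (Or.inl hBt)] at h1
    unfold cost
    rw [← mul_div_assoc, ENNReal.lt_div_iff_mul_lt (Or.inl hr0) (Or.inl ENNReal.ofReal_ne_top)]
    rwa [mul_comm]
  refine (hC _ x y r _ hr' (by linarith) ?_ hcap).mono le_rfl le_rfl ?_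
  · calc ENNReal.ofReal r * (ε₁ * cost μ x r) = ε₁ * μ (ball x r) := by
          unfold cost
          rw [mul_left_comm, ENNReal.mul_div_cancel hr0 ENNReal.ofReal_ne_top]
      _ ≤ _ := mul_le_mul_left (min_le_right _ _) _
  · rw [← mul_assoc]
    refine mul_le_mul_left ?_ _
    calc C * ε₁ ≤ C * (ε / C) := mul_le_mul_right (min_le_left _ _) _
      _ = ε := ENNReal.mul_div_cancel hC0 ENNReal.coe_ne_top

/-- Thinness in terms of covers, second direction. -/
lemma MMS.thin_of_cov (hX : MMS μ Cd CP lam) {S : Set X} {x : X}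
    (h : ∀ ε : ℝ≥0∞, ε ≠ 0 →
      ∀ᶠ r in 𝓝[>] (0 : ℝ), Cov μ (r / 8) (S ∩ ball x r) (ε * cost μ x r)) :
    IsThinAt μ S x := by
  obtain ⟨C, hC1, hC⟩ := hX.vcap1_le_of_cov
  have hC0 : (C : ℝ≥0∞) ≠ 0 := by
    simpa using (zero_lt_one.trans_le hC1).ne'
  refine ENNReal.tendsto_nhds_zero.mpr fun ε hε => ?_
  set ε₁ := min (ε / C) 1 with hε₁
  have hε₁0 : 0 < ε₁ := lt_min (ENNReal.div_pos hε.ne' (by simp)) one_pos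
  have hε₁t : ε₁ ≠ ⊤ := ((min_le_right _ _).trans_lt ENNReal.one_lt_top).ne
  filter_upwards [h ε₁ hε₁0.ne', self_mem_nhdsWithin] with r h1 hr
  have hr' : 0 < r := hr
  have hr0 : ENNReal.ofReal r ≠ 0 := by simpa using hr'
  have hct : cost μ x r ≠ ⊤ := ENNReal.div_ne_top (hX.ball_ne_top x r) hr0
  have h2 := hC _ x r (r / 8) _ (ENNReal.mul_ne_top hε₁t hct) inter_subset_right le_rfl h1
  refine ENNReal.div_le_of_le_mul ?_
  calc ENNReal.ofReal r * vcap1 μ (S ∩ ball x r) (ball x (2 * r))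
      ≤ ENNReal.ofReal r * (C * (ε₁ * cost μ x r)) := mul_le_mul_right h2 _
    _ = C * ε₁ * μ (ball x r) := by
        unfold cost
        rw [← mul_assoc (C : ℝ≥0∞), mul_left_comm,
          ENNReal.mul_div_cancel hr0 ENNReal.ofReal_ne_top]
    _ ≤ ε * μ (ball x r) := by
        refine mul_le_mul_left ?_ _
        calc C * ε₁ ≤ C * (ε / C) := mul_le_mul_right (min_le_left _ _) _
          _ = ε := ENNReal.mul_div_cancel hC0 ENNReal.coe_ne_top

/-- Decay of density and perimeter of an obstacle solution from one scale to a smaller one. -/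
lemma MMS.decay (hX : MMS μ Cd CP lam) : ∃ (κ C : ℝ≥0), 0 < κ ∧ κ ≤ 1 / 2 ∧ 1 ≤ C ∧
    ∀ (G Ω E : Set X), LeastPerim μ G Ω E →
    ∀ (y : X) (s : ℝ) (z : ℕ → X) (ρ : ℕ → ℝ) (θ : ℝ≥0∞), 0 < s → (∀ i, 0 ≤ ρ i) →
    G ∩ ball y (8 * s) ⊆ ⋃ i, ball (z i) (ρ i) → (⋃ i, ball (z i) (2 * ρ i)) ⊆ Ω →
    θ ≤ κ → μ (E ∩ ball y (8 * s)) ≤ θ * μ (ball y (8 * s)) →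
    μ (E ∩ ball y s) ≤ (θ / 2) * μ (ball y s) + C * ENNReal.ofReal s * ∑' i, cost μ (z i) (ρ i) ∧
    ENNReal.ofReal s * tv μ (chi E) (ball y (2 * s)) ≤
      C * θ * μ (ball y s) + C * ENNReal.ofReal s * ∑' i, cost μ (z i) (ρ i) := by
  have hlam := hX.hlam
  obtain ⟨C₁, hC₁1, hC₁⟩ := hX.measure_gain
  obtain ⟨C₀, hC₀1, hC₀⟩ := hX.caccioppoli
  obtain ⟨C₈, hC₈1, hC₈⟩ := hX.exists_doubling 8
  have hC₁0 : 0 < C₁ := zero_lt_one.trans_le hC₁1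
  have hC₈0 : 0 < C₈ := zero_lt_one.trans_le hC₈1
  set δ : ℝ := min (1 / (4 * lam)) (1 / (C₁ * C₈)) with hδ
  have hδ0 : 0 < δ := lt_min (by positivity) (by positivity)
  have hδ1 : 4 * lam * δ ≤ 1 := by
    have h1 : δ ≤ 1 / (4 * lam) := min_le_left _ _
    rw [le_div_iff₀ (by positivity)] at h1
    linarith
  have hδ2 : δ * (C₁ * C₈) ≤ 1 := by
    have h1 : δ ≤ 1 / (C₁ * C₈) := min_le_right _ _
    rwa [le_div_iff₀ (by positivity)] at h1
  have hδ3 : δ ≤ 1 := by nlinarith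
  obtain ⟨C₂, hC₂1, hC₂⟩ := hX.density_transfer hδ0
  have hC₂0 : 0 < C₂ := zero_lt_one.trans_le hC₂1
  refine ⟨1 / (2 * C₂), C₀ * C₁ * C₈, by positivity, ?_, ?_, ?_⟩
  · rw [div_le_div_iff₀ (by positivity) (by positivity)]
    linarith
  · exact one_le_mul (one_le_mul hC₀1 hC₁1) hC₈1
  intro G Ω E h y s z ρ θ hs hρ hG hΩ hθ hE
  set T := ∑' i, cost μ (z i) (ρ i) with hT
  have hcac := hC₀ G Ω E h y (2 * s) z ρ (by positivity) hρ
    (by rwa [show 4 * (2 * s) = 8 * s by ring]) hΩ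
  rw [show 4 * (2 * s) = 8 * s by ring] at hcac
  set P := tv μ (chi E) (ball y (2 * s)) with hP
  have hsP : ENNReal.ofReal s * P ≤ C₈ * (θ / 2) * μ (ball y s) + C₀ * ENNReal.ofReal s * T := by
    calc ENNReal.ofReal s * P
        ≤ ENNReal.ofReal s * (ENNReal.ofReal (1 / (2 * s)) * (θ * (C₈ * μ (ball y s)))
            + C₀ * T) :=
          mul_le_mul_right (hcac.trans (add_le_add_left (mul_le_mul_right (hE.trans
            (mul_le_mul_right (hC₈ y s hs) _)) _) _)) _
      _ = (ENNReal.ofReal s * ENNReal.ofReal (1 / (2 * s))) * (θ * (C₈ * μ (ball y s)))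
            + C₀ * ENNReal.ofReal s * T := by ring
      _ = _ := by
          have : ENNReal.ofReal s * ENNReal.ofReal (1 / (2 * s)) = 2⁻¹ := by
            rw [← ENNReal.ofReal_mul hs.le, show s * (1 / (2 * s)) = 2⁻¹ by field_simp,
              ENNReal.ofReal_inv_of_pos two_pos, ENNReal.ofReal_ofNat]
          rw [this, div_eq_mul_inv]
          ring
  have hC₈' : (C₈ : ℝ≥0∞) * (θ / 2) ≤ (C₀ * C₁ * C₈ : ℝ≥0) * θ := by
    refine mul_le_mul' ?_ ENNReal.half_le_self
    exact_mod_cast le_mul_of_one_le_left' (one_le_mul hC₀1 hC₁1)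
  have hC₀' : (C₀ : ℝ≥0∞) ≤ (C₀ * C₁ * C₈ : ℝ≥0) := by
    have : C₀ ≤ C₀ * C₁ * C₈ := by
      rw [mul_assoc]
      exact le_mul_of_one_le_right' (one_le_mul hC₁1 hC₈1)
    exact_mod_cast this
  refine ⟨?_, ?_⟩
  · have hgain := hC₁ E y s δ h.meas hs hδ0 hδ1 fun w hw => by
      refine (hC₂ E y w s (8 * s) θ hs (by linarith) le_rfl hδ3 hE hw).trans ?_
      refine mul_le_mul_left ?_ _
      calc C₂ * θ ≤ C₂ * (1 / (2 * C₂) : ℝ≥0) := mul_le_mul_right hθ _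
        _ = ((C₂ * (1 / (2 * C₂)) : ℝ≥0) : ℝ≥0∞) := by push_cast; rfl
        _ ≤ _ := by
            refine ENNReal.coe_le_coe.mpr (le_of_eq ?_)
            field_simp
    have hδC : (C₁ : ℝ≥0∞) * ENNReal.ofReal δ * C₈ ≤ 1 := by
      rw [← ENNReal.ofReal_coe_nnreal, ← ENNReal.ofReal_coe_nnreal,
        ← ENNReal.ofReal_mul (by positivity), ← ENNReal.ofReal_mul (by positivity),
        ENNReal.ofReal_le_one]
      linarith
    calc μ (E ∩ ball y s) ≤ C₁ * ENNReal.ofReal (δ * s) * P := hgain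
      _ = C₁ * ENNReal.ofReal δ * (ENNReal.ofReal s * P) := by
          rw [ENNReal.ofReal_mul hδ0.le]; ring
      _ ≤ C₁ * ENNReal.ofReal δ *
          (C₈ * (θ / 2) * μ (ball y s) + C₀ * ENNReal.ofReal s * T) := mul_le_mul_right hsP _
      _ = (C₁ * ENNReal.ofReal δ * C₈) * ((θ / 2) * μ (ball y s)) +
          (C₁ * ENNReal.ofReal δ) * (C₀ * ENNReal.ofReal s * T) := by ring
      _ ≤ 1 * ((θ / 2) * μ (ball y s)) +
          1 * ((C₀ * C₁ * C₈ : ℝ≥0) * ENNReal.ofReal s * T) := by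
          refine add_le_add (mul_le_mul_left hδC _) (mul_le_mul' ?_ ?_)
          · refine le_trans ?_ hδC
            refine le_mul_of_one_le_right' ?_
            exact_mod_cast hC₈1
          · exact mul_le_mul_left (mul_le_mul_left hC₀' _) _
      _ = _ := by rw [one_mul, one_mul]
  · exact hsP.trans (add_le_add (mul_le_mul_left hC₈' _)
      (mul_le_mul_left (mul_le_mul_left hC₀' _) _))

end ThinCover

section Scales

lemma eventually_scale {s : ℝ} (hs : 0 < s) {P : ℕ → Prop} (h : ∀ᶠ k in atTop, P k) :
    ∀ᶠ r in 𝓝[>] (0 : ℝ), ∃ k : ℕ, s / 8 ^ (k + 1) < r ∧ r ≤ s / 8 ^ k ∧ P k := by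
  obtain ⟨J, hJ⟩ := eventually_atTop.mp h
  filter_upwards [self_mem_nhdsWithin,
    nhdsWithin_le_nhds (Iio_mem_nhds (show (0 : ℝ) < s / 8 ^ J by positivity))] with r hr hrJ
  have hr' : 0 < r := hr
  have hrJ' : r < s / 8 ^ J := hrJ
  have hle : s / 8 ^ J ≤ s := div_le_self hs.le (one_le_pow₀ (by norm_num))
  obtain ⟨k, hk1, hk2⟩ := exists_nat_pow_near_of_lt_one (x := r / s) (y := 1 / 8)
    (by positivity) ((div_le_one hs).mpr (hrJ'.le.trans hle)) (by norm_num) (by norm_num)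
  rw [one_div, inv_pow] at hk1 hk2
  have h1 : s / 8 ^ (k + 1) < r := by
    rw [lt_div_iff₀ hs] at hk1
    rwa [div_eq_inv_mul]
  have h2 : r ≤ s / 8 ^ k := by
    rw [div_le_iff₀ hs] at hk2
    rwa [div_eq_inv_mul]
  refine ⟨k, h1, h2, hJ k ?_⟩
  have h3 := h1.trans hrJ'
  rw [div_lt_div_iff_of_pos_left hs (by positivity) (by positivity)] at h3
  have := (pow_lt_pow_iff_right₀ (by norm_num : (1 : ℝ) < 8)).mp h3
  omega

lemma tendsto_of_scales {s : ℝ} (hs : 0 < s) {f : ℝ → ℝ≥0∞} {g : ℕ → ℝ≥0∞} {C : ℝ≥0}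
    (h : ∀ j r, s / 8 ^ (j + 1) < r → r ≤ s / 8 ^ j → f r ≤ C * g j)
    (hg : Tendsto g atTop (𝓝 0)) : Tendsto f (𝓝[>] 0) (𝓝 0) := by
  have h1 : Tendsto (fun j => C * g j) atTop (𝓝 0) := by
    simpa using ENNReal.Tendsto.const_mul hg (Or.inr (ENNReal.coe_ne_top (r := C)))
  refine ENNReal.tendsto_nhds_zero.mpr fun ε hε => ?_
  filter_upwards [eventually_scale hs (ENNReal.tendsto_nhds_zero.mp h1 ε hε)] with r hr
  obtain ⟨k, hk1, hk2, hk3⟩ := hr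
  exact (h k r hk1 hk2).trans hk3

lemma tendsto_zero_of_half_add {t β : ℕ → ℝ≥0∞} (hβ : Tendsto β atTop (𝓝 0))
    (ht : ∀ j, t (j + 1) ≤ t j / 2 + β j) (hfin : ∀ j, t j ≠ ⊤) :
    Tendsto t atTop (𝓝 0) := by
  refine ENNReal.tendsto_nhds_zero.mpr fun ε hε => ?_
  obtain ⟨J, hJ⟩ := eventually_atTop.mp
    (ENNReal.tendsto_nhds_zero.mp hβ (ε / 4) (ENNReal.div_pos hε.ne' (by simp)))
  have key : ∀ n, t (J + n) ≤ t J * 2⁻¹ ^ n + ε / 2 := by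
    intro n
    induction n with
    | zero => simp
    | succ n ih =>
      have h4 : ε / 2 / 2 + ε / 4 = ε / 2 := by
        have : ε / 2 / 2 = ε / 4 := by
          rw [div_eq_mul_inv, div_eq_mul_inv, div_eq_mul_inv, mul_assoc,
            ← ENNReal.mul_inv (by simp) (by simp)]
          norm_num
        rw [← this, ENNReal.add_halves]
      calc t (J + n + 1) ≤ t (J + n) / 2 + β (J + n) := ht _
        _ ≤ (t J * 2⁻¹ ^ n + ε / 2) / 2 + ε / 4 :=
            add_le_add (ENNReal.div_le_div_right ih _) (hJ _ (Nat.le_add_right _ _))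
        _ = t J * 2⁻¹ ^ (n + 1) + (ε / 2 / 2 + ε / 4) := by
            rw [ENNReal.add_div, add_assoc, pow_succ, ← mul_assoc, div_eq_mul_inv (t J * _)]
        _ = _ := by rw [h4]
  have hlim : Tendsto (fun n => t J * 2⁻¹ ^ n) atTop (𝓝 0) := by
    have := ENNReal.Tendsto.const_mul (a := t J)
      (ENNReal.tendsto_pow_atTop_nhds_zero_of_lt_one (r := 2⁻¹) (by simp)) (Or.inr (hfin J))
    simpa using this
  obtain ⟨n₀, hn₀⟩ := eventually_atTop.mp
    (ENNReal.tendsto_nhds_zero.mp hlim (ε / 2) (ENNReal.div_pos hε.ne' (by simp)))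
  filter_upwards [eventually_ge_atTop (J + n₀)] with j hj
  obtain ⟨n, rfl⟩ := Nat.exists_eq_add_of_le (show J ≤ j by omega)
  calc t (J + n) ≤ t J * 2⁻¹ ^ n + ε / 2 := key n
    _ ≤ ε / 2 + ε / 2 := add_le_add_left (hn₀ n (by omega)) _
    _ = ε := ENNReal.add_halves ε

end Scales

section ApproxLimits

variable {X : Type*} [MetricSpace X] [MeasurableSpace X] [BorelSpace X]
  {μ : Measure X} {Cd CP lam : ℝ}

lemma MMS.not_tendsto_univ (hX : MMS μ Cd CP lam) (y : X) :
    ¬ Tendsto (fun r : ℝ => μ (univ ∩ ball y r) / μ (ball y r)) (𝓝[>] 0) (𝓝 0) := by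
  intro h
  have h1 : Tendsto (fun r : ℝ => μ (univ ∩ ball y r) / μ (ball y r)) (𝓝[>] 0) (𝓝 1) := by
    refine tendsto_const_nhds.congr' ?_
    filter_upwards [self_mem_nhdsWithin] with r hr
    rw [univ_inter, ENNReal.div_self (hX.ball_ne_zero y hr) (hX.ball_ne_top y r)]
  exact one_ne_zero (tendsto_nhds_unique h1 h)

lemma upperApprox_chi_le {E : Set X} {y : X}
    (h : Tendsto (fun r : ℝ => μ (E ∩ ball y r) / μ (ball y r)) (𝓝[>] 0) (𝓝 0)) :
    upperApprox μ (chi E) y ≤ 0 := by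
  refine sInf_le ⟨0, ?_, by simp⟩
  have h1 : {w | (0 : ℝ) < chi E w} = E := by
    ext w
    by_cases hw : w ∈ E <;> simp [chi, hw]
  show Tendsto (fun r : ℝ => μ ({w | (0 : ℝ) < chi E w} ∩ ball y r) / μ (ball y r)) _ _
  rwa [h1]

lemma MMS.upperApprox_chi_eq (hX : MMS μ Cd CP lam) {E : Set X} {y : X}
    (h : Tendsto (fun r : ℝ => μ (E ∩ ball y r) / μ (ball y r)) (𝓝[>] 0) (𝓝 0)) :
    upperApprox μ (chi E) y = 0 := by
  refine le_antisymm (upperApprox_chi_le h) (le_sInf ?_)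
  rintro _ ⟨t, ht, rfl⟩
  by_contra hlt
  have hlt' : t < 0 := EReal.coe_lt_coe_iff.mp (not_le.mp hlt)
  refine hX.not_tendsto_univ y ?_
  have h1 : {w | t < chi E w} = univ := by
    ext w
    have : 0 ≤ chi E w := indicator_nonneg (fun _ _ => zero_le_one) w
    simpa using hlt'.trans_le this
  have ht' : Tendsto (fun r : ℝ => μ ({w | t < chi E w} ∩ ball y r) / μ (ball y r))
    (𝓝[>] 0) (𝓝 0) := ht
  rwa [h1] at ht'

lemma MMS.lowerApprox_chi_eq (hX : MMS μ Cd CP lam) {E : Set X} {y : X} (h : E ∈ 𝓝 y) :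
    lowerApprox μ (chi E) y = 1 := by
  refine le_antisymm (sSup_le ?_) (le_sSup ⟨1, ?_, by simp⟩)
  · rintro _ ⟨t, ht, rfl⟩
    by_contra hlt
    have hlt' : 1 < t := EReal.coe_lt_coe_iff.mp (not_le.mp hlt)
    refine hX.not_tendsto_univ y ?_
    have h1 : {w | chi E w < t} = univ := by
      ext w
      have : chi E w ≤ 1 := indicator_le' (fun _ _ => le_rfl) (fun _ _ => zero_le_one) w
      simpa using this.trans_lt hlt'
    have ht' : Tendsto (fun r : ℝ => μ ({w | chi E w < t} ∩ ball y r) / μ (ball y r))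
      (𝓝[>] 0) (𝓝 0) := ht
    rwa [h1] at ht'
  · obtain ⟨ε, hε, hεE⟩ := Metric.mem_nhds_iff.mp h
    show Tendsto (fun r : ℝ => μ ({w | chi E w < 1} ∩ ball y r) / μ (ball y r)) _ _
    refine tendsto_const_nhds.congr' ?_
    filter_upwards [nhdsWithin_le_nhds (Iio_mem_nhds hε)] with r hr
    have h1 : {w | chi E w < 1} ∩ ball y r = ∅ := by
      ext w
      simp only [mem_inter_iff, mem_ofPred_eq, mem_empty_iff_false, iff_false, not_and]
      intro hw hwb
      have : w ∈ E := hεE (ball_subset_ball (le_of_lt hr) hwb)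
      simp [chi, this] at hw
    rw [h1, measure_empty, ENNReal.zero_div]

end ApproxLimits

section NearBalls

variable {X : Type*} [MetricSpace X]

/-- The radii of the balls `ball (z i) (ρ i)` that meet `S`, the others being replaced by `0`. -/
def nearRad (z : ℕ → X) (ρ : ℕ → ℝ) (S : Set X) : ℕ → ℝ :=
  indicator {i | (ball (z i) (ρ i) ∩ S).Nonempty} ρ

lemma nearRad_nonneg {z : ℕ → X} {ρ : ℕ → ℝ} (hρ : ∀ i, 0 ≤ ρ i) (S : Set X) (i : ℕ) :
    0 ≤ nearRad z ρ S i := indicator_nonneg (fun i _ => hρ i) i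

lemma nearRad_le {z : ℕ → X} {ρ : ℕ → ℝ} (hρ : ∀ i, 0 ≤ ρ i) (S : Set X) (i : ℕ) :
    nearRad z ρ S i ≤ ρ i := indicator_le_self' (fun i _ => hρ i) i

lemma nearRad_of_nonempty {z : ℕ → X} {ρ : ℕ → ℝ} {S : Set X} {i : ℕ}
    (h : (ball (z i) (ρ i) ∩ S).Nonempty) : nearRad z ρ S i = ρ i :=
  indicator_of_mem (s := {i | (ball (z i) (ρ i) ∩ S).Nonempty}) h ρ

lemma nearRad_of_not {z : ℕ → X} {ρ : ℕ → ℝ} {S : Set X} {i : ℕ}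
    (h : ¬ (ball (z i) (ρ i) ∩ S).Nonempty) : nearRad z ρ S i = 0 :=
  indicator_of_notMem (s := {i | (ball (z i) (ρ i) ∩ S).Nonempty}) h ρ

lemma subset_iUnion_nearRad (z : ℕ → X) (ρ : ℕ → ℝ) (S : Set X) :
    (⋃ i, ball (z i) (ρ i)) ∩ S ⊆ ⋃ i, ball (z i) (nearRad z ρ S i) := by
  rintro w ⟨hw, hwS⟩
  obtain ⟨i, hi⟩ := mem_iUnion.mp hw
  refine mem_iUnion.mpr ⟨i, ?_⟩
  rwa [nearRad_of_nonempty ⟨w, hi, hwS⟩]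

lemma iUnion_nearRad_subset {z : ℕ → X} {ρ : ℕ → ℝ} (hρ : ∀ i, 0 ≤ ρ i) (S : Set X) :
    (⋃ i, ball (z i) (2 * nearRad z ρ S i)) ⊆ ⋃ i, ball (z i) (2 * ρ i) :=
  iUnion_mono fun i => ball_subset_ball
    (mul_le_mul_of_nonneg_left (nearRad_le hρ S i) zero_le_two)

variable [MeasurableSpace X] [BorelSpace X] {μ : Measure X} {Cd CP lam : ℝ}

/-- The total cost of the balls `ball (z i) (ρ i)` that meet `S`. -/
def nearCost (μ : Measure X) (z : ℕ → X) (ρ : ℕ → ℝ) (S : Set X) : ℝ≥0∞ :=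
  ∑' i, cost μ (z i) (nearRad z ρ S i)

lemma cost_nearRad_le (z : ℕ → X) (ρ : ℕ → ℝ) (S : Set X) (i : ℕ) :
    cost μ (z i) (nearRad z ρ S i) ≤ cost μ (z i) (ρ i) := by
  by_cases h : (ball (z i) (ρ i) ∩ S).Nonempty
  · rw [nearRad_of_nonempty h]
  · rw [nearRad_of_not h, cost_zero]
    exact zero_le

variable [ProperSpace X]

/-- Points outside the enlarged balls that see a positive fraction of the total cost at
arbitrarily small scales. -/
lemma MMS.cov_concentration (hX : MMS μ Cd CP lam) {z : ℕ → X} {ρ : ℕ → ℝ}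
    (hfin : ∑' i, cost μ (z i) (ρ i) ≠ ⊤) {τ : ℝ} (hτ : 0 < τ) (M : ℝ≥0) {ε : ℝ≥0∞}
    (hε : ε ≠ 0) :
    Cov μ τ {y | y ∉ ⋃ i, ball (z i) (4 * ρ i) ∧ ∃ᶠ s in 𝓝[>] (0 : ℝ),
      μ (ball y s) ≤ M * (ENNReal.ofReal s * nearCost μ z ρ (ball y s))} ε := by
  obtain ⟨C, hC1, hC⟩ := hX.cov_of_disjoint 2 one_le_two
  set ε' : ℝ≥0∞ := ε / (C * M) with hε'
  have hε'0 : 0 < ε' := ENNReal.div_pos hε (ENNReal.mul_ne_top (by simp) (by simp))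
  obtain ⟨F, hF⟩ := ((tendsto_order.mp (ENNReal.tendsto_tsum_compl_atTop_zero hfin)).2 ε'
    hε'0).exists
  set N := {y | y ∉ ⋃ i, ball (z i) (4 * ρ i) ∧ ∃ᶠ s in 𝓝[>] (0 : ℝ),
      μ (ball y s) ≤ M * (ENNReal.ofReal s * nearCost μ z ρ (ball y s))} with hN
  have hmeet : ∀ y ∈ N, ∀ i s, (ball (z i) (ρ i) ∩ ball y s).Nonempty →
      0 < ρ i ∧ 3 * ρ i < s ∧ dist (z i) y < ρ i + s := by
    rintro y hy i s ⟨w, hw1, hw2⟩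
    have h1 := mem_ball.mp hw1
    have h2 := mem_ball.mp hw2
    have h3 : ¬ dist y (z i) < 4 * ρ i := fun h => hy.1 (mem_iUnion.mpr ⟨i, h⟩)
    have h4 := dist_triangle y w (z i)
    rw [dist_comm y w] at h4
    refine ⟨dist_nonneg.trans_lt h1, by linarith, ?_⟩
    rw [dist_comm]; linarith
  have hex : ∀ y : X, ∃ s : ℝ, y ∈ N → 0 < s ∧ s ≤ τ / 12 ∧ (∀ i ∈ F, 0 < ρ i → s < 3 * ρ i) ∧
      μ (ball y s) ≤ M * (ENNReal.ofReal s * nearCost μ z ρ (ball y s)) := by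
    intro y
    by_cases hy : y ∈ N
    swap
    · exact ⟨0, fun h => absurd h hy⟩
    have h1 : ∀ᶠ s in 𝓝[>] (0 : ℝ), ∀ i ∈ F, 0 < ρ i → s < 3 * ρ i := by
      rw [Filter.eventually_all_finset]
      intro i _
      by_cases hi : 0 < ρ i
      · filter_upwards [nhdsWithin_le_nhds (Iio_mem_nhds (show 0 < 3 * ρ i by positivity))]
          with s hs _ using hs
      · exact Eventually.of_forall fun _ h => absurd h hi
    obtain ⟨s, hs, ⟨hs1, hs2⟩, hs3⟩ := (hy.2.and_eventually ((h1.and (nhdsWithin_le_nhds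
      (Iio_mem_nhds (show 0 < τ / 12 by positivity)))).and self_mem_nhdsWithin)).exists
    exact ⟨s, fun _ => ⟨hs3, le_of_lt hs2, hs1, hs⟩⟩
  choose σ hσ using hex
  have hcov := hC N σ (τ / 12) (M * ε') (by positivity) (fun y hy => ⟨(hσ y hy).1, (hσ y hy).2.1⟩) ?_
  · refine hcov.mono (by linarith) le_rfl ?_
    rw [← mul_assoc]
    exact ENNReal.mul_div_le
  intro T hTN _ hTd
  calc ∑' y : T, cost μ (y : X) (σ y)
      ≤ ∑' y : T, M * nearCost μ z ρ (ball (y : X) (σ y)) := by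
        refine ENNReal.tsum_le_tsum fun y => ENNReal.div_le_of_le_mul ?_
        refine (hσ y (hTN y.2)).2.2.2.trans_eq ?_
        ring
    _ = M * ∑' i, ∑' y : T, cost μ (z i) (nearRad z ρ (ball (y : X) (σ y)) i) := by
        rw [ENNReal.tsum_mul_left, ENNReal.tsum_comm]; rfl
    _ ≤ M * ∑' i, indicator {i | i ∉ F} (fun i => cost μ (z i) (ρ i)) i := by
        refine mul_le_mul_right (ENNReal.tsum_le_tsum fun i => ?_) _
        by_cases hne : ∃ y : T, (ball (z i) (ρ i) ∩ ball (y : X) (σ y)).Nonempty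
        swap
        · push Not at hne
          have h0 : ∀ y : T, cost μ (z i) (nearRad z ρ (ball (y : X) (σ y)) i) = 0 := fun y => by
            rw [nearRad_of_not (not_nonempty_iff_eq_empty.mpr (hne y)), cost_zero]
          simp only [h0, tsum_zero]
          exact zero_le
        obtain ⟨y₀, hy₀⟩ := hne
        rw [tsum_eq_single y₀]
        · have hm := hmeet y₀ (hTN y₀.2) i _ hy₀
          have hiF : i ∉ F := fun hi => by
            linarith [(hσ y₀ (hTN y₀.2)).2.2.1 i hi hm.1, hm.2.1]
          rw [indicator_of_mem (s := {i | i ∉ F}) hiF]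
          exact cost_nearRad_le z ρ _ i
        · intro y hy
          rw [nearRad_of_not, cost_zero]
          intro hne
          have hm := hmeet y (hTN y.2) i _ hne
          have hm₀ := hmeet y₀ (hTN y₀.2) i _ hy₀
          have hd := hTd y.2 y₀.2 (fun h => hy (Subtype.ext h))
          have h1 : z i ∈ ball (y : X) (2 * σ y) :=
            mem_ball.mpr (by linarith [hm.2.1, hm.2.2, hm.1])
          have h2 : z i ∈ ball (y₀ : X) (2 * σ y₀) :=
            mem_ball.mpr (by linarith [hm₀.2.1, hm₀.2.2, hm₀.1])
          exact Set.disjoint_left.mp hd h1 h2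
    _ ≤ M * ε' := by
        refine mul_le_mul_right ?_ _
        rw [← tsum_subtype]
        exact hF.le

/-- Outside the enlarged balls, the cost of the balls meeting small balls around a point is
negligible, except on a set that can be covered at arbitrarily small cost. -/
lemma MMS.cov_not_tendsto (hX : MMS μ Cd CP lam) {z : ℕ → X} {ρ : ℕ → ℝ}
    (hfin : ∑' i, cost μ (z i) (ρ i) ≠ ⊤) {τ : ℝ} (hτ : 0 < τ) {ε : ℝ≥0∞} (hε : ε ≠ 0) :
    Cov μ τ {y | y ∉ ⋃ i, ball (z i) (4 * ρ i) ∧ ¬ Tendsto (fun s : ℝ =>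
      ENNReal.ofReal s * nearCost μ z ρ (ball y s) / μ (ball y s)) (𝓝[>] 0) (𝓝 0)} ε := by
  have := hX.nontrivial.to_nonempty
  refine (Cov.iUnion_zero hτ.le (fun (m : ℕ) ε hε => hX.cov_concentration hfin hτ (m : ℝ≥0) hε)
    hε).mono le_rfl ?_ le_rfl
  rintro y ⟨hy1, hy2⟩
  rw [ENNReal.tendsto_nhds_zero] at hy2
  push Not at hy2
  obtain ⟨η, hη, hfreq⟩ := hy2
  obtain ⟨m, hm⟩ := ENNReal.exists_inv_nat_lt hη.ne'
  refine mem_iUnion.mpr ⟨m, hy1, ?_⟩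
  refine (hfreq.and_eventually self_mem_nhdsWithin).mono ?_
  rintro s ⟨hs1, hs⟩
  have hm0 : (m : ℝ≥0∞) ≠ 0 := by
    rintro h
    rw [h, ENNReal.inv_zero] at hm
    exact not_top_lt hm
  have h1 := hm.trans hs1
  rw [ENNReal.lt_div_iff_mul_lt (Or.inl (hX.ball_ne_zero y hs)) (Or.inl (hX.ball_ne_top y s))] at h1
  calc μ (ball y s) = m * ((m : ℝ≥0∞)⁻¹ * μ (ball y s)) := by
        rw [← mul_assoc, ENNReal.mul_inv_cancel hm0 (by simp), one_mul]
    _ ≤ _ := by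
        push_cast
        exact mul_le_mul_right h1.le _

end NearBalls

section Decay

variable {X : Type*} [MetricSpace X] [MeasurableSpace X] [BorelSpace X] [ProperSpace X]
  {μ : Measure X} {Cd CP lam : ℝ}

/-- The density of `E` in `ball y s`. -/
def dens (μ : Measure X) (E : Set X) (y : X) (s : ℝ) : ℝ≥0∞ := μ (E ∩ ball y s) / μ (ball y s)

/-- The constants `κ` and `C` control the decay of obstacle solutions between two scales. -/
def DecayConst (μ : Measure X) (κ C : ℝ≥0) : Prop :=
  ∀ (G Ω E : Set X), LeastPerim μ G Ω E →
    ∀ (y : X) (s : ℝ) (z : ℕ → X) (ρ : ℕ → ℝ), 0 < s → (∀ i, 0 ≤ ρ i) →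
    G ∩ ball y (8 * s) ⊆ ⋃ i, ball (z i) (ρ i) → (⋃ i, ball (z i) (2 * ρ i)) ⊆ Ω →
    dens μ E y (8 * s) ≤ κ →
    dens μ E y s ≤ dens μ E y (8 * s) / 2 +
      C * (ENNReal.ofReal s * (∑' i, cost μ (z i) (ρ i)) / μ (ball y s)) ∧
    ENNReal.ofReal s * tv μ (chi E) (ball y (2 * s)) / μ (ball y s) ≤
      C * dens μ E y (8 * s) +
        C * (ENNReal.ofReal s * (∑' i, cost μ (z i) (ρ i)) / μ (ball y s))

lemma MMS.exists_decayConst (hX : MMS μ Cd CP lam) :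
    ∃ κ C : ℝ≥0, 0 < κ ∧ κ ≤ 1 / 2 ∧ 1 ≤ C ∧ DecayConst μ κ C := by
  obtain ⟨κ, C, hκ0, hκ1, hC1, h⟩ := hX.decay
  refine ⟨κ, C, hκ0, hκ1, hC1, fun G Ω E hE y s z ρ hs hρ hG hΩ hd => ?_⟩
  have hB0 := hX.ball_ne_zero y hs
  have hBt := hX.ball_ne_top y s
  have h8 : μ (E ∩ ball y (8 * s)) ≤ dens μ E y (8 * s) * μ (ball y (8 * s)) := by
    unfold dens
    rw [ENNReal.div_mul_cancel (hX.ball_ne_zero y (by positivity)) (hX.ball_ne_top y _)]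
  obtain ⟨h1, h2⟩ := h G Ω E hE y s z ρ _ hs hρ hG hΩ hd h8
  have hmul : C * (ENNReal.ofReal s * (∑' i, cost μ (z i) (ρ i)) / μ (ball y s)) * μ (ball y s) =
      C * ENNReal.ofReal s * ∑' i, cost μ (z i) (ρ i) := by
    rw [mul_assoc, ENNReal.div_mul_cancel hB0 hBt, mul_assoc]
  constructor
  · refine ENNReal.div_le_of_le_mul ?_
    rwa [add_mul, hmul]
  · refine ENNReal.div_le_of_le_mul ?_
    rwa [add_mul, hmul]

lemma DecayConst.tendsto (hX : MMS μ Cd CP lam) {κ C : ℝ≥0} (hd : DecayConst μ κ C)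
    {G Ω E : Set X} (hE : LeastPerim μ G Ω E) {y : X} {s : ℝ} (hs : 0 < s) {z : ℕ → ℕ → X}
    {ρ : ℕ → ℕ → ℝ} (hρ : ∀ j i, 0 ≤ ρ j i)
    (hG : ∀ j, G ∩ ball y (s / 8 ^ j) ⊆ ⋃ i, ball (z j i) (ρ j i))
    (hΩ : ∀ j, (⋃ i, ball (z j i) (2 * ρ j i)) ⊆ Ω)
    (hβ : Tendsto (fun j => ENNReal.ofReal (s / 8 ^ (j + 1)) * (∑' i, cost μ (z j i) (ρ j i)) /
      μ (ball y (s / 8 ^ (j + 1)))) atTop (𝓝 0))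
    (hκ : ∀ j, dens μ E y (s / 8 ^ j) ≤ κ) :
    Tendsto (dens μ E y) (𝓝[>] 0) (𝓝 0) ∧
    Tendsto (fun r => ENNReal.ofReal r * tv μ (chi E) (ball y r) / μ (ball y r))
      (𝓝[>] 0) (𝓝 0) := by
  obtain ⟨C₈, hC₈1, hC₈⟩ := hX.exists_doubling 8
  have h8 : ∀ j : ℕ, 8 * (s / 8 ^ (j + 1)) = s / 8 ^ j := fun j => by
    rw [pow_succ]; field_simp
  have hstep := fun j => hd G Ω E hE y (s / 8 ^ (j + 1)) (z j) (ρ j) (by positivity) (hρ j)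
    (by rw [h8]; exact hG j) (hΩ j) (by rw [h8]; exact hκ j)
  simp only [h8] at hstep
  have hCβ := ENNReal.Tendsto.const_mul (a := (C : ℝ≥0∞)) hβ (Or.inr ENNReal.coe_ne_top)
  rw [mul_zero] at hCβ
  have hθ : Tendsto (fun j : ℕ => dens μ E y (s / 8 ^ j)) atTop (𝓝 0) :=
    tendsto_zero_of_half_add hCβ (fun j => (hstep j).1)
      fun j => ((hκ j).trans_lt ENNReal.coe_lt_top).ne
  have hdoub : ∀ (j : ℕ) r, s / 8 ^ (j + 1) < r → μ (ball y (s / 8 ^ j)) ≤ C₈ * μ (ball y r) := by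
    intro j r hr
    rw [← h8]
    exact (hC₈ y _ (by positivity)).trans (mul_le_mul_right (measure_mono
      (ball_subset_ball hr.le)) _)
  constructor
  · refine tendsto_of_scales hs (C := C₈) (fun j r hr1 hr2 => ?_) hθ
    have hr : 0 < r := lt_trans (by positivity) hr1
    refine ENNReal.div_le_of_le_mul ?_
    calc μ (E ∩ ball y r) ≤ μ (E ∩ ball y (s / 8 ^ j)) :=
          measure_mono (inter_subset_inter_right _ (ball_subset_ball hr2))
      _ = dens μ E y (s / 8 ^ j) * μ (ball y (s / 8 ^ j)) := by
          unfold dens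
          rw [ENNReal.div_mul_cancel (hX.ball_ne_zero y (by positivity)) (hX.ball_ne_top y _)]
      _ ≤ dens μ E y (s / 8 ^ j) * (C₈ * μ (ball y r)) := mul_le_mul_right (hdoub j r hr1) _
      _ = _ := by ring
  · have hπ : Tendsto (fun j : ℕ => ENNReal.ofReal (s / 8 ^ (j + 1)) *
        tv μ (chi E) (ball y (2 * (s / 8 ^ (j + 1)))) / μ (ball y (s / 8 ^ (j + 1))))
        atTop (𝓝 0) := by
      have h1 := (ENNReal.Tendsto.const_mul (a := (C : ℝ≥0∞)) hθ
        (Or.inr ENNReal.coe_ne_top)).add hCβ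
      rw [mul_zero, add_zero] at h1
      exact tendsto_of_tendsto_of_tendsto_of_le_of_le tendsto_const_nhds h1
        (fun _ => zero_le) fun j => (hstep j).2
    refine tendsto_of_scales (s := s / 8) (by positivity) (C := C₈) (fun j r hr1 hr2 => ?_) hπ
    have h88 : ∀ j : ℕ, s / 8 / 8 ^ j = s / 8 ^ (j + 1) := fun j => by
      rw [pow_succ]; field_simp
    rw [h88] at hr1 hr2
    have hr : 0 < r := lt_trans (by positivity) hr1
    have hB0 := hX.ball_ne_zero y hr
    have hpos : 0 < s / 8 ^ (j + 1) := by positivity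
    refine ENNReal.div_le_of_le_mul ?_
    calc ENNReal.ofReal r * tv μ (chi E) (ball y r)
        ≤ ENNReal.ofReal (s / 8 ^ (j + 1)) * tv μ (chi E) (ball y (2 * (s / 8 ^ (j + 1)))) :=
          mul_le_mul' (ENNReal.ofReal_le_ofReal hr2) (tv_mono (ball_subset_ball (by linarith)))
      _ = (ENNReal.ofReal (s / 8 ^ (j + 1)) * tv μ (chi E) (ball y (2 * (s / 8 ^ (j + 1)))) /
            μ (ball y (s / 8 ^ (j + 1)))) * μ (ball y (s / 8 ^ (j + 1))) := by
          rw [ENNReal.div_mul_cancel (hX.ball_ne_zero y hpos) (hX.ball_ne_top y _)]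
      _ ≤ (ENNReal.ofReal (s / 8 ^ (j + 1)) * tv μ (chi E) (ball y (2 * (s / 8 ^ (j + 1)))) /
            μ (ball y (s / 8 ^ (j + 1)))) * (C₈ * μ (ball y r)) :=
          mul_le_mul_right (hdoub (j + 1) r hr1) _
      _ = _ := by ring

end Decay

section Covers

variable {X : Type*} [MetricSpace X] [MeasurableSpace X] [BorelSpace X] [ProperSpace X]
  {μ : Measure X} {Cd CP lam : ℝ}

lemma exists_rate {P : ℕ → ℝ≥0∞ → Prop} {η : ℝ≥0} (hP : ∀ k, P k η)
    (h : ∀ ε : ℝ≥0∞, ε ≠ 0 → ∀ᶠ k in atTop, P k ε) (hη : 0 < η) :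
    ∃ e : ℕ → ℝ≥0∞, Tendsto e atTop (𝓝 0) ∧ ∀ k, e k ≤ η ∧ P k (e k) := by
  classical
  set n : ℕ → ℕ := fun k => Nat.findGreatest (fun n => P k (η * 2⁻¹ ^ n)) k with hn
  refine ⟨fun k => η * 2⁻¹ ^ n k, ?_, fun k => ⟨?_, ?_⟩⟩
  · have hn' : Tendsto n atTop atTop := by
      refine tendsto_atTop.mpr fun m => ?_
      filter_upwards [h (η * 2⁻¹ ^ m) (by simp [hη.ne']), eventually_ge_atTop m] with k hk hmk
      exact Nat.le_findGreatest hmk hk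
    have := ENNReal.Tendsto.const_mul (a := (η : ℝ≥0∞))
      ((ENNReal.tendsto_pow_atTop_nhds_zero_of_lt_one (r := 2⁻¹) (by simp)).comp hn')
      (Or.inr ENNReal.coe_ne_top)
    simpa using this
  · exact mul_le_of_le_one_right' (pow_le_one₀ zero_le (by simp))
  · exact Nat.findGreatest_spec (P := fun n => P k (η * 2⁻¹ ^ n)) (m := 0) (Nat.zero_le _)
      (by simpa using hP k)

/-- A sequence of covers of a thin set at all dyadic scales. -/
structure ThinCovers (μ : Measure X) (A : Set X) (x : X) (R : ℝ) (η : ℝ≥0) (z : ℕ → ℕ → X)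
    (ρ : ℕ → ℕ → ℝ) (e : ℕ → ℝ≥0∞) : Prop where
  pos : 0 < R
  nonneg : ∀ k i, 0 ≤ ρ k i
  le : ∀ k i, ρ k i ≤ R / 8 ^ k / 512
  cover : ∀ k, A ∩ closedBall x (R / 8 ^ k) ⊆ ⋃ i, ball (z k i) (ρ k i)
  dom : ∀ k, (⋃ i, ball (z k i) (2 * ρ k i)) ⊆ ball x (2 * R)
  cost_le : ∀ k, ∑' i, cost μ (z k i) (ρ k i) ≤ e k * cost μ x (R / 8 ^ k)
  rate_le : ∀ k, e k ≤ η
  tendsto : Tendsto e atTop (𝓝 0)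

lemma MMS.exists_thinCovers (hX : MMS μ Cd CP lam) {A : Set X} {x : X} (hA : IsThinAt μ A x)
    {R₀ : ℝ} (hR₀ : 0 < R₀) {η : ℝ≥0} (hη : 0 < η) :
    ∃ R ≤ R₀, ∃ z ρ e, ThinCovers μ A x R η z ρ e := by
  obtain ⟨C, hC1, hC⟩ := hX.cost_mul_le 2 one_le_two
  have hC0 : (C : ℝ≥0∞) ≠ 0 := by
    simpa using (zero_lt_one.trans_le hC1).ne'
  have hev : ∀ ε : ℝ≥0∞, ε ≠ 0 → ∀ᶠ r in 𝓝[>] (0 : ℝ),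
      Cov μ (r / 512) (A ∩ closedBall x r) (ε * cost μ x r) := by
    intro ε hε
    have h2 : Tendsto (fun r : ℝ => 2 * r) (𝓝[>] 0) (𝓝[>] 0) := by
      refine tendsto_nhdsWithin_iff.mpr ⟨?_, ?_⟩
      · have : Tendsto (fun r : ℝ => 2 * r) (𝓝 0) (𝓝 (2 * 0)) :=
          tendsto_id.const_mul 2
        rw [mul_zero] at this
        exact this.mono_left nhdsWithin_le_nhds
      · filter_upwards [self_mem_nhdsWithin] with r hr
        have hr' : 0 < r := hr
        show 0 < 2 * r
        positivity
    filter_upwards [h2.eventually (hX.cov_of_thin hA (τ := 1 / 1024) (by norm_num)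
      (ε := ε / C) (ENNReal.div_ne_zero.mpr ⟨hε, ENNReal.coe_ne_top⟩)), self_mem_nhdsWithin]
      with r hr hr0
    have hr0' : 0 < r := hr0
    refine hr.mono (by linarith) ?_ ?_
    · exact inter_subset_inter_right _ (closedBall_subset_ball (by linarith))
    · calc ε / C * cost μ x (2 * r) ≤ ε / C * (C * cost μ x r) :=
            mul_le_mul_right (hC x r hr0'.le).2 _
        _ = _ := by rw [← mul_assoc, ENNReal.div_mul_cancel hC0 ENNReal.coe_ne_top]
  obtain ⟨R₁, hR₁, hR₁'⟩ := mem_nhdsGT_iff_exists_Ioo_subset.mp (hev η (by simpa using hη.ne'))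
  have hR₁0 : 0 < R₁ := hR₁
  set R := min R₀ (R₁ / 2) with hR
  have hR0 : 0 < R := lt_min hR₀ (by positivity)
  have hRR₁ : R < R₁ := (min_le_right _ _).trans_lt (by linarith)
  have hrk : ∀ k : ℕ, R / 8 ^ k ≤ R := fun k => div_le_self hR0.le (one_le_pow₀ (by norm_num))
  have hscale : Tendsto (fun k : ℕ => R / 8 ^ k) atTop (𝓝[>] 0) := by
    refine tendsto_nhdsWithin_iff.mpr ⟨?_, Eventually.of_forall fun k => ?_⟩
    · exact tendsto_const_nhds.div_atTop (tendsto_pow_atTop_atTop_of_one_lt (by norm_num))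
    · show 0 < R / 8 ^ k
      positivity
  obtain ⟨e, he0, he⟩ := exists_rate (P := fun k ε => Cov μ (R / 8 ^ k / 512)
      (A ∩ closedBall x (R / 8 ^ k)) (ε * cost μ x (R / 8 ^ k)))
    (fun k => hR₁' ⟨by positivity, (hrk k).trans_lt hRR₁⟩) (fun ε hε => hscale.eventually (hev ε hε)) hη
  have he2 := fun k => (he k).2
  choose z ρ hρ hcov hcost using he2
  refine ⟨R, min_le_left _ _, z, fun k => nearRad (z k) (ρ k) (closedBall x (R / 8 ^ k)), e, hR0,
    ?_, ?_, ?_, ?_, ?_, fun k => (he k).1, he0⟩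
  · exact fun k i => nearRad_nonneg (fun i => (hρ k i).1) _ i
  · exact fun k i => (nearRad_le (fun i => (hρ k i).1) _ i).trans (hρ k i).2
  · exact fun k => (subset_inter (hcov k) inter_subset_right).trans (subset_iUnion_nearRad _ _ _)
  · intro k
    refine iUnion_subset fun i => ?_
    by_cases hne : (ball (z k i) (ρ k i) ∩ closedBall x (R / 8 ^ k)).Nonempty
    · rw [nearRad_of_nonempty hne]
      obtain ⟨w, hw1, hw2⟩ := hne
      intro v hv
      have h1 := mem_ball.mp hw1
      have h2 := mem_closedBall.mp hw2
      have h3 := mem_ball.mp hv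
      have h4 := (hρ k i).2
      have h5 := hrk k
      have h6 := dist_triangle4 v (z k i) w x
      rw [dist_comm (z k i) w] at h6
      exact mem_ball.mpr (by linarith)
    · rw [nearRad_of_not hne, mul_zero, ball_zero]
      exact empty_subset _
  · exact fun k => (ENNReal.tsum_le_tsum fun i => cost_nearRad_le _ _ _ i).trans (hcost k)

/-- The obstacle determined by a sequence of covers. -/
def obstacle (x : X) (R : ℝ) (z : ℕ → ℕ → X) (ρ : ℕ → ℕ → ℝ) : Set X :=
  {w | w ≠ x ∧ dist w x < R ∧ ∀ k : ℕ, dist w x ≤ R / 8 ^ k → w ∈ ⋃ i, ball (z k i) (ρ k i)}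

lemma isOpen_obstacle (x : X) (R : ℝ) (z : ℕ → ℕ → X) (ρ : ℕ → ℕ → ℝ) :
    IsOpen (obstacle x R z ρ) := by
  refine isOpen_iff_mem_nhds.mpr ?_
  rintro w ⟨hwx, hwR, hw⟩
  have hpos : 0 < dist w x := dist_pos.mpr hwx
  obtain ⟨n, hn⟩ : ∃ n : ℕ, ∀ k ≥ n, R / 8 ^ k < dist w x / 2 := by
    have h1 : Tendsto (fun k : ℕ => R / 8 ^ k) atTop (𝓝 0) :=
      tendsto_const_nhds.div_atTop (tendsto_pow_atTop_atTop_of_one_lt (by norm_num))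
    exact eventually_atTop.mp ((tendsto_order.mp h1).2 _ (by positivity))
  have hc : ContinuousAt (fun v => dist v x) w := (continuous_id.dist continuous_const).continuousAt
  have h2 : ∀ᶠ v in 𝓝 w, ∀ k ∈ Finset.range n, dist v x ≤ R / 8 ^ k →
      v ∈ ⋃ i, ball (z k i) (ρ k i) := by
    rw [Filter.eventually_all_finset]
    intro k _
    by_cases hk : dist w x ≤ R / 8 ^ k
    · filter_upwards [(isOpen_iUnion fun i => isOpen_ball).mem_nhds (hw k hk)] with v hv _ using hv
    · filter_upwards [hc.eventually (lt_mem_nhds (not_le.mp hk))] with v hv hv'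
      exact absurd hv' (not_le.mpr hv)
  filter_upwards [h2, hc.eventually (gt_mem_nhds hwR),
    hc.eventually (lt_mem_nhds (show dist w x / 2 < dist w x by linarith))] with v hv1 hv2 hv3
  refine ⟨fun h => ?_, hv2, fun k hk => ?_⟩
  · rw [h, dist_self] at hv3
    linarith
  · by_cases hkn : k < n
    · exact hv1 k (Finset.mem_range.mpr hkn) hk
    · linarith [hn k (not_lt.mp hkn)]

lemma ThinCovers.subset_obstacle {A : Set X} {x : X} {R : ℝ} {η : ℝ≥0} {z : ℕ → ℕ → X}
    {ρ : ℕ → ℕ → ℝ} {e : ℕ → ℝ≥0∞} (h : ThinCovers μ A x R η z ρ e) (hx : x ∉ A) :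
    A ∩ ball x R ⊆ obstacle x R z ρ := fun _ hw =>
  ⟨fun heq => hx (heq ▸ hw.1), hw.2, fun k hk => h.cover k ⟨hw.1, hk⟩⟩

end Covers

section Construction

variable {X : Type*} [MetricSpace X] [MeasurableSpace X] [BorelSpace X] [ProperSpace X]
  {μ : Measure X} {Cd CP lam : ℝ} {A : Set X} {x : X} {R : ℝ} {η : ℝ≥0} {z : ℕ → ℕ → X}
  {ρ : ℕ → ℕ → ℝ} {e : ℕ → ℝ≥0∞}

lemma MMS.cost_ne_zero (hX : MMS μ Cd CP lam) (y : X) {r : ℝ} (hr : 0 < r) : cost μ y r ≠ 0 :=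
  ENNReal.div_ne_zero.mpr ⟨hX.ball_ne_zero y hr, ENNReal.ofReal_ne_top⟩

lemma MMS.cost_ne_top (hX : MMS μ Cd CP lam) (y : X) {r : ℝ} (hr : 0 < r) : cost μ y r ≠ ⊤ :=
  ENNReal.div_ne_top (hX.ball_ne_top y r) (by simpa using hr)

lemma ThinCovers.cost_ne_top (h : ThinCovers μ A x R η z ρ e) (hX : MMS μ Cd CP lam) (k : ℕ) :
    ∑' i, cost μ (z k i) (ρ k i) ≠ ⊤ := by
  have hR := h.pos
  exact ne_top_of_le_ne_top (ENNReal.mul_ne_top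
    (ne_top_of_le_ne_top ENNReal.coe_ne_top (h.rate_le k))
    (hX.cost_ne_top x (by positivity))) (h.cost_le k)

lemma ThinCovers.rate (h : ThinCovers μ A x R η z ρ e) {C₈ : ℝ≥0}
    (hC₈ : ∀ (y : X) (r : ℝ), 0 < r → μ (ball y (8 * r)) ≤ C₈ * μ (ball y r)) (j : ℕ) :
    ENNReal.ofReal (R / 8 ^ (j + 1)) * (∑' i, cost μ (z j i) (ρ j i)) /
      μ (ball x (R / 8 ^ (j + 1))) ≤ C₈ * e j := by
  have hR := h.pos
  have hr : 0 < R / 8 ^ (j + 1) := by positivity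
  have h8 : R / 8 ^ j = 8 * (R / 8 ^ (j + 1)) := by rw [pow_succ]; field_simp
  refine ENNReal.div_le_of_le_mul ?_
  calc ENNReal.ofReal (R / 8 ^ (j + 1)) * (∑' i, cost μ (z j i) (ρ j i))
      ≤ ENNReal.ofReal (R / 8 ^ j) * (e j * cost μ x (R / 8 ^ j)) :=
        mul_le_mul' (ENNReal.ofReal_le_ofReal (by linarith)) (h.cost_le j)
    _ = e j * μ (ball x (R / 8 ^ j)) := by
        unfold cost
        rw [mul_left_comm, ENNReal.mul_div_cancel (by simp; positivity) ENNReal.ofReal_ne_top]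
    _ ≤ e j * (C₈ * μ (ball x (R / 8 ^ (j + 1)))) := by
        refine mul_le_mul_right ?_ _
        rw [h8]
        exact hC₈ x _ hr
    _ = _ := by ring

lemma MMS.exists_leastPerim (hX : MMS μ Cd CP lam) : ∃ C : ℝ≥0,
    ∀ (A : Set X) (x y : X) (R : ℝ) (η : ℝ≥0) (z : ℕ → ℕ → X) (ρ : ℕ → ℕ → ℝ) (e : ℕ → ℝ≥0∞),
      ThinCovers μ A x R η z ρ e → 4 * R ≤ dist y x →
      ∃ E, LeastPerim μ (obstacle x R z ρ) (ball x (2 * R)) E ∧ dens μ E x R ≤ C * η := by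
  obtain ⟨C₁, hC₁⟩ := hX.small_set
  obtain ⟨C₂, -, hC₂⟩ := hX.supCut_appr
  have := hX.isLocallyFinite
  refine ⟨C₁ * C₂, fun A x y R η z ρ e h hy => ?_⟩
  have hR := h.pos
  have hsub : obstacle x R z ρ ⊆ ball x (2 * R) := fun w hw =>
    mem_ball.mpr (hw.2.1.trans (by linarith))
  have hadm : Adm μ (obstacle x R z ρ) (ball x (2 * R)) (supCut (z 0) (ρ 0)) := by
    refine ⟨(measurable_supCut _ _).aemeasurable, Eventually.of_forall fun w =>
      ⟨supCut_nonneg _ _ _, supCut_le_one _ _ _, fun hw => ?_, fun hw => ?_⟩⟩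
    · exact supCut_eq_one (hw.2.2 0 (by simpa using hw.2.1.le))
    · exact supCut_eq_zero (h.nonneg 0) fun hw' => hw (h.dom 0 hw')
  have htv : tv μ (supCut (z 0) (ρ 0)) univ ≤ C₂ * ∑' i, cost μ (z 0 i) (ρ 0 i) :=
    (hC₂ (z 0) (ρ 0) (h.nonneg 0)).tv_le
  have hfin : tv μ (supCut (z 0) (ρ 0)) univ ≠ ⊤ :=
    ne_top_of_le_ne_top (ENNReal.mul_ne_top ENNReal.coe_ne_top (h.cost_ne_top hX 0)) htv
  obtain ⟨E, hEm, hGE, hEΩ, hE⟩ := exists_least_perimeter measurableSet_ball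
    (isOpen_obstacle x R z ρ).measurableSet hsub (hX.ball_ne_top x _) hadm hfin
  refine ⟨E, ⟨hEm, hGE, hEΩ, ne_top_of_le_ne_top hfin (hE _ hadm), hE⟩,
    ENNReal.div_le_of_le_mul ?_⟩
  have hcost := h.cost_le 0
  rw [pow_zero, div_one] at hcost
  calc μ (E ∩ ball x R) ≤ μ E := measure_mono inter_subset_left
    _ ≤ C₁ * ENNReal.ofReal R * tv μ (chi E) univ := hC₁ x y R hR hy E hEm hEΩ
    _ ≤ C₁ * ENNReal.ofReal R * (C₂ * (η * cost μ x R)) :=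
        mul_le_mul_right ((hE _ hadm).trans (htv.trans (mul_le_mul_right
          (hcost.trans (mul_le_mul_left (h.rate_le 0) _)) _))) _
    _ = C₁ * C₂ * η * (ENNReal.ofReal R * cost μ x R) := by ring
    _ = _ := by
        unfold cost
        rw [ENNReal.mul_div_cancel (by simpa using hR) ENNReal.ofReal_ne_top]
        push_cast
        ring

lemma ThinCovers.tendsto_center (h : ThinCovers μ A x R η z ρ e) (hX : MMS μ Cd CP lam)
    {κ C C₈ : ℝ≥0} (hd : DecayConst μ κ C)
    (hC₈ : ∀ (y : X) (r : ℝ), 0 < r → μ (ball y (8 * r)) ≤ C₈ * μ (ball y r))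
    (hη : C * C₈ * η ≤ κ / 2) {E : Set X}
    (hE : LeastPerim μ (obstacle x R z ρ) (ball x (2 * R)) E) (hκ : dens μ E x R ≤ κ) :
    Tendsto (dens μ E x) (𝓝[>] 0) (𝓝 0) ∧
    Tendsto (fun r => ENNReal.ofReal r * tv μ (chi E) (ball x r) / μ (ball x r))
      (𝓝[>] 0) (𝓝 0) := by
  have hR := h.pos
  have hG : ∀ j, obstacle x R z ρ ∩ ball x (R / 8 ^ j) ⊆ ⋃ i, ball (z j i) (ρ j i) :=
    fun j w hw => hw.1.2.2 j (mem_ball.mp hw.2).le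
  have hη' : (C : ℝ≥0∞) * (C₈ * η) ≤ κ / 2 := by
    have : ((C * C₈ * η : ℝ≥0) : ℝ≥0∞) ≤ ((κ / 2 : ℝ≥0) : ℝ≥0∞) := ENNReal.coe_le_coe.mpr hη
    rw [ENNReal.coe_div two_ne_zero] at this
    push_cast at this
    rwa [mul_assoc] at this
  have hκj : ∀ j : ℕ, dens μ E x (R / 8 ^ j) ≤ κ := by
    intro j
    induction j with
    | zero => simpa using hκ
    | succ j ih =>
      have h8 : 8 * (R / 8 ^ (j + 1)) = R / 8 ^ j := by rw [pow_succ]; field_simp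
      have h1 := (hd _ _ E hE x (R / 8 ^ (j + 1)) (z j) (ρ j) (by positivity) (h.nonneg j)
        (by rw [h8]; exact hG j) (h.dom j) (by rw [h8]; exact ih)).1
      rw [h8] at h1
      calc dens μ E x (R / 8 ^ (j + 1)) ≤ _ := h1
        _ ≤ κ / 2 + κ / 2 := add_le_add (ENNReal.div_le_div_right ih _)
            ((mul_le_mul_right ((h.rate hC₈ j).trans
              (mul_le_mul_right (h.rate_le j) _)) _).trans hη')
        _ = κ := ENNReal.add_halves _
  refine DecayConst.tendsto hX hd hE hR h.nonneg hG h.dom ?_ hκj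
  have h1 := ENNReal.Tendsto.const_mul (a := (C₈ : ℝ≥0∞)) h.tendsto (Or.inr ENNReal.coe_ne_top)
  rw [mul_zero] at h1
  exact tendsto_of_tendsto_of_tendsto_of_le_of_le tendsto_const_nhds h1 (fun _ => zero_le)
    (h.rate hC₈)

/-- At points off the enlarged cover where the cover is sparse and the density of `E` is small
at all dyadic scales, the density of `E` vanishes. -/
lemma ThinCovers.upperApprox_le (h : ThinCovers μ A x R η z ρ e) (hX : MMS μ Cd CP lam)
    {κ C : ℝ≥0} (hd : DecayConst μ κ C) {E : Set X}
    (hE : LeastPerim μ (obstacle x R z ρ) (ball x (2 * R)) E) {k : ℕ} {y : X} {s : ℝ} (hs : 0 < s)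
    (hys : ball y s ⊆ closedBall x (R / 8 ^ k))
    (hy : Tendsto (fun s => ENNReal.ofReal s * nearCost μ (z k) (ρ k) (ball y s) / μ (ball y s))
      (𝓝[>] 0) (𝓝 0))
    (hκ : ∀ j : ℕ, dens μ E y (s / 2 ^ j) ≤ κ) : upperApprox μ (chi E) y ≤ 0 := by
  obtain ⟨C₈, -, hC₈⟩ := hX.exists_doubling 8
  have hle : ∀ j : ℕ, s / 8 ^ j ≤ s := fun j => div_le_self hs.le (one_le_pow₀ (by norm_num))
  refine upperApprox_chi_le (DecayConst.tendsto hX hd hE hs (z := fun _ => z k)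
    (ρ := fun j => nearRad (z k) (ρ k) (ball y (s / 8 ^ j)))
    (fun j => nearRad_nonneg (h.nonneg k) _) (fun j => ?_)
    (fun j => (iUnion_nearRad_subset (h.nonneg k) _).trans (h.dom k)) ?_ fun j => ?_).1
  · refine (subset_inter (fun w hw => ?_) inter_subset_right).trans (subset_iUnion_nearRad _ _ _)
    exact hw.1.2.2 k (mem_closedBall.mp (hys (ball_subset_ball (hle j) hw.2)))
  · have hsc : Tendsto (fun j : ℕ => s / 8 ^ j) atTop (𝓝[>] 0) := by
      refine tendsto_nhdsWithin_iff.mpr ⟨tendsto_const_nhds.div_atTop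
        (tendsto_pow_atTop_atTop_of_one_lt (by norm_num)), Eventually.of_forall fun j => ?_⟩
      show 0 < s / 8 ^ j
      positivity
    have h1 := ENNReal.Tendsto.const_mul (a := (C₈ : ℝ≥0∞)) (hy.comp hsc)
      (Or.inr ENNReal.coe_ne_top)
    rw [mul_zero] at h1
    refine tendsto_of_tendsto_of_tendsto_of_le_of_le tendsto_const_nhds h1 (fun _ => zero_le)
      fun j => ?_
    have h8 : s / 8 ^ j = 8 * (s / 8 ^ (j + 1)) := by rw [pow_succ]; field_simp
    have hp : 0 < s / 8 ^ (j + 1) := by positivity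
    refine ENNReal.div_le_of_le_mul ?_
    change ENNReal.ofReal (s / 8 ^ (j + 1)) * nearCost μ (z k) (ρ k) (ball y (s / 8 ^ j)) ≤
      C₈ * (ENNReal.ofReal (s / 8 ^ j) * nearCost μ (z k) (ρ k) (ball y (s / 8 ^ j)) /
        μ (ball y (s / 8 ^ j))) * μ (ball y (s / 8 ^ (j + 1)))
    calc ENNReal.ofReal (s / 8 ^ (j + 1)) * nearCost μ (z k) (ρ k) (ball y (s / 8 ^ j))
        ≤ ENNReal.ofReal (s / 8 ^ j) * nearCost μ (z k) (ρ k) (ball y (s / 8 ^ j)) :=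
          mul_le_mul_left (ENNReal.ofReal_le_ofReal (by linarith)) _
      _ = ENNReal.ofReal (s / 8 ^ j) * nearCost μ (z k) (ρ k) (ball y (s / 8 ^ j)) /
            μ (ball y (s / 8 ^ j)) * μ (ball y (s / 8 ^ j)) := by
          rw [ENNReal.div_mul_cancel (hX.ball_ne_zero y (by positivity)) (hX.ball_ne_top y _)]
      _ ≤ ENNReal.ofReal (s / 8 ^ j) * nearCost μ (z k) (ρ k) (ball y (s / 8 ^ j)) /
            μ (ball y (s / 8 ^ j)) * (C₈ * μ (ball y (s / 8 ^ (j + 1)))) := by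
          refine mul_le_mul_right ?_ _
          nth_rewrite 1 [h8]
          exact hC₈ y _ hp
      _ = _ := by ring
  · have : (8 : ℝ) ^ j = 2 ^ (3 * j) := by rw [pow_mul]; norm_num
    rw [this]
    exact hκ _

lemma ThinCovers.isThinAt (h : ThinCovers μ A x R η z ρ e) (hX : MMS μ Cd CP lam) {κ C : ℝ≥0}
    (hκ0 : 0 < κ) (hκ1 : κ ≤ 1 / 2) (hd : DecayConst μ κ C) {E : Set X}
    (hE : LeastPerim μ (obstacle x R z ρ) (ball x (2 * R)) E)
    (hdens : Tendsto (dens μ E x) (𝓝[>] 0) (𝓝 0))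
    (hper : Tendsto (fun r => ENNReal.ofReal r * tv μ (chi E) (ball x r) / μ (ball x r))
      (𝓝[>] 0) (𝓝 0)) : IsThinAt μ {y | 0 < upperApprox μ (chi E) y} x := by
  have hR := h.pos
  have hlam := hX.hlam
  have : Nonempty X := hX.nontrivial.to_nonempty
  set δ : ℝ := 1 / (192 * lam) with hδ
  have hδ0 : 0 < δ := by positivity
  have hδ1 : 192 * (lam * δ) = 1 := by rw [hδ]; field_simp
  have hδ2 : δ ≤ 1 := by nlinarith
  obtain ⟨Cb, hCb1, hCb⟩ := hX.boxing hκ0 hκ1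
  obtain ⟨Ct, hCt1, hCt⟩ := hX.density_transfer hδ0
  obtain ⟨C₂, hC₂1, hC₂⟩ := hX.cost_mul_le 2 (by norm_num)
  obtain ⟨C₄, hC₄1, hC₄⟩ := hX.cost_mul_le 4 (by norm_num)
  obtain ⟨C₁₆, hC₁₆1, hC₁₆⟩ := hX.cost_mul_le 16 (by norm_num)
  have hne : ∀ {a b : ℝ≥0}, 1 ≤ a → 1 ≤ b → ((a * b : ℝ≥0) : ℝ≥0∞) ≠ 0 := fun ha hb => by
    simpa using ⟨(zero_lt_one.trans_le ha).ne', (zero_lt_one.trans_le hb).ne'⟩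
  refine hX.thin_of_cov fun ε hε => ?_
  have hε3 : ε / 3 ≠ 0 := ENNReal.div_ne_zero.mpr ⟨hε, by norm_num⟩
  have hpos : ∀ a : ℝ≥0, 0 < ε / 3 / a := fun a =>
    pos_iff_ne_zero.mpr (ENNReal.div_ne_zero.mpr ⟨hε3, ENNReal.coe_ne_top⟩)
  have h2 : Tendsto (fun r : ℝ => 2 * r) (𝓝[>] 0) (𝓝[>] 0) := by
    refine tendsto_nhdsWithin_iff.mpr ⟨?_, ?_⟩
    · have : Tendsto (fun r : ℝ => 2 * r) (𝓝 0) (𝓝 (2 * 0)) := tendsto_id.const_mul 2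
      rw [mul_zero] at this
      exact this.mono_left nhdsWithin_le_nhds
    · filter_upwards [self_mem_nhdsWithin] with r hr
      have hr' : 0 < r := hr
      show 0 < 2 * r
      positivity
  have hκt : (0 : ℝ≥0∞) < κ / Ct := ENNReal.div_pos (by simpa using hκ0.ne') ENNReal.coe_ne_top
  filter_upwards [self_mem_nhdsWithin,
    eventually_scale (s := R / 2) (by positivity)
      (h.tendsto.eventually (ge_mem_nhds (hpos (C₄ * C₁₆)))),
    h2.eventually (hdens.eventually (ge_mem_nhds hκt)),
    h2.eventually (hper.eventually (ge_mem_nhds (hpos (Cb * C₂))))] with r hr0 hk hr1 hr2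
  have hr : 0 < r := hr0
  obtain ⟨k, hk1, hk2, hk3⟩ := hk
  have hk1' : R / 8 ^ k < 16 * r := by
    have : R / 2 / 8 ^ (k + 1) = R / 8 ^ k / 16 := by rw [pow_succ]; field_simp; norm_num
    linarith
  have hk2' : 2 * r ≤ R / 8 ^ k := by
    have : R / 2 / 8 ^ k = R / 8 ^ k / 2 := by ring
    linarith
  have hδr : 0 < δ * r := by positivity
  have hcov1 : Cov μ (r / 8) (⋃ i, ball (z k i) (4 * ρ k i)) (ε / 3 * cost μ x r) := by
    refine ⟨z k, fun i => 4 * ρ k i, fun i => ⟨?_, ?_⟩, subset_rfl, ?_⟩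
    · have := h.nonneg k i
      positivity
    · have := h.le k i
      linarith
    · have hbig : cost μ x (R / 8 ^ k) ≤ C₁₆ * cost μ x r :=
        (ENNReal.div_le_div (measure_mono (ball_subset_ball hk1'.le))
          (ENNReal.ofReal_le_ofReal (by linarith))).trans (hC₁₆ x r hr.le).1
      calc ∑' i, cost μ (z k i) (4 * ρ k i) ≤ ∑' i, C₄ * cost μ (z k i) (ρ k i) :=
            ENNReal.tsum_le_tsum fun i => (hC₄ _ _ (h.nonneg k i)).2
        _ = C₄ * ∑' i, cost μ (z k i) (ρ k i) := ENNReal.tsum_mul_left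
        _ ≤ C₄ * (ε / 3 / (C₄ * C₁₆ : ℝ≥0) * (C₁₆ * cost μ x r)) :=
            mul_le_mul_right ((h.cost_le k).trans (mul_le_mul' hk3 hbig)) _
        _ = ε / 3 / (C₄ * C₁₆ : ℝ≥0) * (C₄ * C₁₆ : ℝ≥0) * cost μ x r := by push_cast; ring
        _ = _ := by rw [ENNReal.div_mul_cancel (hne hC₄1 hC₁₆1) ENNReal.coe_ne_top]
  have hcov2 := hX.cov_not_tendsto (h.cost_ne_top hX k) (τ := r / 8) (by positivity)
    (ε := ε / 3 * cost μ x r) (mul_ne_zero hε3 (hX.cost_ne_zero x hr))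
  have hsmall : ∀ y ∈ ball x r, μ (E ∩ ball y (δ * r)) ≤ κ * μ (ball y (δ * r)) := by
    intro y hy
    have h1 : μ (E ∩ ball x (2 * r)) ≤ κ / Ct * μ (ball x (2 * r)) := by
      refine le_trans (le_of_eq ?_) (mul_le_mul_left hr1 _)
      unfold dens
      rw [ENNReal.div_mul_cancel (hX.ball_ne_zero x (by positivity)) (hX.ball_ne_top x _)]
    have h3 := hCt E x y r (2 * r) _ hr le_rfl (by linarith) hδ2 h1 hy
    rwa [ENNReal.mul_div_cancel (by simpa using (zero_lt_one.trans_le hCt1).ne')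
      ENNReal.coe_ne_top] at h3
  have hcov3 := hCb E x r δ hE.meas hr hδ0 (by linarith) hsmall
  have htv : Cb * tv μ (chi E) (ball x (2 * r)) ≤ ε / 3 * cost μ x r := by
    have h1 : tv μ (chi E) (ball x (2 * r)) ≤ ε / 3 / (Cb * C₂ : ℝ≥0) * cost μ x (2 * r) := by
      have hp : 0 < 2 * r := by positivity
      have h0 : ENNReal.ofReal (2 * r) ≠ 0 := by simpa using hr
      have h4 := (ENNReal.div_le_iff (hX.ball_ne_zero x hp) (hX.ball_ne_top x _)).mp hr2
      unfold cost
      rw [← mul_div_assoc, ENNReal.le_div_iff_mul_le (Or.inl h0) (Or.inl ENNReal.ofReal_ne_top),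
        mul_comm]
      exact h4
    calc Cb * tv μ (chi E) (ball x (2 * r))
        ≤ Cb * (ε / 3 / (Cb * C₂ : ℝ≥0) * (C₂ * cost μ x r)) :=
          mul_le_mul_right (h1.trans (mul_le_mul_right (hC₂ x r hr.le).2 _)) _
      _ = ε / 3 / (Cb * C₂ : ℝ≥0) * (Cb * C₂ : ℝ≥0) * cost μ x r := by push_cast; ring
      _ = _ := by rw [ENNReal.div_mul_cancel (hne hCb1 hC₂1) ENNReal.coe_ne_top]
  have hr8 : 24 * lam * (δ * r) = r / 8 := by
    have : 24 * lam * (δ * r) = 192 * (lam * δ) * r / 8 := by ring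
    rw [this, hδ1, one_mul]
  rw [hr8] at hcov3
  refine ((hcov1.union (by positivity) hcov2).union (by positivity) hcov3).mono le_rfl ?_ ?_
  · rintro y ⟨hyS, hyr⟩
    by_contra hy
    rw [mem_union, mem_union, not_or, not_or] at hy
    obtain ⟨⟨hy1, hy2⟩, hy3⟩ := hy
    refine (not_le.mpr (show 0 < upperApprox μ (chi E) y from hyS))
      (h.upperApprox_le hX hd hE (k := k) hδr (fun w hw => ?_) ?_ fun j => ?_)
    · have h5 := mem_ball.mp hw
      have h6 := mem_ball.mp hyr
      have h7 : δ * r ≤ r := mul_le_of_le_one_left hr.le hδ2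
      exact mem_closedBall.mpr (by linarith [dist_triangle w y x])
    · by_contra hnot
      exact hy2 ⟨hy1, hnot⟩
    · by_contra hnot
      refine hy3 ⟨hyr, j, ?_⟩
      by_contra hle
      exact hnot (ENNReal.div_le_of_le_mul (not_lt.mp hle))
  · calc ε / 3 * cost μ x r + ε / 3 * cost μ x r + Cb * tv μ (chi E) (ball x (2 * r))
        ≤ ε / 3 * cost μ x r + ε / 3 * cost μ x r + ε / 3 * cost μ x r := add_le_add le_rfl htv
      _ = (ε / 3 + ε / 3 + ε / 3) * cost μ x r := by ring
      _ = _ := by rw [ENNReal.add_thirds]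

end Construction

/-- **Strengthened weak Cartan property.** If `A` is 1-thin at `x ∉ A`, then there exist
`R > 0` and sets `E₀, E₁ ⊆ X` whose characteristic functions are in `BV(X)` and are
1-superminimizers in `B(x,R)`, with `max {χ_{E₀}^∧, χ_{E₁}^∧} = 1` on `A ∩ B(x,R)`,
`χ_{E₀}^∨(x) = 0 = χ_{E₁}^∨(x)`, the set `{max {χ_{E₀}^∨, χ_{E₁}^∨} > 0}` 1-thin at `x`,
and `r · P(Eᵢ, B(x,r))/μ(B(x,r)) → 0` as `r → 0` for `i = 0,1`. -/
theorem strengthened_weak_cartan_property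
    {X : Type*} [MetricSpace X] [MeasurableSpace X] [BorelSpace X]
    (μ : Measure X) (Cd CP lam : ℝ) (hX : MMS μ Cd CP lam)
    (A : Set X) (x : X) (hxA : x ∉ A) (hthin : IsThinAt μ A x) :
    ∃ R : ℝ, 0 < R ∧ ∃ E₀ E₁ : Set X,
      MemBV μ (chi E₀) Set.univ ∧ MemBV μ (chi E₁) Set.univ ∧
      IsSuperminimizer μ (chi E₀) (Metric.ball x R) ∧
      IsSuperminimizer μ (chi E₁) (Metric.ball x R) ∧
      (∀ y ∈ A ∩ Metric.ball x R,
        max (lowerApprox μ (chi E₀) y) (lowerApprox μ (chi E₁) y) = (1 : EReal)) ∧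
      upperApprox μ (chi E₀) x = (0 : EReal) ∧ upperApprox μ (chi E₁) x = (0 : EReal) ∧
      IsThinAt μ {y : X | (0 : EReal) <
        max (upperApprox μ (chi E₀) y) (upperApprox μ (chi E₁) y)} x ∧
      Filter.Tendsto (fun r : ℝ =>
          ENNReal.ofReal r * perim μ E₀ (Metric.ball x r) / μ (Metric.ball x r))
        (𝓝[>] (0 : ℝ)) (𝓝 0) ∧
      Filter.Tendsto (fun r : ℝ =>
          ENNReal.ofReal r * perim μ E₁ (Metric.ball x r) / μ (Metric.ball x r))
        (𝓝[>] (0 : ℝ)) (𝓝 0) := by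
  have := hX.properSpace
  obtain ⟨κ, C, hκ0, hκ1, hC1, hd⟩ := hX.exists_decayConst
  obtain ⟨C₈, hC₈1, hC₈⟩ := hX.exists_doubling 8
  obtain ⟨Ci, hCi⟩ := hX.exists_leastPerim
  have := hX.nontrivial
  obtain ⟨y, hy⟩ := exists_ne x
  have hy0 : 0 < dist y x := dist_pos.mpr hy
  have hC0 : 0 < C := zero_lt_one.trans_le hC1
  have hC₈0 : 0 < C₈ := zero_lt_one.trans_le hC₈1
  set η : ℝ≥0 := κ / (2 * (C * C₈ + Ci)) with hη
  have hη0 : 0 < η := by positivity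
  have hη1 : C * C₈ * η + Ci * η = κ / 2 := by rw [hη]; field_simp
  obtain ⟨R, hRR, z, ρ, e, h⟩ := hX.exists_thinCovers hthin (R₀ := dist y x / 4) (by positivity)
    hη0
  have hR := h.pos
  obtain ⟨E, hE, hEκ⟩ := hCi A x y R η z ρ e h (by linarith)
  have hκR : dens μ E x R ≤ κ := by
    refine hEκ.trans ?_
    have : Ci * η ≤ κ := by
      calc Ci * η ≤ C * C₈ * η + Ci * η := le_add_self
        _ = κ / 2 := hη1
        _ ≤ κ := half_le_self zero_le
    exact_mod_cast this
  obtain ⟨hdens, hper⟩ := h.tendsto_center hX hd hC₈ (hη1 ▸ le_self_add) hE hκR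
  have hΩ := hX.ball_ne_top x (2 * R)
  have hsup := hE.superminimizer hΩ isOpen_ball (ball_subset_ball (by linarith : R ≤ 2 * R))
  have hup := hX.upperApprox_chi_eq hdens
  have hbv := hE.memBV hΩ
  refine ⟨R, hR, E, E, hbv, hbv, hsup, hsup, fun w hw => ?_, hup, hup, ?_, hper, hper⟩
  · rw [max_self]
    exact hX.lowerApprox_chi_eq (mem_of_superset
      ((isOpen_obstacle x R z ρ).mem_nhds (h.subset_obstacle hxA hw)) hE.subset)
  · simp only [max_self]
    exact h.isThinAt hX hκ0 hκ1 hd hE hdens hper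

end MetricBV
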